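/- arXiv:2411.12958 — 6 statements merged into one kernel-verified Lean document; each statement's English description precedes it below -/
import Mathlib

section
/- For every x ∈ ℝ one has 0.941 < R₀(x) < 1.0925. Moreover, for every real λ with |λ| ≤ 1 and every v ∈ Ỹ, one has 0.94 < R₀(x) + λ·v(x) < 1.1 for all x ∈ ℝ. -/
open Real MeasureTheory intervalIntegral

noncomputable section

/-- The Fourier coefficients `c_k` of the approximate solution. -/
def coefC : ℕ → ℝ
  | 0 => 1
  | 1 => 6.990356082734282e-2
  | 2 => 1.481485591846559e-2
  | 3 => 4.562581793349477e-3
  | 4 => 1.662067385043346e-3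
  | 5 => 6.660065136771192e-4
  | 6 => 2.837414439454572e-4
  | 7 => 1.261501302020939e-4
  | 8 => 5.787204471053671e-5
  | 9 => 2.719406328587438e-5
  | 10 => 1.302302594759571e-5
  | 11 => 6.333059955650702e-6
  | 12 => 3.119022088447539e-6
  | 13 => 1.552543629347692e-6
  | 14 => 7.798356164400106e-7
  | 15 => 3.947768555872326e-7
  | 16 => 2.012104965444521e-7
  | 17 => 1.031670056456975e-7
  | 18 => 5.317712460135162e-8
  | 19 => 2.753934675108659e-8
  | 20 => 1.432242380745116e-8
  | 21 => 7.477109926654982e-9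
  | 22 => 3.916974811811910e-9
  | 23 => 2.058418356388450e-9
  | 24 => 1.084839772995918e-9
  | 25 => 5.732502021897411e-10
  | 26 => 3.036541152512813e-10
  | 27 => 1.612094123238438e-10
  | 28 => 8.576430342713042e-11
  | 29 => 4.571554686889860e-11
  | 30 => 2.441210348018661e-11
  | _ => 0

/-- The approximate solution `R₀(x) = ∑_{k=0}^{30} c_k cos(6 k x)`. -/
def R0 (x : ℝ) : ℝ := ∑ k ∈ Finset.range 31, coefC k * Real.cos (6 * k * x)

/-- Membership in `Ỹ = Ỹ₆^{even, ε}` with `ε = 2·10⁻⁵`: `v(x) = ∫₀ˣ w`, where `w` is odd,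
`π/3`-periodic, locally square-integrable and of (normalized) `L²` norm at most `ε`. -/
def memY (v : ℝ → ℝ) : Prop :=
  ∃ w : ℝ → ℝ,
    (∀ x : ℝ, w (-x) = -w x) ∧
    (∀ x : ℝ, w (x + π / 3) = w x) ∧
    MeasureTheory.LocallyIntegrable (fun y => w y ^ 2) volume ∧
    (1 / Real.sqrt 12) * (∫ y in (-π)..π, w y ^ 2) ^ ((1:ℝ)/2) ≤ 2e-5 ∧
    (∀ x : ℝ, v x = ∫ y in (0:ℝ)..x, w y)

/-- The cosine polynomial of degree six that dominates `R0`, with a positive lower bound. -/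
lemma poly_lower (t : ℝ) (h1 : -1 ≤ t) (h2 : t ≤ 1) :
    0.9413 ≤ 1 + 6.990356082734282e-2 * t + 1.481485591846559e-2 * (2*t^2-1)
      + 4.562581793349477e-3 * (4*t^3-3*t) + 1.662067385043346e-3 * (8*t^4-8*t^2+1)
      + 6.660065136771192e-4 * (16*t^5-20*t^3+5*t)
      + 2.837414439454572e-4 * (32*t^6-48*t^4+18*t^2-1) := by
  rcases le_total 0 t with h | h
  · have a2 := pow_nonneg h 2
    have a3 := pow_nonneg h 3
    have a5 := pow_nonneg h 5
    have a6 := pow_nonneg h 6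
    have a4 : t^4 ≤ 1 := pow_le_one₀ h h2
    linarith
  · obtain ⟨s, rfl⟩ : ∃ s, t = -s := ⟨-t, by ring⟩
    have hs : 0 ≤ s := by linarith
    have hs1 : s ≤ 1 := by linarith
    have b1 : 0 ≤ 1 - s := by linarith
    have e2 : 0 ≤ (1 - s) * (1 - s) := mul_nonneg b1 b1
    have e3 : 0 ≤ (1 - s) * s ^ 2 := mul_nonneg b1 (pow_nonneg hs 2)
    have e4 : 0 ≤ (1 - s) * s ^ 3 := mul_nonneg b1 (pow_nonneg hs 3)
    have e5 : 0 ≤ (1 - s) * s ^ 4 := mul_nonneg b1 (pow_nonneg hs 4)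
    have e6 : 0 ≤ (1 - s) * s ^ 5 := mul_nonneg b1 (pow_nonneg hs 5)
    have e1 : 0 ≤ (1 - s) * s := mul_nonneg b1 hs
    have p6 : 0 ≤ s ^ 6 := pow_nonneg hs 6
    nlinarith

set_option maxHeartbeats 2000000 in
lemma R0_bounds (x : ℝ) : 0.941 < R0 x ∧ R0 x < 1.0925 := by
  have hc : ∀ k : ℕ, -1 ≤ Real.cos (6 * k * x) ∧ Real.cos (6 * k * x) ≤ 1 :=
    fun k => ⟨Real.neg_one_le_cos _, Real.cos_le_one _⟩
  set t := Real.cos (6 * x) with ht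
  have c2 : Real.cos (2 * (6 * x)) = 2 * t^2 - 1 := by rw [Real.cos_two_mul]
  have c3 : Real.cos (3 * (6 * x)) = 4 * t^3 - 3 * t := by rw [Real.cos_three_mul]
  have c4 : Real.cos (2 * (2 * (6 * x))) = 8*t^4-8*t^2+1 := by
    rw [Real.cos_two_mul, c2]; ring
  have c6 : Real.cos (2 * (3 * (6 * x))) = 32*t^6-48*t^4+18*t^2-1 := by
    rw [Real.cos_two_mul, c3]; ring
  have c5 : Real.cos (5 * (6 * x)) = 16*t^5-20*t^3+5*t := by
    have h := Real.cos_add_cos (5 * (6 * x)) (6 * x)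
    rw [show (5 * (6 * x) + 6 * x) / 2 = 3 * (6 * x) by ring,
      show (5 * (6 * x) - 6 * x) / 2 = 2 * (6 * x) by ring, c2, c3, ← ht] at h
    linear_combination h
  have k1 : Real.cos (6 * (1:ℕ) * x) = t := by rw [ht]; congr 1; push_cast; ring
  have k2 : Real.cos (6 * (2:ℕ) * x) = 2 * t^2 - 1 := by
    rw [← c2]; congr 1; push_cast; ring
  have k3 : Real.cos (6 * (3:ℕ) * x) = 4 * t^3 - 3 * t := by
    rw [← c3]; congr 1; push_cast; ring
  have k4 : Real.cos (6 * (4:ℕ) * x) = 8*t^4-8*t^2+1 := by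
    rw [← c4]; congr 1; push_cast; ring
  have k5 : Real.cos (6 * (5:ℕ) * x) = 16*t^5-20*t^3+5*t := by
    rw [← c5]; congr 1; push_cast; ring
  have k6 : Real.cos (6 * (6:ℕ) * x) = 32*t^6-48*t^4+18*t^2-1 := by
    rw [← c6]; congr 1; push_cast; ring
  have k0 : Real.cos (6 * (0:ℕ) * x) = 1 := by simp
  have hnn : ∀ k, 0 ≤ coefC k := by
    intro k; unfold coefC; split <;> norm_num
  have hp := poly_lower t (Real.neg_one_le_cos _) (Real.cos_le_one _)
  constructor
  · have hsplit : R0 x = (∑ k ∈ Finset.range 7, coefC k * Real.cos (6 * k * x))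
        + ∑ k ∈ Finset.Ico 7 31, coefC k * Real.cos (6 * k * x) :=
      (Finset.sum_range_add_sum_Ico _ (by norm_num)).symm
    have htail : ∑ k ∈ Finset.Ico 7 31, -coefC k
        ≤ ∑ k ∈ Finset.Ico 7 31, coefC k * Real.cos (6 * k * x) := by
      apply Finset.sum_le_sum
      intro k _
      nlinarith [hnn k, (hc k).1]
    have hnum : -0.00025 ≤ ∑ k ∈ Finset.Ico 7 31, -coefC k := by
      rw [Finset.sum_Ico_eq_sum_range]
      norm_num [Finset.sum_range_succ, coefC]
    have hhead : ∑ k ∈ Finset.range 7, coefC k * Real.cos (6 * k * x)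
        = 1 + 6.990356082734282e-2 * t + 1.481485591846559e-2 * (2*t^2-1)
      + 4.562581793349477e-3 * (4*t^3-3*t) + 1.662067385043346e-3 * (8*t^4-8*t^2+1)
      + 6.660065136771192e-4 * (16*t^5-20*t^3+5*t)
      + 2.837414439454572e-4 * (32*t^6-48*t^4+18*t^2-1) := by
      simp only [Finset.sum_range_succ, Finset.sum_range_zero, k0, k1, k2, k3, k4, k5, k6, coefC]
      ring
    rw [hsplit, hhead]
    linarith
  · have h : R0 x ≤ ∑ k ∈ Finset.range 31, coefC k := by
      apply Finset.sum_le_sum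
      intro k _
      nlinarith [hnn k, (hc k).2]
    refine lt_of_le_of_lt h ?_
    simp only [Finset.sum_range_succ, Finset.sum_range_zero, coefC]
    norm_num

lemma v_bound (v : ℝ → ℝ) (hv : memY v) (x : ℝ) : |v x| < 0.001 := by
  obtain ⟨w, hodd, hper, hloc, hnorm, hvw⟩ := hv
  have hpi : 0 < π := Real.pi_pos
  have hint : ∀ a b : ℝ, IntervalIntegrable (fun y => w y ^ 2) volume a b := fun a b =>
    (hloc.integrableOn_isCompact isCompact_uIcc).intervalIntegrable
  set I := ∫ y in (-π)..π, w y ^ 2 with hI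
  have hI0 : 0 ≤ I := intervalIntegral.integral_nonneg (by linarith) fun y _ => sq_nonneg _
  have hI1 : I ≤ 4.8e-9 := by
    rw [← Real.sqrt_eq_rpow] at hnorm
    have h12 : 0 < Real.sqrt 12 := Real.sqrt_pos.2 (by norm_num)
    have h : Real.sqrt I ≤ 2e-5 * Real.sqrt 12 := by
      rw [one_div, inv_mul_le_iff₀ h12] at hnorm
      linarith
    have hs := mul_self_le_mul_self (Real.sqrt_nonneg I) h
    have q := Real.mul_self_sqrt (show (0:ℝ) ≤ 12 by norm_num)
    rw [Real.mul_self_sqrt hI0] at hs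
    nlinarith
  -- the direct estimate on one period
  have direct : ∀ x : ℝ, 0 ≤ x → x ≤ π / 3 → |v x| < 0.001 := by
    intro x hx0 hx1
    have hg : IntervalIntegrable (fun y => 20000 * w y ^ 2 + 1 / 80000) volume 0 x :=
      ((hint 0 x).const_mul _).add intervalIntegrable_const
    have h1 := intervalIntegral.norm_integral_le_of_norm_le (f := w) (μ := volume) hx0
      (Filter.Eventually.of_forall fun y _ => by
        show ‖w y‖ ≤ 20000 * w y ^ 2 + 1 / 80000
        rw [Real.norm_eq_abs, ← sq_abs]
        nlinarith [sq_nonneg (|w y| - 1 / 40000)]) hg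
    rw [intervalIntegral.integral_add ((hint 0 x).const_mul _) intervalIntegrable_const,
      intervalIntegral.integral_const_mul, intervalIntegral.integral_const] at h1
    have h2 : ∫ y in (0:ℝ)..x, w y ^ 2 ≤ I :=
      intervalIntegral.integral_mono_interval (by linarith) hx0 (by linarith)
        (Filter.Eventually.of_forall fun y => sq_nonneg (w y)) (hint _ _)
    rw [hvw, ← Real.norm_eq_abs]
    simp only [smul_eq_mul, sub_zero] at h1
    have := Real.pi_lt_four
    linarith
  have heven : ∀ x, v (-x) = v x := by
    intro x
    rw [hvw, hvw]
    have h := intervalIntegral.integral_comp_neg (a := 0) (b := x) w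
    simp only [hodd, neg_zero, intervalIntegral.integral_neg] at h
    rw [intervalIntegral.integral_symm, ← h, neg_neg]
  have hwper : Function.Periodic w (π / 3) := hper
  have main : ∀ x : ℝ, 0 ≤ x → |v x| < 0.001 := by
    intro x hx0
    rcases le_total x (π / 3) with hx | hx
    · exact direct x hx0 hx
    by_cases hw : IntervalIntegrable w volume 0 x
    · have hw3 : IntervalIntegrable w volume 0 (π / 3) := by
        apply hw.mono_set
        rw [Set.uIcc_of_le (by positivity), Set.uIcc_of_le hx0]
        exact Set.Icc_subset_Icc_right hx
      have hall := hwper.intervalIntegrable₀ (by positivity) hw3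
      have hzero : ∫ y in (0:ℝ)..0 + π / 3, w y = 0 := by
        rw [hwper.intervalIntegral_add_eq 0 (-(π / 6))]
        have h := intervalIntegral.integral_comp_neg (a := -(π / 6)) (b := π / 6) w
        simp only [hodd, neg_neg, intervalIntegral.integral_neg] at h
        rw [show -(π / 6) + π / 3 = π / 6 by ring]
        linarith
      have hvper : Function.Periodic v (π / 3) := by
        intro y
        rw [hvw, hvw, hwper.intervalIntegral_add_eq_add 0 y hall, hzero, add_zero]
      obtain ⟨y, hy, hxy⟩ := hvper.exists_mem_Ico₀ (by positivity) x
      rw [hxy]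
      exact direct y hy.1 hy.2.le
    · rw [hvw, intervalIntegral.integral_undef hw]
      norm_num
  rcases le_total 0 x with hx | hx
  · exact main x hx
  · rw [← heven]
    exact main (-x) (by linarith)

/-- Lemma 2.1: bounds on the approximate solution and on its perturbations. -/
theorem stmt_2 :
    (∀ x : ℝ, 0.941 < R0 x ∧ R0 x < 1.0925) ∧
    (∀ lam : ℝ, |lam| ≤ 1 → ∀ v : ℝ → ℝ, memY v →
      ∀ x : ℝ, 0.94 < R0 x + lam * v x ∧ R0 x + lam * v x < 1.1) := by
  refine ⟨R0_bounds, fun lam hlam v hv x => ?_⟩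
  have h1 := R0_bounds x
  have h2 : |lam * v x| < 0.001 := by
    rw [abs_mul]
    exact lt_of_le_of_lt (mul_le_of_le_one_left (abs_nonneg _) hlam) (v_bound v hv x)
  rw [abs_lt] at h2
  constructor <;> linarith [h1.1, h1.2, h2.1, h2.2]
end
end

section
/- For every x ∈ ℝ, |K₁(x)| > 0.1. -/
open Real MeasureTheory intervalIntegral

noncomputable section

/-- The angular velocity `Ω = 1537/3750`. -/
def Om : ℝ := 1537 / 3750

/-- `A[v](x,y)`. -/
def Afun (v : ℝ → ℝ) (x y : ℝ) : ℝ :=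
  (R0 x + v x) ^ 2 + (R0 y + v y) ^ 2 - 2 * (R0 x + v x) * (R0 y + v y) * Real.cos (x - y)

/-- `C[v](x,y)`. -/
def Cfun (v : ℝ → ℝ) (x y : ℝ) : ℝ :=
  (1 / (4 * π * Om)) * Real.cos (x - y) * Real.log (Afun v x y)

/-- `S[v](x,y)`. -/
def Sfun (v : ℝ → ℝ) (x y : ℝ) : ℝ :=
  (1 / (4 * π * Om)) * Real.sin (x - y) * Real.log (Afun v x y)

/-- `A[0](x,y)`. -/
def A0 (x y : ℝ) : ℝ := Afun (fun _ => 0) x y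

/-- `C[0](x,y)`. -/
def C0 (x y : ℝ) : ℝ := Cfun (fun _ => 0) x y

/-- `S[0](x,y)`. -/
def S0 (x y : ℝ) : ℝ := Sfun (fun _ => 0) x y

/-- `K₁(x)`. -/
def K1 (x : ℝ) : ℝ :=
  R0 x + ∫ y in (0:ℝ)..(2 * π), (R0 y * C0 x y - deriv R0 y * S0 x y)


lemma ii_bdd (f : ℝ → ℝ) (hm : Measurable f) (C : ℝ)
    (hb : ∀ v ∈ Set.Ioo (0:ℝ) (2 * π), |f v| ≤ C) :
    IntervalIntegrable f volume 0 (2 * π) := by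
  have hpi : (0:ℝ) ≤ 2 * π := by positivity
  rw [intervalIntegrable_iff_integrableOn_Ioo_of_le hpi]
  refine Measure.integrableOn_of_bounded (M := C) (by simp [ENNReal.mul_eq_top]) hm.aestronglyMeasurable ?_
  exact ae_restrict_of_forall_mem measurableSet_Ioo hb

lemma s_pos {v : ℝ} (hv : v ∈ Set.Ioo (0:ℝ) (2 * π)) : 0 < Real.sin (v / 2) := by
  apply Real.sin_pos_of_pos_of_lt_pi
  · linarith [hv.1]
  · linarith [hv.2]

lemma cos_eq_half (v : ℝ) : Real.cos v = 1 - 2 * Real.sin (v / 2) ^ 2 := by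
  have h := Real.cos_two_mul (v / 2)
  have h2 := Real.sin_sq_add_cos_sq (v / 2)
  rw [show 2 * (v / 2) = v by ring] at h
  linarith

lemma abs_sin_nat_mul_le (n : ℕ) (t : ℝ) : |Real.sin (n * t)| ≤ n * |Real.sin t| := by
  induction n with
  | zero => simp
  | succ n ih =>
    have : Real.sin ((n + 1 : ℕ) * t) =
        Real.sin (n * t) * Real.cos t + Real.cos (n * t) * Real.sin t := by
      rw [← Real.sin_add]; congr 1; push_cast; ring
    rw [this]
    calc _ ≤ |Real.sin (n * t) * Real.cos t| + |Real.cos (n * t) * Real.sin t| := abs_add_le _ _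
      _ ≤ |Real.sin (n * t)| * 1 + 1 * |Real.sin t| := by
        rw [abs_mul, abs_mul]
        gcongr
        · exact Real.abs_cos_le_one _
        · exact Real.abs_cos_le_one _
      _ ≤ _ := by push_cast; linarith

lemma abs_cos_diff (n : ℕ) (x v : ℝ) :
    |Real.cos (n * x) - Real.cos (n * (x + v))| ≤ 2 * n * |Real.sin (v / 2)| := by
  rw [Real.cos_sub_cos]
  have h1 : (n * x - n * (x + v)) / 2 = -(n * (v / 2)) := by ring
  rw [h1, Real.sin_neg]
  have h2 := abs_sin_nat_mul_le n (v / 2)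
  have h3 := Real.abs_sin_le_one ((n * x + n * (x + v)) / 2)
  rw [abs_mul, abs_mul, abs_neg]
  have : |(2:ℝ)| = 2 := by norm_num
  rw [this, abs_neg]
  have h4 : 0 ≤ |Real.sin (n * (v / 2))| := abs_nonneg _
  nlinarith

/-- Fejer-type kernel. -/
def Phi (n : ℕ) (v : ℝ) : ℝ := (1 - Real.cos (n * v)) / (4 * Real.sin (v / 2) ^ 2)

lemma integral_cos_nat (n : ℕ) (hn : n ≠ 0) (p : ℝ) :
    ∫ v in (0:ℝ)..(2 * π), Real.cos (n * v + p) = 0 := by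
  have hn' : (n : ℝ) ≠ 0 := by exact_mod_cast hn
  rw [intervalIntegral.integral_comp_mul_add (fun v => Real.cos v) hn' p, integral_cos]
  have : Real.sin (n * (2 * π) + p) = Real.sin p := by
    rw [add_comm]; exact Real.sin_add_nat_mul_two_pi p n
  rw [this]; simp

lemma Phi_rec (n : ℕ) {v : ℝ} (hv : v ∈ Set.Ioo (0:ℝ) (2 * π)) :
    Phi (n + 2) v = 2 * Phi (n + 1) v - Phi n v + Real.cos ((n + 1 : ℕ) * v + 0) := by
  have hs := s_pos hv
  have hc := cos_eq_half v
  unfold Phi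
  have e1 : Real.cos ((n + 2 : ℕ) * v) = Real.cos ((n + 1 : ℕ) * v) * Real.cos v
      - Real.sin ((n + 1 : ℕ) * v) * Real.sin v := by
    rw [← Real.cos_add]; congr 1; push_cast; ring
  have e2 : Real.cos (n * v) = Real.cos ((n + 1 : ℕ) * v) * Real.cos v
      + Real.sin ((n + 1 : ℕ) * v) * Real.sin v := by
    rw [← Real.cos_sub]; congr 1; push_cast; ring
  rw [e1, e2, hc, add_zero]
  field_simp
  ring

lemma Phi_int (n : ℕ) : (IntervalIntegrable (Phi n) volume 0 (2 * π) ∧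
    ∫ v in (0:ℝ)..(2 * π), Phi n v = π * n) ∧
    (IntervalIntegrable (Phi (n + 1)) volume 0 (2 * π) ∧
    ∫ v in (0:ℝ)..(2 * π), Phi (n + 1) v = π * (n + 1 : ℕ)) := by
  have hpi : (0:ℝ) ≤ 2 * π := by positivity
  induction n with
  | zero =>
    have h0 : Phi 0 = fun _ => 0 := by ext v; simp [Phi]
    have h1 : Set.EqOn (fun _ => (1/2:ℝ)) (Phi 1) (Set.uIoo 0 (2 * π)) := by
      rw [Set.uIoo_of_le hpi]
      intro v hv
      have hs := s_pos hv
      simp only [Phi, Nat.cast_one, one_mul]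
      rw [cos_eq_half v]; field_simp; ring
    refine ⟨⟨?_, ?_⟩, ?_, ?_⟩
    · rw [h0]; exact intervalIntegrable_const
    · rw [h0]; simp
    · exact IntervalIntegrable.congr_uIoo intervalIntegrable_const h1
    · rw [zero_add, ← intervalIntegral.integral_congr_uIoo h1]; simp; ring
  | succ n ih =>
    refine ⟨ih.2, ?_⟩
    have h1 : Set.EqOn (fun v => 2 * Phi (n + 1) v - Phi n v + Real.cos ((n + 1 : ℕ) * v + 0))
        (Phi (n + 1 + 1)) (Set.uIoo 0 (2 * π)) := by
      rw [Set.uIoo_of_le hpi]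
      intro v hv
      exact (Phi_rec n hv).symm
    have hc : IntervalIntegrable (fun v : ℝ => Real.cos ((n + 1 : ℕ) * v + 0)) volume 0 (2 * π) := by
      apply Continuous.intervalIntegrable; fun_prop
    have hd := (ih.2.1.const_mul 2).sub ih.1.1
    refine ⟨IntervalIntegrable.congr_uIoo (hd.add hc) h1, ?_⟩
    rw [← intervalIntegral.integral_congr_uIoo h1, intervalIntegral.integral_add hd hc,
      intervalIntegral.integral_sub (ih.2.1.const_mul 2) ih.1.1,
      intervalIntegral.integral_const_mul, ih.2.2, ih.1.2, integral_cos_nat _ (Nat.succ_ne_zero n)]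
    push_cast; ring

/-- The bilinear kernel. -/
def Pker (n m : ℕ) (x v : ℝ) : ℝ :=
  (Real.cos (n * x) - Real.cos (n * (x + v))) * (Real.cos (m * x) - Real.cos (m * (x + v))) /
    (4 * Real.sin (v / 2) ^ 2)

lemma Pker_ii (n m : ℕ) (x : ℝ) : IntervalIntegrable (Pker n m x) volume 0 (2 * π) := by
  apply ii_bdd _ _ (n * m : ℝ)
  · intro v hv
    have hs := s_pos hv
    have h1 := abs_cos_diff n x v
    have h2 := abs_cos_diff m x v
    rw [abs_of_pos hs] at h1 h2
    unfold Pker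
    rw [abs_div, abs_mul, abs_of_pos (by positivity : (0:ℝ) < 4 * Real.sin (v / 2) ^ 2),
      div_le_iff₀ (by positivity)]
    calc _ ≤ (2 * n * Real.sin (v / 2)) * (2 * m * Real.sin (v / 2)) := by gcongr
      _ = _ := by ring
  · unfold Pker; fun_prop

lemma Pker_sym (n d : ℕ) (x v : ℝ) :
    Pker n (n + d) x v + Pker n (n + d) x (2 * π - v) =
      Real.cos ((n + (n + d) : ℕ) * x) * (Phi n v + Phi (n + d) v - Phi (n + (n + d)) v) +
      Real.cos (d * x) * (Phi n v + Phi (n + d) v - Phi d v) := by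
  have hs : Real.sin ((2 * π - v) / 2) = Real.sin (v / 2) := by
    rw [show (2 * π - v) / 2 = π - v / 2 by ring, Real.sin_pi_sub]
  have hk : ∀ k : ℕ, Real.cos (k * (x + (2 * π - v))) = Real.cos (k * x - k * v) := by
    intro k
    rw [show (k * (x + (2 * π - v)) : ℝ) = (k * x - k * v) + k * (2 * π) by ring]
    exact Real.cos_add_nat_mul_two_pi _ k
  unfold Pker Phi
  rw [hs, hk, hk, ← add_div, ← add_div, ← sub_div, ← sub_div, ← mul_div_assoc,
    ← mul_div_assoc, ← add_div]
  congr 1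
  have a1 : Real.cos ((n + (n + d) : ℕ) * x) = Real.cos (n * x) * Real.cos ((n + d : ℕ) * x)
      - Real.sin (n * x) * Real.sin ((n + d : ℕ) * x) := by
    rw [← Real.cos_add]; congr 1; push_cast; ring
  have a2 : Real.cos ((n + (n + d) : ℕ) * v) = Real.cos (n * v) * Real.cos ((n + d : ℕ) * v)
      - Real.sin (n * v) * Real.sin ((n + d : ℕ) * v) := by
    rw [← Real.cos_add]; congr 1; push_cast; ring
  have a3 : Real.cos (d * x) = Real.cos ((n + d : ℕ) * x) * Real.cos (n * x)
      + Real.sin ((n + d : ℕ) * x) * Real.sin (n * x) := by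
    rw [← Real.cos_sub]; congr 1; push_cast; ring
  have a4 : Real.cos (d * v) = Real.cos ((n + d : ℕ) * v) * Real.cos (n * v)
      + Real.sin ((n + d : ℕ) * v) * Real.sin (n * v) := by
    rw [← Real.cos_sub]; congr 1; push_cast; ring
  rw [a1, a2, a3, a4, mul_add, mul_add, Real.cos_add, Real.cos_add, Real.cos_sub, Real.cos_sub]
  have t1 := Real.sin_sq_add_cos_sq (n * x)
  have t2 := Real.sin_sq_add_cos_sq (n * v)
  have t3 := Real.sin_sq_add_cos_sq ((n + d : ℕ) * x)
  have t4 := Real.sin_sq_add_cos_sq ((n + d : ℕ) * v)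
  ring

lemma Pker_int_aux (n d : ℕ) (x : ℝ) :
    ∫ v in (0:ℝ)..(2 * π), Pker n (n + d) x v = π * n * Real.cos (d * x) := by
  have h1 : ∫ v in (0:ℝ)..(2 * π), Pker n (n + d) x (2 * π - v) =
      ∫ v in (0:ℝ)..(2 * π), Pker n (n + d) x v := by
    rw [intervalIntegral.integral_comp_sub_left]; simp
  have hii := Pker_ii n (n + d) x
  have hii2 : IntervalIntegrable (fun v => Pker n (n + d) x (2 * π - v)) volume 0 (2 * π) := by
    have := hii.comp_sub_left (2 * π)
    simpa using this.symm
  have h2 : ∫ v in (0:ℝ)..(2 * π), (Pker n (n + d) x v + Pker n (n + d) x (2 * π - v)) =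
      2 * ∫ v in (0:ℝ)..(2 * π), Pker n (n + d) x v := by
    rw [intervalIntegral.integral_add hii hii2, h1]; ring
  have i1 := (Phi_int n).1.1
  have i2 := (Phi_int (n + d)).1.1
  have i3 := (Phi_int (n + (n + d))).1.1
  have i4 := (Phi_int d).1.1
  have h3 : ∫ v in (0:ℝ)..(2 * π), (Pker n (n + d) x v + Pker n (n + d) x (2 * π - v)) =
      2 * (π * n * Real.cos (d * x)) := by
    simp_rw [Pker_sym]
    rw [intervalIntegral.integral_add (((i1.add i2).sub i3).const_mul _)
      (((i1.add i2).sub i4).const_mul _), intervalIntegral.integral_const_mul,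
      intervalIntegral.integral_const_mul, intervalIntegral.integral_sub (i1.add i2) i3,
      intervalIntegral.integral_sub (i1.add i2) i4, intervalIntegral.integral_add i1 i2,
      (Phi_int n).1.2, (Phi_int (n + d)).1.2, (Phi_int (n + (n + d))).1.2, (Phi_int d).1.2]
    push_cast; ring
  linarith

lemma Pker_int_le (n m : ℕ) (x : ℝ) :
    ∫ v in (0:ℝ)..(2 * π), Pker n m x v ≤ π * (min n m : ℕ) := by
  have key : ∀ n d : ℕ, ∫ v in (0:ℝ)..(2 * π), Pker n (n + d) x v ≤ π * n := by
    intro n d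
    rw [Pker_int_aux]
    have := Real.cos_le_one (d * x)
    have h : 0 ≤ π * n := by positivity
    nlinarith
  rcases le_total n m with h | h
  · obtain ⟨d, rfl⟩ := Nat.exists_eq_add_of_le h
    simpa using key n d
  · obtain ⟨d, rfl⟩ := Nat.exists_eq_add_of_le h
    have e : Pker (m + d) m x = Pker m (m + d) x := by ext v; unfold Pker; ring
    rw [e]
    simpa using key m d

lemma ii_sum (n : ℕ) (f : ℕ → ℝ → ℝ)
    (h : ∀ i ∈ Finset.range n, IntervalIntegrable (f i) volume 0 (2 * π)) :
    IntervalIntegrable (fun v => ∑ i ∈ Finset.range n, f i v) volume 0 (2 * π) := by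
  have := IntervalIntegrable.sum (Finset.range n) h
  have e : (∑ i ∈ Finset.range n, f i) = fun v => ∑ i ∈ Finset.range n, f i v := by
    ext v; simp
  rwa [e] at this

lemma coefC_nonneg (k : ℕ) : 0 ≤ coefC k := by
  unfold coefC; split <;> norm_num

lemma sum_coefC : ∑ k ∈ Finset.range 31, coefC k ≤ 1.09213 := by
  simp only [Finset.sum_range_succ, Finset.sum_range_zero, coefC]; norm_num

lemma sum_kcoefC : ∑ k ∈ Finset.range 31, coefC k * (6 * k) ≤ 0.761 := by
  simp only [Finset.sum_range_succ, Finset.sum_range_zero, coefC]; norm_num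

/-- Integer upper bounds for `10 ^ 9 * coefC k`. -/
def coefN : ℕ → ℕ
  | 0 => 1000000000
  | 1 => 69903561
  | 2 => 14814856
  | 3 => 4562582
  | 4 => 1662068
  | 5 => 666007
  | 6 => 283742
  | 7 => 126151
  | 8 => 57873
  | 9 => 27195
  | 10 => 13024
  | 11 => 6334
  | 12 => 3120
  | 13 => 1553
  | 14 => 780
  | 15 => 395
  | 16 => 202
  | 17 => 104
  | 18 => 54
  | 19 => 28
  | 20 => 15
  | 21 => 8
  | 22 => 4
  | 23 => 3
  | 24 => 2
  | 25 => 1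
  | 26 => 1
  | 27 => 1
  | 28 => 1
  | 29 => 1
  | 30 => 1
  | _ => 0

lemma coefC_le_coefN (k : ℕ) : coefC k ≤ (coefN k : ℝ) / 10 ^ 9 := by
  unfold coefC coefN; split <;> norm_num

lemma sum_minN : ∑ k ∈ Finset.range 31, ∑ l ∈ Finset.range 31,
    coefN k * coefN l * min (6 * k) (6 * l) ≤ 54290000000000000 := by
  decide +kernel

lemma sum_minC : ∑ k ∈ Finset.range 31, ∑ l ∈ Finset.range 31,
    coefC k * coefC l * ((min (6 * k) (6 * l) : ℕ) : ℝ) ≤ 0.05429 := by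
  have h : ((∑ k ∈ Finset.range 31, ∑ l ∈ Finset.range 31,
      coefN k * coefN l * min (6 * k) (6 * l) : ℕ) : ℝ) ≤ ((54290000000000000 : ℕ) : ℝ) :=
    Nat.cast_le.mpr sum_minN
  have h1 : ∑ k ∈ Finset.range 31, ∑ l ∈ Finset.range 31,
      coefC k * coefC l * ((min (6 * k) (6 * l) : ℕ) : ℝ) ≤
      ∑ k ∈ Finset.range 31, ∑ l ∈ Finset.range 31,
      ((coefN k * coefN l * min (6 * k) (6 * l) : ℕ) : ℝ) / 10 ^ 18 := by
    apply Finset.sum_le_sum; intro k _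
    apply Finset.sum_le_sum; intro l _
    have a := mul_le_mul (coefC_le_coefN k) (coefC_le_coefN l) (coefC_nonneg l) (by positivity)
    have b := mul_le_mul_of_nonneg_right a (Nat.cast_nonneg (α := ℝ) (min (6 * k) (6 * l)))
    refine b.trans (le_of_eq ?_)
    rw [Nat.cast_mul, Nat.cast_mul]
    ring
  simp_rw [← Finset.sum_div, ← Nat.cast_sum] at h1
  refine h1.trans ?_
  rw [div_le_iff₀ (by norm_num)]
  refine h.trans ?_
  norm_num

/-- The derivative of `R0`. -/
def R1 (x : ℝ) : ℝ := ∑ k ∈ Finset.range 31, coefC k * (-Real.sin (6 * k * x) * (6 * k))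

lemma R0_hasDerivAt (x : ℝ) : HasDerivAt R0 (R1 x) x := by
  unfold R0 R1
  apply HasDerivAt.fun_sum
  intro k _
  apply HasDerivAt.const_mul
  have h : HasDerivAt (fun y : ℝ => 6 * (k:ℝ) * y) (6 * k) x := by
    simpa using (hasDerivAt_id x).const_mul (6 * (k:ℝ))
  exact h.cos

lemma R0_deriv : deriv R0 = R1 := by
  ext x; exact (R0_hasDerivAt x).deriv

@[fun_prop]
lemma R0_cont : Continuous R0 := by unfold R0; fun_prop

@[fun_prop]
lemma R1_cont : Continuous R1 := by unfold R1; fun_prop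

lemma R0_eq (x : ℝ) :
    R0 x = ∑ k ∈ Finset.range 31, coefC k * Real.cos ((6 * k : ℕ) * x) := by
  unfold R0; push_cast; rfl

lemma R0_le (x : ℝ) : R0 x ≤ 1.09213 := by
  refine le_trans ?_ sum_coefC
  unfold R0
  apply Finset.sum_le_sum
  intro k _
  nlinarith [coefC_nonneg k, Real.cos_le_one (6 * k * x)]

lemma R0_ge (x : ℝ) : 0.9078 ≤ R0 x := by
  have h : ∀ k, -coefC k ≤ coefC k * Real.cos (6 * k * x) := by
    intro k
    nlinarith [coefC_nonneg k, Real.neg_one_le_cos (6 * k * x)]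
  have h1 := sum_coefC
  unfold R0
  rw [Finset.sum_range_succ'] at h1 ⊢
  have h2 : ∑ k ∈ Finset.range 30, -coefC (k + 1) ≤
      ∑ k ∈ Finset.range 30, coefC (k + 1) * Real.cos (6 * ((k + 1 : ℕ) : ℝ) * x) :=
    Finset.sum_le_sum (fun k _ => h (k + 1))
  rw [Finset.sum_neg_distrib] at h2
  have h0 : coefC 0 = 1 := rfl
  simp only [h0] at h1 ⊢
  simp only [Nat.cast_zero, mul_zero, zero_mul, Real.cos_zero, mul_one]
  norm_num at h1 ⊢
  norm_num at h2
  linarith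

lemma R1_abs (x : ℝ) : |R1 x| ≤ 0.761 := by
  refine le_trans ?_ sum_kcoefC
  unfold R1
  refine le_trans (Finset.abs_sum_le_sum_abs _ _) ?_
  apply Finset.sum_le_sum
  intro k _
  rw [abs_mul, abs_mul, abs_neg, abs_of_nonneg (coefC_nonneg k),
    abs_of_nonneg (by positivity : (0:ℝ) ≤ 6 * k)]
  apply mul_le_mul_of_nonneg_left _ (coefC_nonneg k)
  have := Real.abs_sin_le_one (6 * k * x)
  have h2 : (0:ℝ) ≤ 6 * k := by positivity
  nlinarith

lemma R0_diff (x v : ℝ) : |R0 x - R0 (x + v)| ≤ 2 * |Real.sin (v / 2)| := by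
  have e : R0 x - R0 (x + v) = ∑ k ∈ Finset.range 31,
      coefC k * (Real.cos ((6 * k : ℕ) * x) - Real.cos ((6 * k : ℕ) * (x + v))) := by
    rw [R0_eq, R0_eq, ← Finset.sum_sub_distrib]
    apply Finset.sum_congr rfl; intros; ring
  rw [e]
  calc _ ≤ ∑ k ∈ Finset.range 31, coefC k * (6 * k) * (2 * |Real.sin (v / 2)|) := by
        refine le_trans (Finset.abs_sum_le_sum_abs _ _) ?_
        apply Finset.sum_le_sum
        intro k _
        rw [abs_mul, abs_of_nonneg (coefC_nonneg k), mul_assoc]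
        apply mul_le_mul_of_nonneg_left _ (coefC_nonneg k)
        have := abs_cos_diff (6 * k) x v
        push_cast at this ⊢
        linarith
    _ = (∑ k ∈ Finset.range 31, coefC k * (6 * k)) * (2 * |Real.sin (v / 2)|) := by
        rw [Finset.sum_mul]
    _ ≤ 1 * (2 * |Real.sin (v / 2)|) := by
        gcongr
        exact sum_kcoefC.trans (by norm_num)
    _ = _ := by ring

lemma R0_per : Function.Periodic R0 (2 * π) := by
  intro x
  rw [R0_eq, R0_eq]
  apply Finset.sum_congr rfl
  intro k _
  rw [mul_add, Real.cos_add_nat_mul_two_pi]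

lemma R1_per : Function.Periodic R1 (2 * π) := by
  intro x
  unfold R1
  apply Finset.sum_congr rfl
  intro k _
  have : Real.sin (6 * k * (x + 2 * π)) = Real.sin (6 * k * x) := by
    have := Real.sin_add_nat_mul_two_pi (6 * k * x) (6 * k)
    rw [← this]; congr 1; push_cast; ring
  rw [this]

lemma R0_int (x : ℝ) : ∫ v in (0:ℝ)..(2 * π), R0 (x + v) = 2 * π := by
  simp_rw [R0_eq]
  rw [intervalIntegral.integral_finsetSum
    (fun k _ => by apply Continuous.intervalIntegrable; fun_prop)]
  rw [Finset.sum_range_succ', Finset.sum_eq_zero]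
  · have h0 : coefC 0 = 1 := rfl
    simp [h0]
  · intro k _
    rw [intervalIntegral.integral_const_mul]
    have := integral_cos_nat (6 * (k + 1)) (by omega) ((6 * (k + 1) : ℕ) * x)
    simp_rw [mul_add (((6 * (k + 1) : ℕ) : ℝ)) x, add_comm (((6 * (k + 1) : ℕ) : ℝ) * x), this]
    simp

lemma R0_int_cos (x : ℝ) : ∫ v in (0:ℝ)..(2 * π), R0 (x + v) * Real.cos v = 0 := by
  simp_rw [R0_eq, Finset.sum_mul]
  rw [intervalIntegral.integral_finsetSum
    (fun k _ => by apply Continuous.intervalIntegrable; fun_prop)]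
  apply Finset.sum_eq_zero
  intro k _
  rcases Nat.eq_zero_or_pos k with rfl | hk
  · simp
  · have e : ∀ v : ℝ, coefC k * Real.cos ((6 * k : ℕ) * (x + v)) * Real.cos v =
        coefC k / 2 * (Real.cos ((6 * k + 1 : ℕ) * v + (6 * k : ℕ) * x) +
          Real.cos ((6 * k - 1 : ℕ) * v + (6 * k : ℕ) * x)) := by
      intro v
      have e1 : ((6 * k + 1 : ℕ) : ℝ) * v + (6 * k : ℕ) * x = (6 * k : ℕ) * (x + v) + v := by
        push_cast; ring
      have e2 : ((6 * k - 1 : ℕ) : ℝ) * v + (6 * k : ℕ) * x = (6 * k : ℕ) * (x + v) - v := by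
        rw [Nat.cast_sub (by omega)]
        push_cast; ring
      rw [e1, e2, Real.cos_add, Real.cos_sub]; ring
    simp_rw [e]
    rw [intervalIntegral.integral_const_mul, intervalIntegral.integral_add,
      integral_cos_nat _ (by omega), integral_cos_nat _ (by omega)]
    · simp
    · apply Continuous.intervalIntegrable; fun_prop
    · apply Continuous.intervalIntegrable; fun_prop

/-- The quadratic kernel. -/
def Nker (x v : ℝ) : ℝ := (R0 x - R0 (x + v)) ^ 2 / (4 * Real.sin (v / 2) ^ 2)

lemma Nker_eq (x v : ℝ) : Nker x v = ∑ k ∈ Finset.range 31, ∑ l ∈ Finset.range 31,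
    coefC k * coefC l * Pker (6 * k) (6 * l) x v := by
  have e : R0 x - R0 (x + v) = ∑ k ∈ Finset.range 31,
      coefC k * (Real.cos ((6 * k : ℕ) * x) - Real.cos ((6 * k : ℕ) * (x + v))) := by
    rw [R0_eq, R0_eq, ← Finset.sum_sub_distrib]
    apply Finset.sum_congr rfl; intros; ring
  unfold Nker Pker
  rw [e, sq, Finset.sum_mul_sum, Finset.sum_div]
  apply Finset.sum_congr rfl; intro k _
  rw [Finset.sum_div]
  apply Finset.sum_congr rfl; intro l _
  ring

lemma Nker_ii (x : ℝ) : IntervalIntegrable (Nker x) volume 0 (2 * π) := by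
  have : Nker x = fun v => ∑ k ∈ Finset.range 31, ∑ l ∈ Finset.range 31,
    coefC k * coefC l * Pker (6 * k) (6 * l) x v := by ext v; exact Nker_eq x v
  rw [this]
  apply ii_sum; intro k _
  apply ii_sum; intro l _
  exact (Pker_ii _ _ x).const_mul _

lemma Nker_int (x : ℝ) : ∫ v in (0:ℝ)..(2 * π), Nker x v ≤ π * 0.05429 := by
  simp_rw [Nker_eq]
  rw [intervalIntegral.integral_finsetSum]
  · calc _ ≤ ∑ k ∈ Finset.range 31, ∑ l ∈ Finset.range 31,
          π * (coefC k * coefC l * ((min (6 * k) (6 * l) : ℕ) : ℝ)) := by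
          apply Finset.sum_le_sum; intro k _
          rw [intervalIntegral.integral_finsetSum
            (fun l _ => (Pker_ii _ _ x).const_mul _)]
          apply Finset.sum_le_sum; intro l _
          rw [intervalIntegral.integral_const_mul]
          have := Pker_int_le (6 * k) (6 * l) x
          have h := mul_le_mul_of_nonneg_left this (mul_nonneg (coefC_nonneg k) (coefC_nonneg l))
          linarith
      _ = π * ∑ k ∈ Finset.range 31, ∑ l ∈ Finset.range 31,
          (coefC k * coefC l * ((min (6 * k) (6 * l) : ℕ) : ℝ)) := by
          simp_rw [Finset.mul_sum]
      _ ≤ _ := by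
          apply mul_le_mul_of_nonneg_left sum_minC Real.pi_pos.le
  · intro k _
    apply ii_sum; intro l _
    exact (Pker_ii _ _ x).const_mul _

/-- The weight of the integral after the shift `y = x + v`. -/
def gker (x v : ℝ) : ℝ := R0 (x + v) * Real.cos v + R1 (x + v) * Real.sin v

@[fun_prop]
lemma gker_cont (x : ℝ) : Continuous (gker x) := by unfold gker; fun_prop

lemma R0s_hasDerivAt (x v : ℝ) : HasDerivAt (fun v => R0 (x + v)) (R1 (x + v)) v := by
  exact (R0_hasDerivAt (x + v)).comp_const_add x v

lemma R0s_end (x : ℝ) : R0 (x + 2 * π) = R0 x := R0_per x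

lemma R0_pos (x : ℝ) : 0 < R0 x := lt_of_lt_of_le (by norm_num) (R0_ge x)

lemma gker_int (x : ℝ) : ∫ v in (0:ℝ)..(2 * π), gker x v = 0 := by
  have hd : ∀ v ∈ Set.uIcc (0:ℝ) (2 * π),
      HasDerivAt (fun v => R0 (x + v) * Real.sin v) (gker x v) v := by
    intro v _
    have := (R0s_hasDerivAt x v).mul (Real.hasDerivAt_sin v)
    refine this.congr_deriv ?_
    unfold gker; ring
  rw [intervalIntegral.integral_eq_sub_of_hasDerivAt hd
    ((gker_cont x).intervalIntegrable _ _)]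
  simp

lemma R1_int_sin (x : ℝ) : ∫ v in (0:ℝ)..(2 * π), R1 (x + v) * Real.sin v = 0 := by
  have h := gker_int x
  unfold gker at h
  rw [intervalIntegral.integral_add, R0_int_cos] at h
  · linarith
  · apply Continuous.intervalIntegrable; fun_prop
  · apply Continuous.intervalIntegrable; fun_prop

lemma logR_cont (x : ℝ) : Continuous (fun v => Real.log (R0 (x + v))) := by
  apply Continuous.log
  · fun_prop
  · intro v; exact (R0_pos _).ne'

lemma gker_int_log (x : ℝ) :
    ∫ v in (0:ℝ)..(2 * π), gker x v * Real.log (R0 (x + v)) = 0 := by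
  have hd : ∀ v ∈ Set.uIcc (0:ℝ) (2 * π),
      HasDerivAt (fun v => R0 (x + v) * Real.sin v * Real.log (R0 (x + v)))
        (gker x v * Real.log (R0 (x + v)) + R1 (x + v) * Real.sin v) v := by
    intro v _
    have h0 := (R0_pos (x + v)).ne'
    have := ((R0s_hasDerivAt x v).mul (Real.hasDerivAt_sin v)).mul
      ((R0s_hasDerivAt x v).log h0)
    refine this.congr_deriv ?_
    unfold gker
    simp only [Pi.mul_apply]
    field_simp
    ring
  have c1 : Continuous (fun v => gker x v * Real.log (R0 (x + v))) :=
    (gker_cont x).mul (logR_cont x)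
  have c2 : Continuous (fun v => R1 (x + v) * Real.sin v) := by fun_prop
  have h := intervalIntegral.integral_eq_sub_of_hasDerivAt hd
    ((c1.add c2).intervalIntegrable _ _)
  rw [intervalIntegral.integral_add (c1.intervalIntegrable _ _) (c2.intervalIntegrable _ _),
    R1_int_sin] at h
  simpa using h

lemma logs_ii (x : ℝ) : IntervalIntegrable
    (fun v => gker x v * Real.log (4 * Real.sin (v / 2) ^ 2)) volume 0 (2 * π) := by
  have h1 : IntervalIntegrable (fun v => Real.log (Real.sin ((1/2) * v))) volume 0 (2 * π) := by
    have := (intervalIntegrable_log_sin (a := 0) (b := π)).comp_mul_left (c := 1/2)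
    simp only [Function.comp] at this
    convert this using 1
    · simp
    · field_simp
  have h2 : IntervalIntegrable (fun v => gker x v * (Real.log 4 + 2 * Real.log (Real.sin ((1/2) * v))))
      volume 0 (2 * π) := by
    apply IntervalIntegrable.continuousOn_mul
    · exact intervalIntegrable_const.add (h1.const_mul 2)
    · exact (gker_cont x).continuousOn
  refine h2.congr_uIoo ?_
  rw [Set.uIoo_of_le (by positivity)]
  intro v hv
  have hs := s_pos hv
  simp only
  rw [Real.log_mul (by norm_num) (by positivity), Real.log_pow,
    show (1/2) * v = v / 2 by ring]
  norm_num

lemma gker_int_logs (x : ℝ) :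
    ∫ v in (0:ℝ)..(2 * π), gker x v * Real.log (4 * Real.sin (v / 2) ^ 2) = -(2 * π) := by
  have hpi : (0:ℝ) ≤ 2 * π := by positivity
  have hH : ∀ v, R0 (x + v) * Real.sin v * Real.log (4 * Real.sin (v / 2) ^ 2) =
      2 * R0 (x + v) * Real.cos (v / 2) *
        ((2 * Real.sin (v / 2)) * Real.log (2 * Real.sin (v / 2))) := by
    intro v
    have e1 : Real.sin v = 2 * Real.sin (v / 2) * Real.cos (v / 2) := by
      rw [← Real.sin_two_mul]; congr 1; ring
    have e2 : 4 * Real.sin (v / 2) ^ 2 = (2 * Real.sin (v / 2)) ^ 2 := by ring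
    rw [e2, Real.log_pow, e1]; push_cast; ring
  have hc : Continuous (fun v => R0 (x + v) * Real.sin v * Real.log (4 * Real.sin (v / 2) ^ 2)) := by
    simp_rw [hH]
    have h1 : Continuous (fun v : ℝ => (2 * Real.sin (v / 2)) * Real.log (2 * Real.sin (v / 2))) :=
      Real.continuous_mul_log.comp (by fun_prop : Continuous (fun v : ℝ => 2 * Real.sin (v / 2)))
    exact Continuous.mul (by fun_prop) h1
  have hd : ∀ v ∈ Set.Ioo (0:ℝ) (2 * π),
      HasDerivAt (fun v => R0 (x + v) * Real.sin v * Real.log (4 * Real.sin (v / 2) ^ 2))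
        (gker x v * Real.log (4 * Real.sin (v / 2) ^ 2) +
          (R0 (x + v) + R0 (x + v) * Real.cos v)) v := by
    intro v hv
    have hs := s_pos hv
    have hsd : HasDerivAt (fun v : ℝ => Real.sin (v / 2)) (Real.cos (v / 2) * (1 / 2)) v :=
      ((hasDerivAt_id v).div_const 2).sin
    have h4 : HasDerivAt (fun v : ℝ => 4 * Real.sin (v / 2) ^ 2)
        (4 * (2 * Real.sin (v / 2) * (Real.cos (v / 2) * (1 / 2)))) v := by
      have := (hsd.pow 2).const_mul 4
      refine this.congr_deriv ?_
      norm_num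
    have := ((R0s_hasDerivAt x v).mul (Real.hasDerivAt_sin v)).mul
      (h4.log (by positivity))
    refine this.congr_deriv ?_
    unfold gker
    simp only [Pi.mul_apply]
    have e1 : Real.sin v = 2 * Real.sin (v / 2) * Real.cos (v / 2) := by
      rw [← Real.sin_two_mul]; congr 1; ring
    have e3 := Real.sin_sq_add_cos_sq (v / 2)
    have e2 : Real.cos v = 2 * Real.cos (v / 2) ^ 2 - 1 := by
      rw [cos_eq_half]; linarith
    rw [e1, e2]
    field_simp
    ring
  have c2 : Continuous (fun v => R0 (x + v)) := by fun_prop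
  have c3 : Continuous (fun v => R0 (x + v) * Real.cos v) := by fun_prop
  have i23 := (c2.intervalIntegrable (μ := volume) 0 (2 * π)).add
    (c3.intervalIntegrable (μ := volume) 0 (2 * π))
  have h := intervalIntegral.integral_eq_sub_of_hasDerivAt_of_le hpi hc.continuousOn hd
    ((logs_ii x).add i23)
  rw [intervalIntegral.integral_add (logs_ii x) i23,
    intervalIntegral.integral_add (c2.intervalIntegrable _ _) (c3.intervalIntegrable _ _),
    R0_int, R0_int_cos] at h
  simp at h
  linarith

/-- Primitive of `(ρ - r)^2 / r`. -/
def Fr (p r : ℝ) : ℝ := p ^ 2 * (Real.log r - Real.log p) - 2 * p * (r - p) + (r ^ 2 - p ^ 2) / 2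

lemma Fr_deriv (p r : ℝ) (hr : 0 < r) : HasDerivAt (Fr p) ((p - r) ^ 2 / r) r := by
  have h1 := (((Real.hasDerivAt_log hr.ne').sub_const (Real.log p)).const_mul (p ^ 2))
  have h2 := ((hasDerivAt_id r).sub_const p).const_mul (2 * p)
  have h3 := (((hasDerivAt_id r).pow 2).sub_const (p ^ 2)).div_const 2
  have := (h1.sub h2).add h3
  refine this.congr_deriv ?_
  simp
  field_simp
  ring

lemma Fr_mvt (p r : ℝ) (hp : 0 < p) (hr : 0 < r) :
    ∃ z, (p - z) ^ 2 ≤ (p - r) ^ 2 ∧ min p r ≤ z ∧ Fr p r = (p - z) ^ 2 / z * (r - p) := by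
  have h0 : Fr p p = 0 := by unfold Fr; ring
  rcases lt_trichotomy p r with h | h | h
  · obtain ⟨z, hz, e⟩ := exists_hasDerivAt_eq_slope (Fr p) (fun r => (p - r) ^ 2 / r) h
      (fun y hy => (Fr_deriv p y (by linarith [hy.1])).continuousAt.continuousWithinAt)
      (fun y hy => Fr_deriv p y (by linarith [hy.1]))
    refine ⟨z, by nlinarith [hz.1, hz.2], (min_le_left _ _).trans hz.1.le, ?_⟩
    rw [e, h0]; have : r - p ≠ 0 := by linarith
    field_simp; ring
  · subst h
    exact ⟨p, by simp, by simp, by rw [h0]; ring⟩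
  · obtain ⟨z, hz, e⟩ := exists_hasDerivAt_eq_slope (Fr p) (fun r => (p - r) ^ 2 / r) h
      (fun y hy => (Fr_deriv p y (by linarith [hy.1])).continuousAt.continuousWithinAt)
      (fun y hy => Fr_deriv p y (by linarith [hy.1]))
    refine ⟨z, by nlinarith [hz.1, hz.2], (min_le_right _ _).trans hz.1.le, ?_⟩
    rw [e, h0]; have : p - r ≠ 0 := by linarith
    field_simp; ring

lemma Fr_abs (p r : ℝ) (hp : 1 / 2 ≤ p) (hr : 1 / 2 ≤ r) :
    |Fr p r| ≤ 2 * |p - r| ^ 3 := by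
  obtain ⟨z, h1, h2, e⟩ := Fr_mvt p r (by linarith) (by linarith)
  have hz : 1 / 2 ≤ z := (le_min hp hr).trans h2
  have hz0 : 0 < z := by linarith
  rw [e, abs_mul, abs_sub_comm r p, abs_of_nonneg (by positivity)]
  have h3 : (p - z) ^ 2 / z ≤ 2 * |p - r| ^ 2 := by
    rw [div_le_iff₀ (by linarith), sq_abs]
    nlinarith [sq_nonneg (p - r)]
  calc _ ≤ 2 * |p - r| ^ 2 * |p - r| := by gcongr
    _ = _ := by ring

lemma Fr_le (p r B : ℝ) (hp : 0 < p) (hr : 0 < r) (hpB : p ≤ B) (hrB : r ≤ B) :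
    Fr p r ≤ (B - p) / p * (p - r) ^ 2 := by
  obtain ⟨z, h1, h2, e⟩ := Fr_mvt p r hp hr
  have hz0 : 0 < z := (lt_min hp hr).trans_le h2
  have hB : 0 ≤ (B - p) / p := div_nonneg (by linarith) hp.le
  rcases le_total r p with h | h
  · have : Fr p r ≤ 0 := by
      rw [e]; exact mul_nonpos_of_nonneg_of_nonpos (by positivity) (by linarith)
    have : 0 ≤ (B - p) / p * (p - r) ^ 2 := by positivity
    linarith
  · rw [min_eq_left h] at h2
    rw [e]
    calc (p - z) ^ 2 / z * (r - p) ≤ (p - r) ^ 2 / p * (B - p) := by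
          gcongr
      _ = _ := by ring

/-- The boundary function in the integration by parts. -/
def Psi (x v : ℝ) : ℝ := Fr (R0 x) (R0 (x + v)) * (Real.cos (v / 2) / Real.sin (v / 2))

/-- Its derivative. -/
def Psi' (x v : ℝ) : ℝ :=
  (R0 x - R0 (x + v)) ^ 2 / R0 (x + v) * R1 (x + v) * (Real.cos (v / 2) / Real.sin (v / 2))
    - Fr (R0 x) (R0 (x + v)) / (2 * Real.sin (v / 2) ^ 2)

lemma R0_half (x : ℝ) : 1 / 2 ≤ R0 x := le_trans (by norm_num) (R0_ge x)

lemma Psi_bound (x v : ℝ) : |Psi x v| ≤ 16 * Real.sin (v / 2) ^ 2 := by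
  unfold Psi
  have h1 := Fr_abs _ _ (R0_half x) (R0_half (x + v))
  have h2 := R0_diff x v
  have h3 : |R0 x - R0 (x + v)| ^ 3 ≤ (2 * |Real.sin (v / 2)|) ^ 3 := by gcongr
  have hc := Real.abs_cos_le_one (v / 2)
  rw [abs_mul, abs_div]
  rcases eq_or_ne (Real.sin (v / 2)) 0 with h | h
  · simp [h]
  · have hs : 0 < |Real.sin (v / 2)| := abs_pos.mpr h
    rw [← mul_div_assoc, div_le_iff₀ hs, ← sq_abs (Real.sin (v / 2))]
    calc _ ≤ (2 * (2 * |Real.sin (v / 2)|) ^ 3) * 1 := by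
          gcongr
          linarith
      _ = _ := by ring

lemma Fr_cont (x : ℝ) : Continuous (fun v => Fr (R0 x) (R0 (x + v))) := by
  unfold Fr
  have := logR_cont x
  fun_prop

lemma Psi_contOn (x : ℝ) : ContinuousOn (Psi x) (Set.Icc 0 (2 * π)) := by
  intro v hv
  apply ContinuousAt.continuousWithinAt
  rcases eq_or_ne (Real.sin (v / 2)) 0 with h | h
  · have h0 : Psi x v = 0 := by unfold Psi; simp [h]
    unfold ContinuousAt
    rw [h0]
    apply squeeze_zero_norm (a := fun v => 16 * Real.sin (v / 2) ^ 2)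
    · intro t; exact Psi_bound x t
    · have : Continuous (fun v : ℝ => 16 * Real.sin (v / 2) ^ 2) := by fun_prop
      have h2 := this.tendsto v
      simpa [h] using h2
  · unfold Psi
    apply ContinuousAt.mul (Fr_cont x).continuousAt
    exact ContinuousAt.div (by fun_prop) (by fun_prop) h

lemma Psi_hasDerivAt (x : ℝ) {v : ℝ} (hv : v ∈ Set.Ioo (0:ℝ) (2 * π)) :
    HasDerivAt (Psi x) (Psi' x v) v := by
  have hs := s_pos hv
  have hsd : HasDerivAt (fun v : ℝ => Real.sin (v / 2)) (Real.cos (v / 2) * (1 / 2)) v :=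
    ((hasDerivAt_id v).div_const 2).sin
  have hcd : HasDerivAt (fun v : ℝ => Real.cos (v / 2)) (-Real.sin (v / 2) * (1 / 2)) v :=
    ((hasDerivAt_id v).div_const 2).cos
  have h1 : HasDerivAt (fun v => Fr (R0 x) (R0 (x + v)))
      ((R0 x - R0 (x + v)) ^ 2 / R0 (x + v) * R1 (x + v)) v :=
    HasDerivAt.comp (h₂ := Fr (R0 x)) v (Fr_deriv (R0 x) (R0 (x + v)) (R0_pos _))
      (R0s_hasDerivAt x v)
  have := h1.mul (hcd.div hsd hs.ne')
  refine this.congr_deriv ?_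
  unfold Psi'
  have e3 := Real.sin_sq_add_cos_sq (v / 2)
  have e4 : -Real.sin (v / 2) * (1 / 2) * Real.sin (v / 2)
      - Real.cos (v / 2) * (Real.cos (v / 2) * (1 / 2)) = -(1 / 2) := by
    linear_combination (-1 / 2) * e3
  rw [e4]
  simp only [Pi.div_apply]
  field_simp
  ring

lemma Psi'_ii (x : ℝ) : IntervalIntegrable (Psi' x) volume 0 (2 * π) := by
  apply ii_bdd _ _ 32
  · intro v hv
    have hs := s_pos hv
    have hs1 := Real.sin_le_one (v / 2)
    have h1 := Fr_abs _ _ (R0_half x) (R0_half (x + v))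
    have h2 := R0_diff x v
    rw [abs_of_pos hs] at h2
    have hc := Real.abs_cos_le_one (v / 2)
    have hf := R0_half (x + v)
    have hf0 := R0_pos (x + v)
    have hR := R1_abs (x + v)
    have hR' : |R1 (x + v)| ≤ 1 := hR.trans (by norm_num)
    unfold Psi'
    refine (abs_sub _ _).trans ?_
    have a1 : |(R0 x - R0 (x + v)) ^ 2 / R0 (x + v) * R1 (x + v) *
        (Real.cos (v / 2) / Real.sin (v / 2))| ≤ 8 := by
      rw [abs_mul, abs_mul, abs_div, abs_div, abs_of_pos hf0, abs_of_pos hs, abs_pow]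
      calc _ ≤ (2 * Real.sin (v / 2)) ^ 2 / (1 / 2) * 1 * (1 / Real.sin (v / 2)) := by
            gcongr
        _ = 8 * Real.sin (v / 2) := by field_simp; norm_num
        _ ≤ 8 := by linarith
    have a2 : |Fr (R0 x) (R0 (x + v)) / (2 * Real.sin (v / 2) ^ 2)| ≤ 8 := by
      rw [abs_div, abs_of_pos (by positivity : (0:ℝ) < 2 * Real.sin (v / 2) ^ 2)]
      calc _ ≤ (2 * (2 * Real.sin (v / 2)) ^ 3) / (2 * Real.sin (v / 2) ^ 2) := by
            gcongr
            exact h1.trans (by gcongr)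
        _ = 8 * Real.sin (v / 2) := by field_simp; norm_num
        _ ≤ 8 := by linarith
    linarith
  · unfold Psi'
    have := (Fr_cont x).measurable
    have h2 := R0_cont.measurable
    have h3 := R1_cont.measurable
    fun_prop

lemma Psi'_int (x : ℝ) : ∫ v in (0:ℝ)..(2 * π), Psi' x v = 0 := by
  rw [intervalIntegral.integral_eq_sub_of_hasDerivAt_of_le (by positivity) (Psi_contOn x)
    (fun v hv => Psi_hasDerivAt x hv) (Psi'_ii x)]
  unfold Psi
  simp

/-- The smooth part of the kernel. -/
def qker (x v : ℝ) : ℝ := Nker x v / (R0 x * R0 (x + v))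

lemma qker_nonneg (x v : ℝ) : 0 ≤ qker x v := by
  have h1 := R0_pos x
  have h2 := R0_pos (x + v)
  unfold qker Nker; positivity

lemma logq_ii (x : ℝ) :
    IntervalIntegrable (fun v => gker x v * Real.log (1 + qker x v)) volume 0 (2 * π) := by
  apply IntervalIntegrable.continuousOn_mul _ (gker_cont x).continuousOn
  apply ii_bdd _ _ 4
  · intro v hv
    have hs := s_pos hv
    have hq := qker_nonneg x v
    have hf := R0_half (x + v)
    have hp := R0_half x
    have h2 := R0_diff x v
    rw [abs_of_pos hs] at h2
    have h3 : qker x v ≤ 4 := by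
      unfold qker Nker
      have hb : (R0 x - R0 (x + v)) ^ 2 ≤ (2 * Real.sin (v / 2)) ^ 2 := by
        rw [← sq_abs]; gcongr
      calc _ ≤ (2 * Real.sin (v / 2)) ^ 2 / (4 * Real.sin (v / 2) ^ 2) / ((1/2) * (1/2)) := by
            gcongr
        _ = 4 := by field_simp; norm_num
    rw [abs_of_nonneg (Real.log_nonneg (by linarith))]
    have := Real.log_le_sub_one_of_pos (by linarith : 0 < 1 + qker x v)
    linarith
  · have h2 := R0_cont.measurable
    unfold qker Nker
    fun_prop

lemma gker_lower (x v : ℝ) :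
    -(2 * R0 (x + v) + R1 (x + v) ^ 2 / R0 (x + v)) * Real.sin (v / 2) ^ 2 ≤ gker x v := by
  have hf := R0_pos (x + v)
  have e1 : Real.sin v = 2 * Real.sin (v / 2) * Real.cos (v / 2) := by
    rw [← Real.sin_two_mul]; congr 1; ring
  have e3 := Real.sin_sq_add_cos_sq (v / 2)
  unfold gker
  rw [e1, cos_eq_half v]
  set s := Real.sin (v / 2)
  set c := Real.cos (v / 2)
  set f := R0 (x + v)
  set d := R1 (x + v)
  have key : f * (1 - 2 * s ^ 2) + d * (2 * s * c) - -(2 * f + d ^ 2 / f) * s ^ 2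
      = ((f * c + d * s) ^ 2 + f ^ 2 * s ^ 2) / f := by
    field_simp
    linear_combination (-f ^ 2) * e3
  have : 0 ≤ ((f * c + d * s) ^ 2 + f ^ 2 * s ^ 2) / f := by positivity
  linarith

lemma eps_bound (p f d : ℝ) (hp : 0.9078 ≤ p) (hp' : p ≤ 1.09213) (hf : 0.9078 ≤ f)
    (hf' : f ≤ 1.09213) (hd : |d| ≤ 0.761) :
    (2 * f + d ^ 2 / f) / 2 * ((p - f) ^ 2 / (4 * p ^ 2 * f ^ 2)) ≤ 0.015 / p := by
  have hf0 : 0 < f := by linarith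
  have hp0 : 0 < p := by linarith
  have hd2 : d ^ 2 ≤ 0.5792 := by
    rw [← sq_abs]
    nlinarith [abs_nonneg d]
  have hpf : (p - f) ^ 2 ≤ 0.03399 := by
    have h1 : -(0.18434:ℝ) ≤ p - f := by linarith
    have h2 : p - f ≤ 0.18434 := by linarith
    nlinarith
  have h1 : (2 * f + d ^ 2 / f) / 2 * ((p - f) ^ 2 / (4 * p ^ 2 * f ^ 2)) =
      ((2 * f ^ 2 + d ^ 2) * (p - f) ^ 2) / (8 * p ^ 2 * f ^ 3) := by
    field_simp; ring
  rw [h1, div_le_div_iff₀ (by positivity) hp0]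
  have h3 : (2 * f ^ 2 + d ^ 2) * (p - f) ^ 2 ≤ (2 * f ^ 2 + 0.5792) * 0.03399 := by gcongr
  have h4 : (2 * f ^ 2 + 0.5792) * 0.03399 ≤ 0.12 * 0.9078 * f ^ 3 := by
    nlinarith [sq_nonneg (f - 0.9078), mul_nonneg (sub_nonneg.mpr hf) (sq_nonneg f)]
  have h5 : 0.12 * 0.9078 * f ^ 3 ≤ 0.12 * p * f ^ 3 := by gcongr
  calc (2 * f ^ 2 + d ^ 2) * (p - f) ^ 2 * p ≤ (0.12 * p * f ^ 3) * p := by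
        exact mul_le_mul_of_nonneg_right (h3.trans (h4.trans h5)) hp0.le
    _ = _ := by ring

lemma pointwise (x : ℝ) {v : ℝ} (hv : v ∈ Set.Ioo (0:ℝ) (2 * π)) :
    gker x v * Real.log (1 + qker x v) ≤
      (1 / R0 x) * ((1.09213 / R0 x + 0.015) * Nker x v
        - ((R0 x - 1) ^ 2 / 2 - (R0 x - 1) * (R0 (x + v) - 1)) + Psi' x v / 2) := by
  have hs := s_pos hv
  have hf := R0_pos (x + v)
  have hp := R0_pos x
  have hq := qker_nonneg x v
  have hlow := gker_lower x v
  have heps := eps_bound (R0 x) (R0 (x + v)) (R1 (x + v)) (R0_ge _) (R0_le _) (R0_ge _) (R0_le _)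
    (R1_abs _)
  have hF := Fr_le (R0 x) (R0 (x + v)) 1.09213 hp hf (R0_le _) (R0_le _)
  have hN : 0 ≤ Nker x v := by unfold Nker; positivity
  have l1 : Real.log (1 + qker x v) ≤ qker x v := by
    have := Real.log_le_sub_one_of_pos (by linarith : 0 < 1 + qker x v)
    linarith
  have l2 : qker x v - Real.log (1 + qker x v) ≤ qker x v ^ 2 / 2 := by
    have h := Real.le_log_one_add_of_nonneg hq
    have : qker x v - 2 * qker x v / (qker x v + 2) ≤ qker x v ^ 2 / 2 := by
      have e : qker x v - 2 * qker x v / (qker x v + 2) = qker x v ^ 2 / (qker x v + 2) := by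
        field_simp; ring
      rw [e]
      gcongr
      linarith
    linarith
  set K := 2 * R0 (x + v) + R1 (x + v) ^ 2 / R0 (x + v) with hK
  have hK0 : 0 ≤ K := by positivity
  have s1 : gker x v * Real.log (1 + qker x v) ≤
      gker x v * qker x v + K / 2 * (Real.sin (v / 2) ^ 2 * qker x v ^ 2) := by
    have a : -K * Real.sin (v / 2) ^ 2 * (qker x v - Real.log (1 + qker x v)) ≤
        gker x v * (qker x v - Real.log (1 + qker x v)) :=
      mul_le_mul_of_nonneg_right hlow (by linarith)
    have b : K * Real.sin (v / 2) ^ 2 * (qker x v - Real.log (1 + qker x v)) ≤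
        K * Real.sin (v / 2) ^ 2 * (qker x v ^ 2 / 2) :=
      mul_le_mul_of_nonneg_left l2 (by positivity)
    linarith
  have s2 : Real.sin (v / 2) ^ 2 * qker x v ^ 2 =
      (R0 x - R0 (x + v)) ^ 2 / (4 * R0 x ^ 2 * R0 (x + v) ^ 2) * Nker x v := by
    unfold qker Nker
    field_simp
  have s3 : K / 2 * (Real.sin (v / 2) ^ 2 * qker x v ^ 2) ≤ 0.015 / R0 x * Nker x v := by
    rw [s2, ← mul_assoc]
    exact mul_le_mul_of_nonneg_right heps hN
  have s4 : gker x v * qker x v = (1 / R0 x) * (Nker x v - (R0 x - R0 (x + v)) ^ 2 / 2 +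
      Psi' x v / 2 + Fr (R0 x) (R0 (x + v)) / (4 * Real.sin (v / 2) ^ 2)) := by
    have e1 : Real.sin v = 2 * Real.sin (v / 2) * Real.cos (v / 2) := by
      rw [← Real.sin_two_mul]; congr 1; ring
    unfold gker qker Nker Psi'
    rw [e1, cos_eq_half v]
    field_simp
    ring
  have s5 : Fr (R0 x) (R0 (x + v)) / (4 * Real.sin (v / 2) ^ 2) ≤
      (1.09213 - R0 x) / R0 x * Nker x v := by
    unfold Nker
    rw [← mul_div_assoc]
    gcongr
  have s6 : (R0 x - 1) ^ 2 / 2 - (R0 x - 1) * (R0 (x + v) - 1) ≤ (R0 x - R0 (x + v)) ^ 2 / 2 := by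
    nlinarith [sq_nonneg (R0 (x + v) - 1)]
  have s7 : gker x v * qker x v ≤ (1 / R0 x) * (Nker x v
      - ((R0 x - 1) ^ 2 / 2 - (R0 x - 1) * (R0 (x + v) - 1)) +
      Psi' x v / 2 + (1.09213 - R0 x) / R0 x * Nker x v) := by
    rw [s4]
    apply mul_le_mul_of_nonneg_left _ (by positivity)
    linarith
  have s8 : (1.09213 - R0 x) / R0 x = 1.09213 / R0 x - 1 := by field_simp
  rw [s8] at s7
  have s9 : (1 / R0 x) * ((1.09213 / R0 x + 0.015) * Nker x v
        - ((R0 x - 1) ^ 2 / 2 - (R0 x - 1) * (R0 (x + v) - 1)) + Psi' x v / 2) =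
      (1 / R0 x) * (Nker x v
      - ((R0 x - 1) ^ 2 / 2 - (R0 x - 1) * (R0 (x + v) - 1)) +
      Psi' x v / 2 + (1.09213 / R0 x - 1) * Nker x v) + 0.015 / R0 x * Nker x v := by
    ring
  rw [s9]
  linarith

lemma logq_int_le (x : ℝ) : ∫ v in (0:ℝ)..(2 * π), gker x v * Real.log (1 + qker x v) ≤
    (1 / R0 x) * ((1.09213 / R0 x + 0.015) * (π * 0.05429) - π * (R0 x - 1) ^ 2) := by
  have hp := R0_pos x
  have c1 : Continuous (fun v => (R0 x - 1) ^ 2 / 2 - (R0 x - 1) * (R0 (x + v) - 1)) := by fun_prop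
  have i1 := (Nker_ii x).const_mul (1.09213 / R0 x + 0.015)
  have i2 := c1.intervalIntegrable (μ := volume) 0 (2 * π)
  have i3 := (Psi'_ii x).div_const 2
  have i4 := ((i1.sub i2).add i3).const_mul (1 / R0 x)
  refine (intervalIntegral.integral_mono_on_of_le_Ioo (by positivity) (logq_ii x) i4
    (fun v hv => pointwise x hv)).trans ?_
  rw [intervalIntegral.integral_const_mul, intervalIntegral.integral_add (i1.sub i2) i3,
    intervalIntegral.integral_sub i1 i2, intervalIntegral.integral_const_mul,
    intervalIntegral.integral_div, Psi'_int]
  have hV : ∫ v in (0:ℝ)..(2 * π), ((R0 x - 1) ^ 2 / 2 - (R0 x - 1) * (R0 (x + v) - 1)) =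
      π * (R0 x - 1) ^ 2 := by
    have c2 : Continuous (fun v => R0 (x + v)) := by fun_prop
    have c3 : Continuous (fun v => (R0 x - 1) * (R0 (x + v) - 1)) := by fun_prop
    rw [intervalIntegral.integral_sub intervalIntegrable_const (c3.intervalIntegrable _ _),
      intervalIntegral.integral_const_mul,
      intervalIntegral.integral_sub (c2.intervalIntegrable _ _) intervalIntegrable_const, R0_int]
    simp
    ring
  rw [hV]
  have hN := Nker_int x
  have h0 : 0 ≤ 1.09213 / R0 x + 0.015 := by positivity
  apply mul_le_mul_of_nonneg_left _ (by positivity)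
  have := mul_le_mul_of_nonneg_left hN h0
  linarith

lemma A0_log (x : ℝ) {v : ℝ} (hv : v ∈ Set.Ioo (0:ℝ) (2 * π)) :
    Real.log (A0 x (x + v)) = Real.log (4 * Real.sin (v / 2) ^ 2) + Real.log (R0 x)
      + Real.log (R0 (x + v)) + Real.log (1 + qker x v) := by
  have hs := s_pos hv
  have hf := R0_pos (x + v)
  have hp := R0_pos x
  have hq := qker_nonneg x v
  have hq1 : (1 + qker x v) ≠ 0 := by linarith
  rw [← Real.log_mul (by positivity) hp.ne', ← Real.log_mul (by positivity) hf.ne',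
    ← Real.log_mul (by positivity) hq1]
  congr 1
  unfold A0 Afun qker Nker
  rw [show x - (x + v) = -v by ring, Real.cos_neg, cos_eq_half v]
  field_simp
  ring

lemma main_int (x : ℝ) :
    ∫ v in (0:ℝ)..(2 * π), gker x v * Real.log (A0 x (x + v)) =
      -(2 * π) + ∫ v in (0:ℝ)..(2 * π), gker x v * Real.log (1 + qker x v) := by
  have hpi : (0:ℝ) ≤ 2 * π := by positivity
  have i1 := logs_ii x
  have i2 : IntervalIntegrable (fun v => gker x v * Real.log (R0 x)) volume 0 (2 * π) := by
    apply Continuous.intervalIntegrable; fun_prop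
  have i3 : IntervalIntegrable (fun v => gker x v * Real.log (R0 (x + v))) volume 0 (2 * π) :=
    ((gker_cont x).mul (logR_cont x)).intervalIntegrable _ _
  have i4 := logq_ii x
  have e : ∫ v in (0:ℝ)..(2 * π), gker x v * Real.log (A0 x (x + v)) =
      ∫ v in (0:ℝ)..(2 * π), (gker x v * Real.log (4 * Real.sin (v / 2) ^ 2)
        + gker x v * Real.log (R0 x) + gker x v * Real.log (R0 (x + v))
        + gker x v * Real.log (1 + qker x v)) := by
    apply intervalIntegral.integral_congr_Ioo_of_le hpi
    intro v hv
    simp only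
    rw [A0_log x hv]; ring
  rw [e, intervalIntegral.integral_add ((i1.add i2).add i3) i4,
    intervalIntegral.integral_add (i1.add i2) i3, intervalIntegral.integral_add i1 i2,
    gker_int_logs, intervalIntegral.integral_mul_const, gker_int, gker_int_log]
  ring

lemma K1_eq (x : ℝ) : K1 x = R0 x + (1 / (4 * π * Om)) *
    (-(2 * π) + ∫ v in (0:ℝ)..(2 * π), gker x v * Real.log (1 + qker x v)) := by
  rw [← main_int]
  unfold K1
  congr 1
  have hper : Function.Periodic (fun y => R0 y * C0 x y - deriv R0 y * S0 x y) (2 * π) := by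
    intro y
    simp only [R0_deriv, C0, S0, Cfun, Sfun, Afun, R0_per y, R1_per y]
    rw [show x - (y + 2 * π) = x - y - 2 * π by ring, Real.cos_sub_two_pi, Real.sin_sub_two_pi]
  have h1 := hper.intervalIntegral_add_eq 0 x
  rw [zero_add] at h1
  rw [h1, ← intervalIntegral.integral_const_mul]
  have h2 := intervalIntegral.integral_comp_add_left (a := 0) (b := 2 * π)
    (fun y => R0 y * C0 x y - deriv R0 y * S0 x y) x
  rw [add_zero] at h2
  rw [← h2]
  apply intervalIntegral.integral_congr
  intro v _
  simp only [R0_deriv, C0, S0, Cfun, Sfun, A0, gker]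
  rw [show x - (x + v) = -v by ring, Real.cos_neg, Real.sin_neg]
  ring

lemma final_poly (p : ℝ) (h1 : 0.9078 ≤ p) (h2 : p ≤ 1.09213) :
    p + (1 / (4 * Om)) * (-2 +
      (1 / p) * ((1.09213 / p + 0.015) * 0.05429 - (p - 1) ^ 2)) < -0.1 := by
  have hp : 0 < p := by linarith
  have e : p + (1 / (4 * Om)) * (-2 +
      (1 / p) * ((1.09213 / p + 0.015) * 0.05429 - (p - 1) ^ 2)) - (-0.1) =
      (4 * Om * p ^ 2 * (p + 0.1) - 2 * p ^ 2 + (1.09213 + 0.015 * p) * 0.05429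
        - p * (p - 1) ^ 2) / (4 * Om * p ^ 2) := by
    unfold Om
    field_simp
    ring
  have hneg : 4 * Om * p ^ 2 * (p + 0.1) - 2 * p ^ 2 + (1.09213 + 0.015 * p) * 0.05429
        - p * (p - 1) ^ 2 < 0 := by
    unfold Om
    nlinarith [mul_nonneg (sub_nonneg.mpr h1) (sub_nonneg.mpr h2),
      mul_nonneg (mul_nonneg (sub_nonneg.mpr h1) (sub_nonneg.mpr h2)) hp.le]
  have := div_neg_of_neg_of_pos hneg (by unfold Om; positivity : 0 < 4 * Om * p ^ 2)
  linarith

/-- Lemma 2.8: `|K₁(x)| > 0.1` for every `x`. -/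
theorem stmt_9 : ∀ x : ℝ, 0.1 < |K1 x| := by
  intro x
  have hp := R0_pos x
  have hfin := final_poly (R0 x) (R0_ge x) (R0_le x)
  have hI := logq_int_le x
  have hOm : 0 < Om := by unfold Om; norm_num
  have hpi := Real.pi_pos
  have h1 : K1 x ≤ R0 x + (1 / (4 * Om)) * (-2 +
      (1 / R0 x) * ((1.09213 / R0 x + 0.015) * 0.05429 - (R0 x - 1) ^ 2)) := by
    rw [K1_eq]
    have h2 : (1 / (4 * π * Om)) *
        (-(2 * π) + ∫ v in (0:ℝ)..(2 * π), gker x v * Real.log (1 + qker x v)) ≤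
        (1 / (4 * π * Om)) * (-(2 * π) + (1 / R0 x) *
          ((1.09213 / R0 x + 0.015) * (π * 0.05429) - π * (R0 x - 1) ^ 2)) := by
      apply mul_le_mul_of_nonneg_left _ (by positivity)
      linarith
    refine (add_le_add_right h2 _).trans (le_of_eq ?_)
    field_simp
  have h3 : K1 x < -0.1 := lt_of_le_of_lt h1 hfin
  have := neg_le_abs (K1 x)
  linarith
end
end

section
/- Let m be a positive integer, let w : ℝ → ℝ be odd, 2π/m-periodic, and square-integrable on [−π, π], and set v(x) = ∫₀ˣ w(y) dy. Then sup_{x ∈ ℝ} |v(x)| ≤ (√π/(m√2)) · (∫_{−π}^{π} w(y)² dy)^{1/2}. -/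
open Real MeasureTheory intervalIntegral

noncomputable section

lemma cs_aux (w : ℝ → ℝ) (x : ℝ) (hx : 0 < x)
    (h1 : IntervalIntegrable w volume 0 x)
    (h2 : IntervalIntegrable (fun y => w y ^ 2) volume 0 x) :
    (∫ y in (0:ℝ)..x, w y) ^ 2 ≤ x * ∫ y in (0:ℝ)..x, w y ^ 2 := by
  set V := ∫ y in (0:ℝ)..x, w y with hV
  set J := ∫ y in (0:ℝ)..x, w y ^ 2 with hJ
  have h0 : 0 ≤ ∫ y in (0:ℝ)..x, (w y - V / x) ^ 2 :=
    intervalIntegral.integral_nonneg hx.le (fun y _ => sq_nonneg _)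
  have he : ∫ y in (0:ℝ)..x, (w y - V / x) ^ 2 = J - 2 * (V / x) * V + x * (V / x) ^ 2 := by
    have : ∀ y, (w y - V / x) ^ 2 = (w y ^ 2 - 2 * (V / x) * w y) + (V / x) ^ 2 := by
      intro y; ring
    simp_rw [this]
    rw [intervalIntegral.integral_add (h2.sub (h1.const_mul _)) intervalIntegrable_const,
      intervalIntegral.integral_sub h2 (h1.const_mul _), intervalIntegral.integral_const_mul,
      intervalIntegral.integral_const]
    simp [hV, hJ]
  rw [he] at h0
  have h3 : 0 ≤ x * (J - 2 * (V / x) * V + x * (V / x) ^ 2) := mul_nonneg hx.le h0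
  have h4 : x * (J - 2 * (V / x) * V + x * (V / x) ^ 2) = x * J - V ^ 2 := by
    field_simp; ring
  linarith

/-- Lemma 4.1: `L^∞`–`Ḣ¹` bound: `sup |v| ≤ (√π/(m√2)) ‖w‖_{L²(−π,π)}`. -/
theorem stmt_13 (m : ℕ) (hm : 0 < m) (w : ℝ → ℝ)
    (hodd : ∀ x : ℝ, w (-x) = -w x)
    (hper : ∀ x : ℝ, w (x + 2 * π / m) = w x)
    (hint : MeasureTheory.IntegrableOn (fun y => w y ^ 2) (Set.Icc (-π) π))
    (v : ℝ → ℝ) (hv : ∀ x : ℝ, v x = ∫ y in (0:ℝ)..x, w y) :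
    ∀ x : ℝ,
      |v x| ≤ (Real.sqrt π / (m * Real.sqrt 2)) * (∫ y in (-π)..π, w y ^ 2) ^ ((1:ℝ)/2) := by
  have hm' : (0:ℝ) < m := by exact_mod_cast hm
  have hπ := Real.pi_pos
  obtain ⟨H, hH⟩ : ∃ H : ℝ, H = π / m := ⟨_, rfl⟩
  have hHpos : 0 < H := by rw [hH]; positivity
  have hmH : m * H = π := by rw [hH]; field_simp
  have hT : 2 * π / m = 2 * H := by rw [hH]; ring
  rw [hT] at hper
  have hwp : Function.Periodic w (2 * H) := hper
  have hqp : Function.Periodic (fun y => w y ^ 2) (2 * H) := fun y => by simp only [hwp y]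
  have hqI : ∀ a b, IntervalIntegrable (fun y => w y ^ 2) volume a b := by
    have hp2 : Function.Periodic (fun y => w y ^ 2) (2 * π) := by
      have := hqp.nat_mul m
      rwa [show (m:ℝ) * (2 * H) = 2 * π by rw [← hmH]; ring] at this
    refine hp2.intervalIntegrable (t := -π) (by positivity) ?_
    rw [show -π + 2 * π = π by ring, intervalIntegrable_iff_integrableOn_Icc_of_le (by linarith)]
    exact hint
  have hI : ∫ y in (-π)..π, w y ^ 2 = 2 * m * ∫ y in (0:ℝ)..H, w y ^ 2 := by
    have h1 := hqp.intervalIntegral_add_zsmul_eq m (-π) hqI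
    have h2 := hqp.intervalIntegral_add_eq (-π) (-H)
    have h3 : ∫ y in (-H)..0, w y ^ 2 = ∫ y in (0:ℝ)..H, w y ^ 2 := by
      have := intervalIntegral.integral_comp_neg (a := 0) (b := H) (fun y => w y ^ 2)
      simp only [hodd, neg_sq, neg_zero] at this
      exact this.symm
    have h4 := intervalIntegral.integral_add_adjacent_intervals (hqI (-H) 0) (hqI 0 H)
    rw [h2, show -H + 2 * H = H by ring, ← h4, h3] at h1
    simp only [zsmul_eq_mul, Int.cast_natCast] at h1
    rw [show -π + (m:ℝ) * (2 * H) = π by rw [← hmH]; ring] at h1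
    rw [h1]; ring
  have hJ0 : 0 ≤ ∫ y in (0:ℝ)..H, w y ^ 2 :=
    intervalIntegral.integral_nonneg hHpos.le (fun y _ => sq_nonneg _)
  have hB : (Real.sqrt π / (m * Real.sqrt 2)) * (∫ y in (-π)..π, w y ^ 2) ^ ((1:ℝ)/2)
      = Real.sqrt (H * ∫ y in (0:ℝ)..H, w y ^ 2) := by
    rw [← Real.sqrt_eq_rpow, hI]
    symm
    rw [Real.sqrt_eq_iff_mul_self_eq (by positivity) (by positivity)]
    have e1 := Real.mul_self_sqrt hπ.le
    have e2 := Real.mul_self_sqrt (show (0:ℝ) ≤ 2 by norm_num)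
    have e3 := Real.mul_self_sqrt (show 0 ≤ 2 * m * ∫ y in (0:ℝ)..H, w y ^ 2 by positivity)
    symm
    calc _ = (√π * √π) / (m * m * (√2 * √2)) * (√(2 * m * ∫ y in (0:ℝ)..H, w y ^ 2) *
            √(2 * m * ∫ y in (0:ℝ)..H, w y ^ 2)) := by ring
      _ = _ := by rw [e1, e2, e3, hH]; field_simp
  rw [hB]
  have heven : ∀ x, v (-x) = v x := by
    intro x
    rw [hv, hv]
    have := intervalIntegral.integral_comp_neg (a := 0) (b := x) w
    simp only [hodd, neg_zero, intervalIntegral.integral_neg] at this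
    rw [intervalIntegral.integral_symm, ← this, neg_neg]
  have hsmall : ∀ x, 0 ≤ x → x ≤ H → |v x| ≤ Real.sqrt (H * ∫ y in (0:ℝ)..H, w y ^ 2) := by
    intro x hx0 hxH
    rcases hx0.eq_or_lt with h | hx
    · rw [hv, ← h]; simp
    by_cases hw : IntervalIntegrable w volume 0 x
    · apply Real.abs_le_sqrt
      rw [hv]
      refine (cs_aux w x hx hw (hqI _ _)).trans ?_
      have : ∫ y in (0:ℝ)..x, w y ^ 2 ≤ ∫ y in (0:ℝ)..H, w y ^ 2 := by
        rw [← intervalIntegral.integral_add_adjacent_intervals (hqI 0 x) (hqI x H)]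
        have : 0 ≤ ∫ y in x..H, w y ^ 2 :=
          intervalIntegral.integral_nonneg hxH (fun y _ => sq_nonneg _)
        linarith
      exact mul_le_mul hxH this
        (intervalIntegral.integral_nonneg hx.le (fun y _ => sq_nonneg _)) hHpos.le
    · rw [hv, intervalIntegral.integral_undef hw]; simp
  have hsmall' : ∀ x, |x| ≤ H → |v x| ≤ Real.sqrt (H * ∫ y in (0:ℝ)..H, w y ^ 2) := by
    intro x hx
    have := hsmall |x| (abs_nonneg x) hx
    rcases abs_choice x with h | h <;> rw [h] at this
    · exact this
    · rwa [heven] at this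
  have hmain : ∀ x, 0 ≤ x → |v x| ≤ Real.sqrt (H * ∫ y in (0:ℝ)..H, w y ^ 2) := by
    intro x hx0
    rcases le_total x H with hxH | hxH
    · exact hsmall x hx0 hxH
    by_cases hw : IntervalIntegrable w volume 0 x
    · have hw1 : IntervalIntegrable w volume 0 H := by
        apply hw.mono_set
        rw [Set.uIcc_of_le hHpos.le, Set.uIcc_of_le hx0]
        exact Set.Icc_subset_Icc le_rfl hxH
      have hw2 : IntervalIntegrable w volume (-H) 0 := by
        have := (IntervalIntegrable.iff_comp_neg (f := w)).1 hw1
        simp only [hodd, neg_zero] at this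
        have h5 := this.neg.symm
        rwa [show (-fun x => -w x) = w from by ext y; simp] at h5
      have hwI := hwp.intervalIntegrable (t := -H) (by positivity)
        (by rw [show -H + 2 * H = H by ring]; exact hw2.trans hw1)
      have hz : ∀ t, ∫ y in t..t + 2 * H, w y = 0 := by
        intro t
        rw [hwp.intervalIntegral_add_eq t (-H), show -H + 2 * H = H by ring,
          ← intervalIntegral.integral_add_adjacent_intervals hw2 hw1,
          intervalIntegral.integral_symm, ← hv, ← hv, heven]
        ring
      have hvp : Function.Periodic v (2 * H) := by
        intro t
        rw [hv, hv, hwp.intervalIntegral_add_eq_add 0 t hwI, hz, add_zero]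
      obtain ⟨y, hy, hxy⟩ := hvp.exists_mem_Ico (by positivity) x (-H)
      rw [hxy]
      apply hsmall'
      rw [abs_le]
      exact ⟨hy.1, by linarith [hy.2]⟩
    · rw [hv, intervalIntegral.integral_undef hw]; simp
  intro x
  rcases le_total 0 x with h | h
  · exact hmain x h
  · rw [← heven]; exact hmain _ (by linarith)
end
end

section
/- Set m_R = 0.94, M_R = 1.1, Ω = 1537/3750, t₁ = 2·arcsin(1/(2m_R)), t₂ = 2·arcsin(√(1 − (M_R − m_R)²)/(2M_R)), b₁ = (1/(4πΩ))·√(16t₁ + 8(log(2M_R))²·(π/2 − (sin(2t₂) + 2t₂)/4)), and b₂ = max{1/(Ω·e·2^{5/2}·m_R), (1/(4πΩ))·log((M_R − m_R)² + 3M_R²), (√3/(8πΩ))·log((M_R − m_R)² + 4M_R²)}. Then for every v ∈ Ỹ: (1) sup_{x ∈ ℝ} (∫₀^{2π} C[v](x,y)² dy)^{1/2} ≤ b₁, and (2) |S[v](x,y)| ≤ b₂ for all x, y ∈ ℝ. -/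
open Real MeasureTheory intervalIntegral

noncomputable section

def mR : ℝ := 0.94
def MR : ℝ := 1.1
def tOne : ℝ := 2 * Real.arcsin (1 / (2 * mR))
def tTwo : ℝ := 2 * Real.arcsin (Real.sqrt (1 - (MR - mR) ^ 2) / (2 * MR))

/-- The constant `b₁`. -/
def b1 : ℝ :=
  (1 / (4 * π * Om)) *
    Real.sqrt (16 * tOne +
      8 * Real.log (2 * MR) ^ 2 * (π / 2 - (Real.sin (2 * tTwo) + 2 * tTwo) / 4))

/-- The constant `b₂`. -/
def b2 : ℝ :=
  max (max (1 / (Om * Real.exp 1 * (2:ℝ) ^ ((5:ℝ)/2) * mR))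
        ((1 / (4 * π * Om)) * Real.log ((MR - mR) ^ 2 + 3 * MR ^ 2)))
      ((Real.sqrt 3 / (8 * π * Om)) * Real.log ((MR - mR) ^ 2 + 4 * MR ^ 2))

lemma aux_R0_trunc (x : ℝ) :
    |R0 x - (1 + coefC 1 * Real.cos (6*x) + coefC 2 * Real.cos (2*(6*x)) + coefC 3 * Real.cos (3*(6*x))
      + coefC 4 * Real.cos (2*(2*(6*x))))| ≤ 0.0012 := by
  have h : R0 x - (1 + coefC 1 * Real.cos (6*x) + coefC 2 * Real.cos (2*(6*x)) + coefC 3 * Real.cos (3*(6*x))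
      + coefC 4 * Real.cos (2*(2*(6*x)))) =
      ∑ k ∈ Finset.range 26, coefC (k+5) * Real.cos (6 * ((k+5 : ℕ):ℝ) * x) := by
    unfold R0
    rw [Finset.sum_range_add (fun k : ℕ => coefC k * Real.cos (6 * (k:ℝ) * x)) 5 26]
    have e : ∑ k ∈ Finset.range 5, coefC k * Real.cos (6 * (k:ℝ) * x) =
       1 + coefC 1 * Real.cos (6*x) + coefC 2 * Real.cos (2*(6*x)) + coefC 3 * Real.cos (3*(6*x))
      + coefC 4 * Real.cos (2*(2*(6*x))) := by
      simp only [Finset.sum_range_succ, Finset.sum_range_zero]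
      have h0 : coefC 0 = 1 := rfl
      rw [h0]
      push_cast
      rw [show 6*(0:ℝ)*x = 0 by ring, show 6*(1:ℝ)*x = 6*x by ring, show 6*(2:ℝ)*x = 2*(6*x) by ring,
        show 6*(3:ℝ)*x = 3*(6*x) by ring, show 6*(4:ℝ)*x = 2*(2*(6*x)) by ring, Real.cos_zero]
      ring
    rw [e, add_sub_cancel_left]
    refine Finset.sum_congr rfl fun k _ => ?_
    rw [add_comm 5 k]
  rw [h]
  have hb : ∀ k ∈ Finset.range 26, |coefC (k+5) * Real.cos (6 * ((k+5 : ℕ):ℝ) * x)| ≤ |coefC (k+5)| := by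
    intro k _
    rw [abs_mul]
    exact mul_le_of_le_one_right (abs_nonneg _) (Real.abs_cos_le_one _)
  refine (Finset.abs_sum_le_sum_abs _ _).trans ((Finset.sum_le_sum hb).trans ?_)
  simp only [Finset.sum_range_succ, Finset.sum_range_zero, coefC]
  norm_num [abs_of_pos]

lemma aux_R0 (x : ℝ) : 0.9402 ≤ R0 x ∧ R0 x ≤ 1.0998 := by
  have h := abs_le.1 (aux_R0_trunc x)
  obtain ⟨h1, h2⟩ := h
  rw [Real.cos_two_mul (2*(6*x)), Real.cos_three_mul, Real.cos_two_mul (6*x)] at h1 h2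
  have ha := Real.neg_one_le_cos (6*x)
  have hb := Real.cos_le_one (6*x)
  generalize Real.cos (6*x) = t at *
  simp only [coefC] at h1 h2
  have e1 : 0 ≤ (1+t) := by linarith
  have e2 : 0 ≤ 1 - t := by linarith
  constructor
  · nlinarith [sq_nonneg t, sq_nonneg (t^2), mul_nonneg e1 e1, mul_nonneg e1 (sq_nonneg t), mul_nonneg e1 (sq_nonneg (t-1/2)), mul_nonneg e1 e2, mul_nonneg (mul_nonneg e1 e2) (sq_nonneg t)]
  · nlinarith [sq_nonneg t, sq_nonneg (t^2), mul_nonneg e1 e2, mul_nonneg e2 (sq_nonneg t), mul_nonneg (mul_nonneg e1 e2) (sq_nonneg t), mul_nonneg e1 (mul_nonneg e1 e2)]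

lemma aux_v (v : ℝ → ℝ) (hv : memY v) (x : ℝ) : |v x| ≤ 0.0002 := by
  obtain ⟨w, hodd, hper, hloc, hnorm, hvw⟩ := hv
  set I := ∫ y in (-π)..π, w y ^ 2 with hI
  have hpi := Real.pi_pos
  have hI0 : 0 ≤ I := intervalIntegral.integral_nonneg (by linarith) (fun y _ => sq_nonneg _)
  have hIle : I ≤ 4.8e-9 := by
    rw [← Real.sqrt_eq_rpow] at hnorm
    have h12 : 0 < Real.sqrt 12 := by positivity
    have h1 : Real.sqrt I ≤ 2e-5 * Real.sqrt 12 := by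
      rw [one_div, inv_mul_le_iff₀ h12] at hnorm
      linarith
    have h2 := Real.sq_sqrt hI0
    have h3 := Real.sq_sqrt (show (0:ℝ) ≤ 12 by norm_num)
    have h4 : Real.sqrt I ^ 2 ≤ (2e-5 * Real.sqrt 12)^2 := by
      gcongr
    rw [h2, mul_pow, h3] at h4
    refine h4.trans (by norm_num)
  have hw2 : ∀ a b, IntervalIntegrable (fun y => w y ^ 2) volume a b := fun a b =>
    (hloc.integrableOn_isCompact isCompact_uIcc).intervalIntegrable
  set g : ℝ → ℝ := fun y => w y ^ 2 * 12500 + 2e-5 with hg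
  have hgi : ∀ a b, IntervalIntegrable g volume a b := fun a b =>
    ((hw2 a b).mul_const _).add intervalIntegrable_const
  have hwg : ∀ y, ‖w y‖ ≤ g y := by
    intro y
    rw [Real.norm_eq_abs, hg]
    have := sq_nonneg (|w y| * 25000 - 1)
    dsimp only
    rw [← sq_abs (w y)]
    nlinarith
  have hg0 : ∀ y, 0 ≤ g y := fun y => (norm_nonneg _).trans (hwg y)
  have hgint : ∫ y in (-π)..π, g y ≤ 0.0002 := by
    rw [hg, intervalIntegral.integral_add ((hw2 _ _).mul_const _) intervalIntegrable_const,
      intervalIntegral.integral_mul_const, ← hI, intervalIntegral.integral_const, smul_eq_mul]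
    have := Real.pi_lt_d2
    nlinarith
  have pos : ∀ x, 0 ≤ x → x ≤ π → |v x| ≤ 0.0002 := by
    intro x h0 h1
    rw [hvw]
    refine (intervalIntegral.norm_integral_le_of_norm_le h0 (Filter.Eventually.of_forall fun t _ => hwg t) (hgi _ _)).trans ?_
    refine le_trans ?_ hgint
    exact intervalIntegral.integral_mono_interval (by linarith) h0 h1
      (Filter.Eventually.of_forall hg0) (hgi _ _)
  have even : ∀ x, v (-x) = v x := by
    intro x
    rw [hvw, hvw]
    have h := intervalIntegral.integral_comp_neg (a := 0) (b := x) w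
    simp only [hodd, neg_zero, intervalIntegral.integral_neg] at h
    rw [intervalIntegral.integral_symm]
    linarith
  have mid : ∀ x, |x| ≤ π → |v x| ≤ 0.0002 := by
    intro x hx
    rcases le_total 0 x with h | h
    · exact pos x h (by rwa [abs_of_nonneg h] at hx)
    · rw [← even]; exact pos _ (by linarith) (by rwa [abs_of_nonpos h] at hx)
  have hper2 : Function.Periodic w (2 * π) := by
    have h : Function.Periodic w (π/3) := hper
    have := h.nat_mul 6
    have e : ((6:ℕ):ℝ) * (π/3) = 2 * π := by push_cast; ring
    rwa [e] at this
  by_cases hint : IntervalIntegrable w volume 0 π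
  · have hneg : IntervalIntegrable w volume (-π) 0 := by
      have := (hint.comp_sub_left 0).neg
      simp only [zero_sub, sub_zero, neg_zero] at this
      have h2 : (-fun x => w (-x)) = w := by
        funext x; simp [hodd]
      rw [h2] at this
      exact this.symm
    have hall : ∀ a b, IntervalIntegrable w volume a b := by
      intro a b
      refine hper2.intervalIntegrable (t := -π) (by positivity) ?_ a b
      have := hneg.trans hint
      convert this using 1
      ring
    have hvper : Function.Periodic v (2 * π) := by
      intro x
      rw [hvw, hvw]
      rw [← intervalIntegral.integral_add_adjacent_intervals (hall 0 x) (hall x _)]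
      rw [hper2.intervalIntegral_add_eq x (-π)]
      rw [show -π + 2 * π = π by ring]
      rw [← intervalIntegral.integral_add_adjacent_intervals (hall (-π) 0) (hall 0 π)]
      have h := even π
      rw [hvw, hvw, intervalIntegral.integral_symm] at h
      linarith
    obtain ⟨y, hy, hxy⟩ := hvper.exists_mem_Ico (by positivity) x (-π)
    rw [hxy]
    apply mid
    rw [abs_le]
    exact ⟨hy.1, by have := hy.2; linarith⟩
  · have big : ∀ x, π ≤ x → v x = 0 := by
      intro x hx
      rw [hvw]
      apply intervalIntegral.integral_undef
      intro hc
      apply hint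
      refine hc.mono_set ?_
      rw [Set.uIcc_of_le hpi.le, Set.uIcc_of_le (by linarith)]
      exact Set.Icc_subset_Icc_right hx
    rcases le_total |x| π with h | h
    · exact mid x h
    · have : v x = 0 := by
        rcases le_total 0 x with h' | h'
        · exact big x (by rwa [abs_of_nonneg h'] at h)
        · rw [← even]; exact big _ (by rwa [abs_of_nonpos h'] at h)
      rw [this]; norm_num

lemma aux_Rv (v : ℝ → ℝ) (hv : memY v) (x : ℝ) : mR ≤ R0 x + v x ∧ R0 x + v x ≤ MR := by
  have h1 := aux_R0 x
  have h2 := abs_le.1 (aux_v v hv x)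
  unfold mR MR
  constructor <;> linarith [h1.1, h1.2, h2.1, h2.2]

lemma aux_A (v : ℝ → ℝ) (hv : memY v) (x y : ℝ) :
    4 * mR^2 * Real.sin ((x-y)/2)^2 ≤ Afun v x y ∧
    Afun v x y ≤ (MR - mR)^2 + 4 * MR^2 * Real.sin ((x-y)/2)^2 ∧ Afun v x y ≤ (2 * MR)^2 := by
  have hx := aux_Rv v hv x
  have hy := aux_Rv v hv y
  unfold Afun
  have hc : Real.cos (x-y) = 1 - 2 * Real.sin ((x-y)/2)^2 := by
    rw [show x - y = 2 * ((x-y)/2) by ring, Real.cos_two_mul, Real.cos_sq']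
    rw [show 2 * ((x-y)/2)/2 = (x-y)/2 by ring]; ring
  rw [hc]
  have hs0 := sq_nonneg (Real.sin ((x-y)/2))
  have hs1 := Real.sin_sq_le_one ((x-y)/2)
  generalize Real.sin ((x-y)/2)^2 = s at *
  generalize R0 x + v x = a at *
  generalize R0 y + v y = b at *
  have hm : (0:ℝ) < mR := by norm_num [mR]
  generalize mR = m at *
  generalize MR = M at *
  obtain ⟨a1, a2⟩ := hx
  obtain ⟨b1, b2⟩ := hy
  have e1 : m^2 ≤ a*b := by nlinarith
  have e2 : a*b ≤ M^2 := by nlinarith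
  have e3 : (a-b)^2 ≤ (M-m)^2 := sq_le_sq' (by linarith) (by linarith)
  have e4 := mul_le_mul_of_nonneg_right e1 hs0
  have e5 := mul_le_mul_of_nonneg_right e2 hs0
  have e6 : (a+b)^2 ≤ (2*M)^2 := pow_le_pow_left₀ (by linarith) (by linarith) 2
  have e7 : a*b*s ≤ a*b := mul_le_of_le_one_right (by nlinarith) hs1
  refine ⟨by nlinarith [sq_nonneg (a-b)], by nlinarith, by nlinarith⟩

lemma aux_S (v : ℝ → ℝ) (hv : memY v) (x y : ℝ) : |Sfun v x y| ≤ b2 := by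
  obtain ⟨hA1, hA2, -⟩ := aux_A v hv x y
  unfold Sfun b2
  have hOm : 0 < Om := by norm_num [Om]
  have hm : 0 < mR := by norm_num [mR]
  have hK : 0 < 1 / (4 * π * Om) := by positivity
  rw [abs_mul, abs_mul, abs_of_pos hK]
  have hsin : Real.sin (x-y) = 2 * Real.sin ((x-y)/2) * Real.cos ((x-y)/2) := by
    rw [← Real.sin_two_mul]; congr 1; ring
  have hA0 : 0 ≤ Afun v x y := le_trans (by positivity) hA1
  rcases le_total (Afun v x y) 1 with hA | hA
  · refine le_trans ?_ ((le_max_left _ _).trans (le_max_left _ _))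
    -- key: |sin| * |log A| ≤ 2 / (m e)
    have key : |Real.sin (x-y)| * |Real.log (Afun v x y)| ≤ 2 / (mR * Real.exp 1) := by
      rcases eq_or_ne (Real.sin ((x-y)/2)) 0 with hs | hs
      · rw [hsin, hs]; simp; positivity
      set s := 2 * mR * |Real.sin ((x-y)/2)| with hsdef
      have hs0 : 0 < s := by positivity
      have hsA : s^2 ≤ Afun v x y := by
        rw [hsdef, mul_pow, sq_abs]; linarith
      have hApos : 0 < Afun v x y := lt_of_lt_of_le (by positivity) hsA
      have hlog : |Real.log (Afun v x y)| ≤ -(2 * Real.log s) := by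
        rw [abs_of_nonpos (Real.log_nonpos hA0 hA)]
        have := Real.log_le_log (by positivity) hsA
        rw [Real.log_pow] at this
        push_cast at this
        linarith
      have hsn : |Real.sin (x-y)| ≤ s / mR := by
        rw [hsin, abs_mul, abs_mul, hsdef]
        have := Real.abs_cos_le_one ((x-y)/2)
        rw [abs_of_pos (by norm_num : (0:ℝ) < 2)]
        calc 2 * |Real.sin ((x-y)/2)| * |Real.cos ((x-y)/2)| ≤ 2 * |Real.sin ((x-y)/2)| * 1 := by gcongr
          _ = _ := by field_simp
      have hmain : -(s * Real.log s) ≤ 1 / Real.exp 1 := by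
        have h := Real.log_le_sub_one_of_pos (x := 1 / (s * Real.exp 1)) (by positivity)
        rw [one_div, Real.log_inv, Real.log_mul hs0.ne' (Real.exp_pos 1).ne', Real.log_exp] at h
        have h2 := mul_le_mul_of_nonneg_left h hs0.le
        have h3 : s * ((s * Real.exp 1)⁻¹ - 1) = 1 / Real.exp 1 - s := by
          field_simp
        rw [h3] at h2
        linarith
      calc _ ≤ s / mR * (-(2 * Real.log s)) := by gcongr
        _ = 2 / mR * (-(s * Real.log s)) := by ring
        _ ≤ 2 / mR * (1 / Real.exp 1) := by gcongr
        _ = _ := by field_simp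
    have h52 : (2:ℝ) ^ ((5:ℝ)/2) ≤ 2 * π := by
      have h1 : (2:ℝ) ^ ((5:ℝ)/2) = Real.sqrt 32 := by
        rw [Real.sqrt_eq_rpow, show (32:ℝ) = 2 ^ (5:ℝ) by norm_num, ← Real.rpow_mul (by norm_num)]
        norm_num
      rw [h1]
      have := Real.pi_gt_three
      rw [Real.sqrt_le_left (by positivity)]
      nlinarith
    calc _ = 1 / (4 * π * Om) * (|Real.sin (x-y)| * |Real.log (Afun v x y)|) := by ring
      _ ≤ 1 / (4 * π * Om) * (2 / (mR * Real.exp 1)) := by gcongr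
      _ = 1 / (Om * Real.exp 1 * (2 * π) * mR) := by field_simp; norm_num
      _ ≤ _ := by gcongr
  · have hl0 := Real.log_nonneg hA
    rw [abs_of_nonneg hl0]
    rcases le_total (Real.sin ((x-y)/2)^2) (3/4) with hs | hs
    · refine le_trans ?_ ((le_max_right _ _).trans (le_max_left _ _))
      have h1 : Real.log (Afun v x y) ≤ Real.log ((MR - mR)^2 + 3 * MR^2) :=
        Real.log_le_log (by linarith) (by nlinarith [sq_nonneg MR])
      calc _ ≤ 1 / (4 * π * Om) * 1 * Real.log ((MR - mR)^2 + 3 * MR^2) := by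
            gcongr
            exact Real.abs_sin_le_one _
        _ = _ := by ring
    · refine le_trans ?_ (le_max_right _ _)
      have h1 : Real.log (Afun v x y) ≤ Real.log ((MR - mR)^2 + 4 * MR^2) :=
        Real.log_le_log (by linarith) (by nlinarith [sq_nonneg MR, Real.sin_sq_le_one ((x-y)/2)])
      have h2 : |Real.sin (x-y)| ≤ Real.sqrt 3 / 2 := by
        rw [show Real.sqrt 3 / 2 = Real.sqrt (3/4) by
          rw [Real.sqrt_div (by norm_num), show (4:ℝ) = 2^2 by norm_num, Real.sqrt_sq (by norm_num)]]
        apply Real.abs_le_sqrt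
        rw [hsin, mul_pow, mul_pow, Real.cos_sq']
        nlinarith [Real.sin_sq_le_one ((x-y)/2)]
      calc _ ≤ 1 / (4 * π * Om) * (Real.sqrt 3 / 2) * Real.log ((MR - mR)^2 + 4 * MR^2) := by
            gcongr
        _ = _ := by ring

lemma aux_F_deriv (T : ℝ) (hT : 0 < T) (u : ℝ) (hu : 0 < u) :
    HasDerivAt (fun u => u * Real.log (u/T)^2 - 2 * (u * Real.log (u/T)) + 2 * u) (Real.log (u/T)^2) u := by
  have h1 : HasDerivAt (fun u => Real.log (u/T)) (1/u) u := by
    have := ((hasDerivAt_id u).div_const T).log (by simp; exact ⟨hu.ne', hT.ne'⟩)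
    refine this.congr_deriv ?_
    change 1 / T / (u / T) = 1 / u
    field_simp
  have h2 := (((hasDerivAt_id u).mul (h1.pow 2)).sub (((hasDerivAt_id u).mul h1).const_mul 2)).add ((hasDerivAt_id u).const_mul 2)
  refine h2.congr_deriv ?_
  simp only [id, Pi.pow_apply]
  field_simp
  ring

lemma aux_F_cont (T : ℝ) (hT : 0 < T) :
    ContinuousOn (fun u => u * Real.log (u/T)^2 - 2 * (u * Real.log (u/T)) + 2 * u) (Set.Icc 0 T) := by
  have hc : Continuous (fun u : ℝ => T * (4 * (Real.sqrt (u/T) * Real.log (Real.sqrt (u/T)))^2) - 2 * (T * (u/T * Real.log (u/T))) + 2 * u) := by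
    have a := Real.continuous_mul_log
    have b := a.comp (f := fun u : ℝ => Real.sqrt (u/T)) (by fun_prop)
    have c := a.comp (f := fun u : ℝ => u/T) (by fun_prop)
    simp only [Function.comp_def] at b c
    fun_prop
  refine hc.continuousOn.congr ?_
  intro u hu
  have h0 : 0 ≤ u/T := div_nonneg hu.1 hT.le
  dsimp only
  rw [Real.log_sqrt h0, mul_pow, Real.sq_sqrt h0]
  field_simp
  ring

lemma aux_log_int (T : ℝ) (hT : 0 < T) :
    IntervalIntegrable (fun u => Real.log (u/T)^2) volume 0 T ∧
    ∫ u in (0:ℝ)..T, Real.log (u/T)^2 = 2 * T := by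
  have hi : IntervalIntegrable (fun u => Real.log (u/T)^2) volume 0 T := by
    rw [intervalIntegrable_iff_integrableOn_Ioc_of_le hT.le]
    exact integrableOn_deriv_of_nonneg (aux_F_cont T hT)
      (fun u hu => aux_F_deriv T hT u hu.1) (fun u _ => sq_nonneg _)
  refine ⟨hi, ?_⟩
  rw [intervalIntegral.integral_eq_sub_of_hasDerivAt_of_le hT.le (aux_F_cont T hT)
    (fun u hu => aux_F_deriv T hT u hu.1) hi]
  simp [hT.ne']

/-- the periodic majorant -/
def auxH (d : ℝ) : ℝ :=
  (if 4 * mR^2 * Real.sin (d/2)^2 ≤ 1 then Real.log (4 * mR^2 * Real.sin (d/2)^2)^2 else 0) +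
  (if 1 ≤ (MR-mR)^2 + 4 * MR^2 * Real.sin (d/2)^2 then Real.cos d^2 * (4 * Real.log (2*MR)^2) else 0)

/-- majorant of the majorant on `[0,π]` -/
def auxG (d : ℝ) : ℝ :=
  (Set.Ioc 0 tOne).indicator (fun d => 4 * Real.log (d/tOne)^2) d +
  (Set.Icc tTwo π).indicator (fun d => Real.cos d^2 * (4 * Real.log (2*MR)^2)) d

lemma auxH_periodic : Function.Periodic auxH (2 * π) := by
  intro d
  unfold auxH
  have h : Real.sin ((d + 2*π)/2)^2 = Real.sin (d/2)^2 := by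
    rw [show (d+2*π)/2 = d/2 + π by ring, Real.sin_add_pi]; ring
  rw [h, Real.cos_add_two_pi]

lemma auxH_even (d : ℝ) : auxH (-d) = auxH d := by
  unfold auxH
  rw [neg_div, Real.sin_neg, Real.cos_neg, neg_sq]

lemma auxH_nonneg (d : ℝ) : 0 ≤ auxH d := by
  unfold auxH
  split_ifs <;> positivity

lemma auxH_meas : Measurable auxH := by
  unfold auxH
  refine Measurable.add ?_ ?_
  · refine Measurable.ite (measurableSet_le (by fun_prop) (by fun_prop)) (by fun_prop) (by fun_prop)
  · refine Measurable.ite (measurableSet_le (by fun_prop) (by fun_prop)) (by fun_prop) (by fun_prop)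

lemma aux_tOne : 0 < tOne ∧ tOne ≤ π ∧ Real.sin (tOne/2) = 1 / (2 * mR) := by
  unfold tOne
  have h : (0:ℝ) < 1 / (2 * mR) := by norm_num [mR]
  have h1 : 1 / (2 * mR) ≤ 1 := by norm_num [mR]
  refine ⟨by have := Real.arcsin_pos.2 h; linarith, by have := Real.arcsin_le_pi_div_two (1/(2*mR)); linarith, ?_⟩
  rw [mul_div_cancel_left₀ _ (by norm_num : (2:ℝ) ≠ 0)]
  exact Real.sin_arcsin (by linarith) h1

lemma aux_tTwo : 0 ≤ tTwo ∧ tTwo ≤ π := by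
  unfold tTwo
  have h : (0:ℝ) ≤ Real.sqrt (1 - (MR - mR) ^ 2) / (2 * MR) := by
    have : (0:ℝ) < MR := by norm_num [MR]
    positivity
  have h1 := Real.arcsin_nonneg.2 h
  have h2 := Real.arcsin_le_pi_div_two (Real.sqrt (1 - (MR - mR) ^ 2) / (2 * MR))
  constructor <;> linarith

lemma auxH_le_auxG (d : ℝ) (h0 : 0 < d) (h1 : d ≤ π) : auxH d ≤ auxG d := by
  unfold auxH auxG
  have hm : 0 < mR := by norm_num [mR]
  have hM : 0 < MR := by norm_num [MR]
  have hs : 0 < Real.sin (d/2) := Real.sin_pos_of_pos_of_lt_pi (by linarith) (by linarith)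
  obtain ⟨ht0, htp, ht⟩ := aux_tOne
  refine add_le_add ?_ ?_
  · split_ifs with h
    · have h' : 2 * mR * Real.sin (d/2) ≤ 1 := by
        rw [← sq_le_one_iff₀ (by positivity)]; linarith
      have hdt : d ≤ tOne := by
        by_contra hc
        push Not at hc
        have := Real.sin_lt_sin_of_lt_of_le_pi_div_two (x := tOne/2) (y := d/2) (by linarith) (by linarith) (by linarith)
        rw [ht, div_lt_iff₀ (by positivity)] at this
        linarith
      rw [Set.indicator_of_mem (show d ∈ Set.Ioc 0 tOne from ⟨h0, hdt⟩)]
      have hconc : d / tOne ≤ 2 * mR * Real.sin (d/2) := by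
        have m1 : (0:ℝ) ∈ Set.Icc 0 π := ⟨le_rfl, by linarith⟩
        have m2 : tOne/2 ∈ Set.Icc 0 π := ⟨by linarith, by linarith⟩
        have hcc := strictConcaveOn_sin_Icc.concaveOn.2 m1 m2
          (show 0 ≤ 1 - d/tOne by rw [sub_nonneg, div_le_one ht0]; exact hdt) (show 0 ≤ d/tOne by positivity) (by ring)
        simp only [smul_eq_mul, Real.sin_zero, mul_zero, zero_add, ht] at hcc
        rw [show d / tOne * (tOne/2) = d/2 by field_simp] at hcc
        calc d / tOne = 2 * mR * (d / tOne * (1 / (2 * mR))) := by field_simp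
          _ ≤ _ := by gcongr
      have e : Real.log (4 * mR^2 * Real.sin (d/2)^2) = 2 * Real.log (2 * mR * Real.sin (d/2)) := by
        rw [show 4 * mR^2 * Real.sin (d/2)^2 = (2 * mR * Real.sin (d/2))^2 by ring, Real.log_pow]
        norm_num
      rw [e, mul_pow]
      have l1 := Real.log_le_log (by positivity) hconc
      have l2 := Real.log_nonpos (by positivity) h'
      nlinarith
    · exact Set.indicator_nonneg (fun _ _ => by positivity) _
  · split_ifs with h
    · have : tTwo ≤ d := by
        unfold tTwo
        have h2 : Real.sqrt (1 - (MR - mR) ^ 2) / (2 * MR) ≤ Real.sin (d/2) := by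
          rw [div_le_iff₀ (by positivity), Real.sqrt_le_left (by positivity)]
          nlinarith
        have h3 := Real.monotone_arcsin h2
        rw [Real.arcsin_sin (by linarith) (by linarith)] at h3
        linarith
      rw [Set.indicator_of_mem (show d ∈ Set.Icc tTwo π from ⟨this, h1⟩)]
    · exact Set.indicator_nonneg (fun _ _ => by positivity) _

lemma auxG_int : IntervalIntegrable auxG volume 0 π ∧
    ∫ d in (0:ℝ)..π, auxG d = 8 * tOne + 4 * Real.log (2 * MR)^2 * (π / 2 - (Real.sin (2 * tTwo) + 2 * tTwo) / 4) := by
  obtain ⟨ht0, htp, ht⟩ := aux_tOne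
  obtain ⟨hs0, hsp⟩ := aux_tTwo
  have hpi := Real.pi_pos
  obtain ⟨li, lv⟩ := aux_log_int tOne ht0
  have l4 := li.const_mul 4
  rw [intervalIntegrable_iff_integrableOn_Ioc_of_le ht0.le] at l4
  have i1 : Integrable ((Set.Ioc 0 tOne).indicator (fun d => 4 * Real.log (d/tOne)^2)) volume :=
    (integrable_indicator_iff measurableSet_Ioc).2 l4
  have i2 : Integrable ((Set.Icc tTwo π).indicator (fun d => Real.cos d^2 * (4 * Real.log (2*MR)^2))) volume :=
    (integrable_indicator_iff measurableSet_Icc).2 ((by fun_prop : Continuous _).continuousOn.integrableOn_Icc)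
  refine ⟨(i1.add i2).intervalIntegrable, ?_⟩
  unfold auxG
  rw [intervalIntegral.integral_add i1.intervalIntegrable i2.intervalIntegrable]
  congr 1
  · rw [intervalIntegral.integral_of_le hpi.le, setIntegral_indicator measurableSet_Ioc,
      Set.inter_eq_right.2 (Set.Ioc_subset_Ioc_right htp), ← intervalIntegral.integral_of_le ht0.le,
      intervalIntegral.integral_const_mul, lv]
    ring
  · rw [intervalIntegral.integral_of_le hpi.le, ← integral_Icc_eq_integral_Ioc, setIntegral_indicator measurableSet_Icc,
      Set.inter_eq_right.2 (Set.Icc_subset_Icc_left hs0), integral_Icc_eq_integral_Ioc, ← intervalIntegral.integral_of_le hsp,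
      intervalIntegral.integral_mul_const, integral_cos_sq, Real.sin_two_mul]
    simp
    ring

lemma auxH_int : IntervalIntegrable auxH volume (-π) π ∧
    ∫ d in (-π)..π, auxH d ≤ 16 * tOne + 8 * Real.log (2 * MR)^2 * (π / 2 - (Real.sin (2 * tTwo) + 2 * tTwo) / 4) := by
  obtain ⟨gi, gv⟩ := auxG_int
  have hpi := Real.pi_pos
  have hi : IntervalIntegrable auxH volume 0 π := by
    refine gi.mono_fun' auxH_meas.aestronglyMeasurable ?_
    rw [Set.uIoc_of_le hpi.le]
    refine (ae_restrict_mem measurableSet_Ioc).mono fun d hd => ?_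
    dsimp only
    rw [Real.norm_of_nonneg (auxH_nonneg d)]
    exact auxH_le_auxG d hd.1 hd.2
  have hneg : IntervalIntegrable auxH volume (-π) 0 := by
    have := hi.comp_sub_left 0
    simp only [zero_sub, sub_zero, auxH_even] at this
    exact this.symm
  refine ⟨hneg.trans hi, ?_⟩
  rw [← intervalIntegral.integral_add_adjacent_intervals hneg hi]
  have e : ∫ d in (-π)..0, auxH d = ∫ d in (0:ℝ)..π, auxH d := by
    have h := intervalIntegral.integral_comp_neg (a := 0) (b := π) auxH
    simp only [auxH_even, neg_zero] at h
    exact h.symm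
  rw [e]
  have hle : ∫ d in (0:ℝ)..π, auxH d ≤ ∫ d in (0:ℝ)..π, auxG d :=
    intervalIntegral.integral_mono_on_of_le_Ioo hpi.le hi gi (fun d hd => auxH_le_auxG d hd.1 hd.2.le)
  rw [gv] at hle
  linarith

lemma aux_C_pt (v : ℝ → ℝ) (hv : memY v) (x y : ℝ) (hs : Real.sin ((x-y)/2) ≠ 0) :
    Cfun v x y ^ 2 ≤ (1 / (4 * π * Om))^2 * auxH (x - y) := by
  obtain ⟨hA1, hA2, hA3⟩ := aux_A v hv x y
  have hm : 0 < mR := by norm_num [mR]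
  have hM : 0 < MR := by norm_num [MR]
  have hp : 0 < 4 * mR^2 * Real.sin ((x-y)/2)^2 := by positivity
  unfold Cfun
  rw [mul_assoc, mul_pow]
  gcongr
  unfold auxH
  rcases le_total (Afun v x y) 1 with hA | hA
  · rw [if_pos (hA1.trans hA)]
    have l1 := Real.log_le_log hp hA1
    have l2 := Real.log_nonpos (hp.le.trans hA1) hA
    have l3 : Real.log (Afun v x y)^2 ≤ Real.log (4 * mR^2 * Real.sin ((x-y)/2)^2)^2 := by nlinarith
    have : (Real.cos (x-y) * Real.log (Afun v x y))^2 ≤ Real.log (Afun v x y)^2 := by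
      rw [mul_pow]
      exact mul_le_of_le_one_left (sq_nonneg _) (Real.cos_sq_le_one _)
    refine (this.trans l3).trans (le_add_of_nonneg_right ?_)
    split_ifs <;> positivity
  · rw [if_pos (hA.trans hA2)]
    have l1 := Real.log_le_log (by linarith) hA3
    rw [Real.log_pow] at l1
    push_cast at l1
    have l2 := Real.log_nonneg hA
    refine le_trans ?_ (le_add_of_nonneg_left (by split_ifs <;> positivity))
    rw [mul_pow]
    gcongr
    nlinarith

lemma aux_C (v : ℝ → ℝ) (hv : memY v) (x : ℝ) :
    (∫ y in (0:ℝ)..(2 * π), Cfun v x y ^ 2) ^ ((1:ℝ)/2) ≤ b1 := by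
  obtain ⟨hi, hle⟩ := auxH_int
  have hpi := Real.pi_pos
  have hOm : 0 < Om := by norm_num [Om]
  have hall : ∀ a b, IntervalIntegrable auxH volume a b := by
    intro a b
    refine auxH_periodic.intervalIntegrable (t := -π) (by positivity) ?_ a b
    convert hi using 1
    ring
  have hshift : IntervalIntegrable (fun y => (1 / (4 * π * Om))^2 * auxH (x - y)) volume 0 (2*π) := by
    have := ((hall (x - 0) (x - 2*π)).comp_sub_left x).const_mul ((1 / (4 * π * Om))^2)
    simpa using this
  have hval : ∫ y in (0:ℝ)..(2*π), auxH (x - y) = ∫ d in (-π)..π, auxH d := by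
    rw [intervalIntegral.integral_comp_sub_left auxH x]
    have := auxH_periodic.intervalIntegral_add_eq (x - 2*π) (-π)
    rw [show x - 2*π + 2*π = x - 0 by ring, show -π + 2*π = π by ring] at this
    exact this
  have hcount : ∀ᵐ y : ℝ, Real.sin ((x-y)/2) ≠ 0 := by
    have hc : {y : ℝ | ¬ Real.sin ((x-y)/2) ≠ 0}.Countable := by
      refine (Set.countable_range (fun n : ℤ => x - 2 * (n * π))).mono ?_
      intro y hy
      simp only [ne_eq, not_not, Set.mem_ofPred_eq] at hy
      obtain ⟨n, hn⟩ := Real.sin_eq_zero_iff.1 hy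
      exact ⟨n, by dsimp only; rw [hn]; ring⟩
    exact hc.measure_zero volume
  have hmain : ∫ y in (0:ℝ)..(2 * π), Cfun v x y ^ 2 ≤ ∫ y in (0:ℝ)..(2*π), (1 / (4 * π * Om))^2 * auxH (x - y) := by
    rw [intervalIntegral.integral_of_le (by positivity), intervalIntegral.integral_of_le (by positivity)]
    refine integral_mono_of_nonneg (Filter.Eventually.of_forall fun y => sq_nonneg _) hshift.1 ?_
    exact ae_restrict_of_ae (hcount.mono fun y hy => aux_C_pt v hv x y hy)
  rw [intervalIntegral.integral_const_mul, hval] at hmain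
  rw [← Real.sqrt_eq_rpow]
  unfold b1
  have hK : 0 ≤ 1 / (4 * π * Om) := by positivity
  calc _ ≤ Real.sqrt ((1 / (4 * π * Om))^2 * (16 * tOne + 8 * Real.log (2 * MR)^2 * (π / 2 - (Real.sin (2 * tTwo) + 2 * tTwo) / 4))) := by
        apply Real.sqrt_le_sqrt
        refine hmain.trans ?_
        gcongr
    _ = _ := by rw [Real.sqrt_mul (sq_nonneg _), Real.sqrt_sq hK]

/-- Lemma 4.5: bounds on `C[v]` and `S[v]` for `v ∈ Ỹ`. -/
theorem stmt_15 (v : ℝ → ℝ) (hv : memY v) :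
    (∀ x : ℝ, (∫ y in (0:ℝ)..(2 * π), Cfun v x y ^ 2) ^ ((1:ℝ)/2) ≤ b1) ∧
    (∀ x y : ℝ, |Sfun v x y| ≤ b2) := by
  exact ⟨aux_C v hv, aux_S v hv⟩
end
end

section
/- For every v ∈ Ỹ, ‖N[v]‖_{L²([0,π/6])} ≤ C_N · ‖v'‖²_{L²([0,π/6])}, where C_N = √(π/6) + (2^{3/2}π/√6)·b₁ + (2π^{5/2}/6^{3/2} + 2√(6π))·b₂, and b₁, b₂ are defined, with m_R = 0.94, M_R = 1.1, Ω = 1537/3750, t₁ = 2·arcsin(1/(2m_R)), t₂ = 2·arcsin(√(1 − (M_R − m_R)²)/(2M_R)), by b₁ = (1/(4πΩ))·√(16t₁ + 8(log(2M_R))²·(π/2 − (sin(2t₂) + 2t₂)/4)) and b₂ = max{1/(Ω·e·2^{5/2}·m_R), (1/(4πΩ))·log((M_R − m_R)² + 3M_R²), (√3/(8πΩ))·log((M_R − m_R)² + 4M_R²)}. -/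
open Real MeasureTheory intervalIntegral

noncomputable section

/-- `T[v]`, where `dv` plays the role of `v'`. -/
def Tcal (v dv : ℝ → ℝ) (x : ℝ) : ℝ :=
  dv x * (R0 x + ∫ y in (0:ℝ)..(2 * π), (R0 y * Cfun v x y - deriv R0 y * Sfun v x y)) +
    v x * (deriv R0 x +
      ∫ y in (0:ℝ)..(2 * π), (-(deriv R0 y) * Cfun v x y - R0 y * Sfun v x y)) +
    (∫ y in (0:ℝ)..(2 * π), (-(R0 x) * Sfun v x y + deriv R0 x * Cfun v x y) * v y) +
    ∫ y in (0:ℝ)..(2 * π), (-(deriv R0 x) * Sfun v x y - R0 x * Cfun v x y) * dv y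

/-- `E[v]`. -/
def Eop (v : ℝ → ℝ) (x : ℝ) : ℝ :=
  -(R0 x * deriv R0 x) +
    (∫ y in (0:ℝ)..(2 * π), Cfun v x y * (R0 x * deriv R0 y - R0 y * deriv R0 x)) +
    ∫ y in (0:ℝ)..(2 * π), Sfun v x y * (R0 x * R0 y + deriv R0 x * deriv R0 y)

/-- `N[v]`, where `dv` plays the role of `v'`. -/
def Nop (v dv : ℝ → ℝ) (x : ℝ) : ℝ :=
  -(v x * dv x) +
    (∫ y in (0:ℝ)..(2 * π), Cfun v x y * (v x * dv y - v y * dv x)) +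
    ∫ y in (0:ℝ)..(2 * π), Sfun v x y * (v x * v y + dv x * dv y)

/-- The constant `C_N` (with `m = 6`). -/
def CN : ℝ :=
  Real.sqrt (π / 6) + ((2:ℝ) ^ ((3:ℝ)/2) * π / Real.sqrt 6) * b1 +
    (2 * π ^ ((5:ℝ)/2) / (6:ℝ) ^ ((3:ℝ)/2) + 2 * Real.sqrt (6 * π)) * b2

lemma R0_bound (x : ℝ) : |R0 x - 1| ≤ 0.095 := by
  have h : R0 x - 1 = ∑ k ∈ Finset.range 30, coefC (k+1) * Real.cos (6 * ((k+1 : ℕ) : ℝ) * x) := by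
    unfold R0
    rw [Finset.sum_range_succ' _ 30]
    simp [coefC]
  rw [h]
  refine (Finset.abs_sum_le_sum_abs _ _).trans ?_
  have h2 : ∀ k ∈ Finset.range 30, |coefC (k+1) * Real.cos (6 * ((k+1 : ℕ) : ℝ) * x)| ≤ |coefC (k+1)| := by
    intro k _
    rw [abs_mul]
    exact mul_le_of_le_one_right (abs_nonneg _) (Real.abs_cos_le_one _)
  refine (Finset.sum_le_sum h2).trans ?_
  simp only [Finset.sum_range_succ, Finset.sum_range_zero, coefC]
  norm_num [abs_of_pos]

lemma cs_aux_s16 {μ : Measure ℝ} {f g : ℝ → ℝ} (hf : AEStronglyMeasurable f μ)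
    (hg : AEStronglyMeasurable g μ) (hf0 : ∀ x, 0 ≤ f x) (hg0 : ∀ x, 0 ≤ g x)
    (hf2 : Integrable (fun x => f x ^ 2) μ) (hg2 : Integrable (fun x => g x ^ 2) μ) :
    Integrable (fun x => f x * g x) μ ∧
      ∫ x, f x * g x ∂μ ≤ √(∫ x, f x ^ 2 ∂μ) * √(∫ x, g x ^ 2 ∂μ) := by
  have mf : MemLp f 2 μ := (memLp_two_iff_integrable_sq hf).2 hf2
  have mg : MemLp g 2 μ := (memLp_two_iff_integrable_sq hg).2 hg2
  refine ⟨mf.integrable_mul mg, ?_⟩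
  have := integral_mul_le_Lp_mul_Lq_of_nonneg (μ := μ) (p := 2) (q := 2)
    (Real.HolderConjugate.two_two) (f := f) (g := g)
    (Filter.Eventually.of_forall hf0) (Filter.Eventually.of_forall hg0)
    (by simpa using mf) (by simpa using mg)
  simpa [Real.sqrt_eq_rpow] using this

lemma log_sq_int : IntervalIntegrable (fun u => Real.log u ^ 2) volume 0 1 ∧
    ∫ u in (0:ℝ)..1, Real.log u ^ 2 = 2 := by
  have hc1 : ContinuousOn (fun u : ℝ => u * Real.log u ^ 2 - 2 * (u * Real.log u) + 2 * u) (Set.Icc 0 1) := by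
    have h1 := Real.continuous_mul_log
    have h2 : ContinuousOn (fun u : ℝ => 4 * (√u * Real.log √u)^2) (Set.Icc 0 1) := by
      have : Continuous (fun u : ℝ => √u * Real.log √u) := h1.comp Real.continuous_sqrt
      exact ((this.pow 2).const_mul 4).continuousOn
    have h3 : ContinuousOn (fun u : ℝ => u * Real.log u ^ 2) (Set.Icc 0 1) := by
      refine h2.congr ?_
      intro u hu
      have : √u ^ 2 = u := Real.sq_sqrt hu.1
      simp only [Real.log_sqrt hu.1]
      rw [mul_pow, this]; ring
    exact (h3.sub (h1.const_mul 2).continuousOn).add (continuous_id.const_mul 2).continuousOn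
  have hd : ∀ u ∈ Set.Ioo (0:ℝ) 1, HasDerivAt
      (fun u : ℝ => u * Real.log u ^ 2 - 2 * (u * Real.log u) + 2 * u) (Real.log u ^ 2) u := by
    intro u hu
    have hl := Real.hasDerivAt_log hu.1.ne'
    have := (((hasDerivAt_id u).mul (hl.pow 2)).sub (((hasDerivAt_id u).mul hl).const_mul 2)).add
      ((hasDerivAt_id u).const_mul 2)
    refine HasDerivAt.congr_deriv this ?_
    have := hu.1.ne'
    simp [Pi.pow_apply]
    field_simp
    ring
  have hi : IntervalIntegrable (fun u => Real.log u ^ 2) volume 0 1 := by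
    rw [intervalIntegrable_iff_integrableOn_Ioc_of_le zero_le_one]
    exact integrableOn_deriv_of_nonneg hc1 hd (fun x _ => by positivity)
  refine ⟨hi, ?_⟩
  rw [integral_eq_sub_of_hasDerivAt_of_le zero_le_one hc1 hd hi]
  norm_num

/-- majorant of the negative part of the logarithm -/
def lam (t : ℝ) : ℝ := 2 * max 0 (-Real.log (1.8 * |Real.sin (t / 2)|))

def lamt (t : ℝ) : ℝ := 2 * max 0 (-Real.log (0.8 * |t|))

lemma lamt_sq_int : IntervalIntegrable (fun t => lamt t ^ 2) volume (-π) π ∧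
    ∫ t in (-π)..π, lamt t ^ 2 = 20 := by
  have h1 : IntervalIntegrable (fun t => lamt t ^ 2) volume 0 1.25 ∧
      ∫ t in (0:ℝ)..1.25, lamt t ^ 2 = 10 := by
    have hcg : Set.EqOn (fun t => 4 * (Real.log (0.8 * t) ^ 2)) (fun t => lamt t ^ 2) (Set.uIcc 0 1.25) := by
      intro t ht
      rw [Set.uIcc_of_le (by norm_num)] at ht
      have : Real.log (0.8 * t) ≤ 0 := Real.log_nonpos (by linarith [ht.1]) (by linarith [ht.2])
      simp only [lamt, abs_of_nonneg ht.1]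
      rw [max_eq_right (by linarith)]; ring
    have hi := log_sq_int.1.comp_mul_left (c := 0.8)
    norm_num at hi
    constructor
    · refine IntervalIntegrable.congr (f := fun t => 4 * (Real.log (0.8 * t) ^ 2)) ?_ ?_
      · intro t ht
        exact hcg (Set.uIoc_subset_uIcc ht)
      · have := hi.const_mul 4
        norm_num
        exact this
    · rw [← intervalIntegral.integral_congr hcg]
      rw [intervalIntegral.integral_const_mul,
        intervalIntegral.integral_comp_mul_left (fun u => Real.log u ^ 2) (by norm_num : (0.8:ℝ) ≠ 0)]
      norm_num [log_sq_int.2]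
  have h2 : IntervalIntegrable (fun t => lamt t ^ 2) volume 1.25 π ∧
      ∫ t in (1.25:ℝ)..π, lamt t ^ 2 = 0 := by
    have hp := Real.pi_gt_three
    have hcg : Set.EqOn (fun t => (0:ℝ)) (fun t => lamt t ^ 2) (Set.uIcc 1.25 π) := by
      intro t ht
      rw [Set.uIcc_of_le (by norm_num; linarith)] at ht
      have h0 : 0 ≤ t := le_trans (by norm_num) ht.1
      have : 0 ≤ Real.log (0.8 * t) := Real.log_nonneg (by have := ht.1; norm_num at *; linarith)
      simp only [lamt, abs_of_nonneg h0]
      rw [max_eq_left (by linarith)]; ring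
    constructor
    · refine IntervalIntegrable.congr (f := fun t => (0:ℝ)) ?_ (by simp)
      intro t ht
      exact hcg (Set.uIoc_subset_uIcc ht)
    · rw [← intervalIntegral.integral_congr hcg]; simp
  have h3 := h1.1.trans h2.1
  have h4 : ∫ t in (0:ℝ)..π, lamt t ^ 2 = 10 := by
    rw [← intervalIntegral.integral_add_adjacent_intervals h1.1 h2.1, h1.2, h2.2]; norm_num
  have he : ∀ t, lamt (-t) = lamt t := by intro t; simp [lamt]
  have h5 : IntervalIntegrable (fun t => lamt t ^ 2) volume (-π) 0 := by
    have := h3.comp_sub_left 0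
    simp [he] at this
    exact this.symm
  have h6 : ∫ t in (-π)..0, lamt t ^ 2 = 10 := by
    have := intervalIntegral.integral_comp_neg (a := 0) (b := π) (fun t => lamt t ^ 2)
    simp only [he] at this
    rw [← h4, this]; simp
  refine ⟨h5.trans h3, ?_⟩
  rw [← intervalIntegral.integral_add_adjacent_intervals h5 h3, h4, h6]; norm_num

lemma lam_le {t : ℝ} (ht : t ∈ Set.Icc (-π) π) : lam t ≤ lamt t := by
  have key : ∀ t, 0 ≤ t → t ≤ π → lam t ≤ lamt t := by
    intro t h0 hpi
    rcases h0.eq_or_lt with h0 | h0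
    · rw [← h0]; simp [lam, lamt]
    have hs : 0 ≤ Real.sin (t/2) := Real.sin_nonneg_of_nonneg_of_le_pi (by linarith) (by linarith)
    unfold lam lamt
    rw [abs_of_nonneg hs, abs_of_pos h0]
    have hcube : ∀ x : ℝ, 0 < x → x ≤ 0.65 → 0.89 * x ≤ Real.sin x := by
      intro x hx hx1
      have := Real.sin_gt_sub_cube hx
      norm_num at hx1 ⊢
      nlinarith [mul_pos hx hx, mul_nonneg hx.le (sub_nonneg.2 hx1), mul_nonneg (mul_pos hx hx).le (sub_nonneg.2 hx1)]
    rcases le_total t 1.3 with h | h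
    · have := hcube (t/2) (by linarith) (by norm_num at *; linarith)
      have h3 := Real.log_le_log (x := 0.8 * t) (y := 1.8 * Real.sin (t/2)) (by positivity) (by norm_num at *; linarith)
      gcongr
    · have hm : Real.sin 0.65 ≤ Real.sin (t/2) := by
        apply Real.sin_le_sin_of_le_of_le_pi_div_two
        · norm_num; linarith [Real.pi_gt_three]
        · linarith
        · norm_num at *; linarith
      have := hcube 0.65 (by norm_num) le_rfl
      have h4 : 0 ≤ Real.log (1.8 * Real.sin (t/2)) := Real.log_nonneg (by norm_num at *; linarith)
      rw [max_eq_left (by linarith)]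
      simp
  rcases le_total 0 t with h | h
  · exact key t h ht.2
  · have := key (-t) (by linarith) (by linarith [ht.1])
    have e1 : lam (-t) = lam t := by simp [lam, neg_div]
    have e2 : lamt (-t) = lamt t := by simp [lamt]
    rwa [e1, e2] at this

def Lc : ℝ := Real.log 4.84

lemma Lc_pos : 0 ≤ Lc := Real.log_nonneg (by norm_num)

lemma Lc_le : Lc ≤ 1.6 := by
  have h : Lc = 2 * (Real.log 2 + Real.log 1.1) := by
    unfold Lc
    rw [← Real.log_mul (by norm_num) (by norm_num), show (4.84:ℝ) = (2*1.1)^2 by norm_num, Real.log_pow]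
    norm_num
  have := Real.log_two_lt_d9
  have := Real.log_le_sub_one_of_pos (x := 1.1) (by norm_num)
  rw [h]; norm_num at *; linarith

/-- majorant of `(cos t log A)^2` -/
def Pf (t : ℝ) : ℝ := Lc ^ 2 * Real.cos t ^ 2 + lam t ^ 2

lemma Pf_nonneg (t : ℝ) : 0 ≤ Pf t := by unfold Pf; positivity

lemma Pf_meas : Measurable Pf := by unfold Pf lam; fun_prop

lemma Pf_per : Function.Periodic Pf (2 * π) := by
  intro t
  unfold Pf lam
  rw [Real.cos_add_two_pi, show (t + 2 * π) / 2 = t / 2 + π by ring, Real.sin_add_pi, abs_neg]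

lemma Pf_int : IntervalIntegrable Pf volume (-π) π ∧ ∫ t in (-π)..π, Pf t ≤ 28.1 := by
  have hp := Real.pi_pos
  have hd : IntervalIntegrable (fun t => Lc ^ 2 * Real.cos t ^ 2 + lamt t ^ 2) volume (-π) π := by
    refine IntervalIntegrable.add ?_ lamt_sq_int.1
    exact Continuous.intervalIntegrable (by fun_prop) _ _
  have hle : ∀ t ∈ Set.Icc (-π) π, Pf t ≤ Lc ^ 2 * Real.cos t ^ 2 + lamt t ^ 2 := by
    intro t ht
    have h0 : 0 ≤ lam t := by unfold lam; positivity
    have := lam_le ht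
    unfold Pf
    gcongr
  have hP : IntervalIntegrable Pf volume (-π) π := by
    refine hd.mono_fun Pf_meas.aestronglyMeasurable ?_
    rw [Filter.EventuallyLE, ae_restrict_iff' measurableSet_uIoc]
    refine Filter.Eventually.of_forall fun t ht => ?_
    have := hle t (by rw [← Set.uIcc_of_le (by linarith : -π ≤ π)]; exact Set.uIoc_subset_uIcc ht)
    rw [Real.norm_of_nonneg (Pf_nonneg t), Real.norm_of_nonneg ((Pf_nonneg t).trans this)]
    exact this
  refine ⟨hP, ?_⟩
  refine (intervalIntegral.integral_mono_on (by linarith) hP hd hle).trans ?_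
  rw [intervalIntegral.integral_add (Continuous.intervalIntegrable (by fun_prop) _ _) lamt_sq_int.1,
    lamt_sq_int.2, intervalIntegral.integral_const_mul, integral_cos_sq]
  simp
  have h1 := Lc_le
  have h0 := Lc_pos
  have : Lc^2 ≤ 1.6^2 := by gcongr
  have := Real.pi_lt_d4
  have : Lc^2 * ((π + π)/2) ≤ 1.6^2 * 3.1416 := by
    gcongr; linarith
  norm_num at *; linarith

lemma Pf_shift (x : ℝ) : IntegrableOn (fun y => Pf (x - y)) (Set.Ioc 0 (2 * π)) ∧
    ∫ y in Set.Ioc 0 (2 * π), Pf (x - y) ≤ 28.1 := by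
  have hp := Real.pi_pos
  have hall : ∀ a b, IntervalIntegrable Pf volume a b := by
    intro a b
    refine Pf_per.intervalIntegrable (t := -π) (by linarith) ?_ a b
    have := Pf_int.1
    convert this using 1; ring
  constructor
  · rw [← intervalIntegrable_iff_integrableOn_Ioc_of_le (by positivity)]
    have := (hall (x) (x-2*π)).comp_sub_left x
    simpa using this
  · rw [← intervalIntegral.integral_of_le (by positivity), intervalIntegral.integral_comp_sub_left]
    have := Pf_per.intervalIntegral_add_eq (x - 2 * π) (-π)
    rw [show x - 2 * π + 2 * π = x - 0 by ring, show -π + 2 * π = π by ring] at this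
    rw [this]; exact Pf_int.2

/-- Pointwise bound of the logarithm. -/
lemma log_bound {r s t : ℝ} (hr : r ∈ Set.Icc 0.9 1.1) (hs : s ∈ Set.Icc 0.9 1.1)
    (ht : Real.sin (t / 2) ≠ 0) :
    |Real.cos t * Real.log (r ^ 2 + s ^ 2 - 2 * r * s * Real.cos t)| ≤ √(Pf t) ∧
    |Real.sin t * Real.log (r ^ 2 + s ^ 2 - 2 * r * s * Real.cos t)| ≤ Lc := by
  obtain ⟨hr1, hr2⟩ := hr
  obtain ⟨hs1, hs2⟩ := hs
  norm_num at hr1 hr2 hs1 hs2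
  set A := r ^ 2 + s ^ 2 - 2 * r * s * Real.cos t with hA
  set q := |Real.sin (t/2)| with hq
  have hq0 : 0 < q := abs_pos.2 ht
  have hcos : Real.cos t = 1 - 2 * q ^ 2 := by
    rw [hq, sq_abs]
    have := Real.cos_two_mul (t/2)
    rw [show 2 * (t/2) = t by ring] at this
    rw [this, Real.cos_sq']; ring
  have hsin : |Real.sin t| ≤ 2 * q := by
    have := Real.sin_two_mul (t/2)
    rw [show 2 * (t/2) = t by ring] at this
    rw [this, abs_mul, abs_mul, ← hq]
    have := Real.abs_cos_le_one (t/2)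
    norm_num
    nlinarith
  have hrs : 0.81 ≤ r * s := by norm_num; nlinarith
  have hrs2 : r * s ≤ 1.21 := by norm_num; nlinarith
  have hlow : (1.8 * q) ^ 2 ≤ A := by
    rw [hA, hcos]; norm_num at *; nlinarith [sq_nonneg (r - s), sq_nonneg q]
  have hup : A ≤ 4.84 := by
    have := Real.neg_one_le_cos t
    rw [hA]; norm_num at *; nlinarith
  have hApos : 0 < A := lt_of_lt_of_le (by positivity) hlow
  have hlogup : Real.log A ≤ Lc := Real.log_le_log hApos hup
  have hloglow : 2 * Real.log (1.8 * q) ≤ Real.log A := by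
    have := Real.log_le_log (by positivity) hlow
    rw [Real.log_pow] at this
    exact_mod_cast this
  have hL := Lc_pos
  rcases le_total 0 (Real.log A) with h | h
  · constructor
    · apply Real.abs_le_sqrt
      rw [mul_pow, mul_comm]
      unfold Pf
      have : Real.log A ^ 2 ≤ Lc ^ 2 := by gcongr
      nlinarith [sq_nonneg (Real.cos t), sq_nonneg (lam t)]
    · rw [abs_mul, abs_of_nonneg h]
      have := Real.abs_sin_le_one t
      nlinarith [abs_nonneg (Real.sin t)]
  · have hlam : |Real.log A| ≤ lam t := by
      rw [abs_of_nonpos h]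
      unfold lam
      rw [← hq]
      have := le_max_right 0 (-Real.log (1.8 * q))
      linarith
    constructor
    · apply Real.abs_le_sqrt
      rw [mul_pow]
      unfold Pf
      have h1 : Real.log A ^ 2 ≤ lam t ^ 2 := by
        rw [← sq_abs (Real.log A)]; gcongr
      have h2 : Real.cos t ^ 2 ≤ 1 := Real.cos_sq_le_one t
      nlinarith [sq_nonneg (Real.cos t), sq_nonneg (lam t), sq_nonneg Lc, sq_nonneg (Real.log A),
        mul_nonneg (sq_nonneg Lc) (sq_nonneg (Real.cos t))]
    · rw [abs_mul, abs_of_nonpos h]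
      set u := 1.8 * q with hu
      have hu0 : 0 < u := by positivity
      have hlu : - Real.log u ≤ 2 * ((√u)⁻¹ - 1) := by
        have := Real.log_le_sub_one_of_pos (x := (√u)⁻¹) (by positivity)
        rw [Real.log_inv, Real.log_sqrt hu0.le] at this
        linarith
      have hmul : u * (- Real.log u) ≤ 1/2 := by
        have h1 : u * (- Real.log u) ≤ u * (2 * ((√u)⁻¹ - 1)) := by gcongr
        have hz : 0 < √u := by positivity
        have h2 : u * (2 * ((√u)⁻¹ - 1)) = 2 * √u - 2 * (√u)^2 := by
          have : u = √u ^ 2 := (Real.sq_sqrt hu0.le).symm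
          nth_rewrite 1 [this]
          field_simp
        rw [h2] at h1
        nlinarith [sq_nonneg (√u - 1/2)]
      have h3 : |Real.sin t| * -Real.log A ≤ 2 * q * (2 * (-Real.log u)) := by
        apply mul_le_mul hsin (by linarith) (by linarith) (by linarith)
      have h4 : 2 * q * (2 * (-Real.log u)) ≤ 10/9 := by
        have : q = u / 1.8 := by rw [hu]; ring
        rw [this]; norm_num; nlinarith
      have h5 : 10 / 9 ≤ Lc := by
        unfold Lc
        have : Real.log ((4:ℝ)) ≤ Real.log 4.84 := Real.log_le_log (by norm_num) (by norm_num)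
        rw [show (4:ℝ) = 2^2 by norm_num, Real.log_pow] at this
        have := Real.log_two_gt_d9
        norm_num at *; linarith
      linarith
lemma even_per_int {f : ℝ → ℝ} (he : ∀ x, f (-x) = f x) (hp : ∀ x, f (x + π / 3) = f x)
    (hi : ∀ a b, IntervalIntegrable f volume a b) :
    (∫ x in (0:ℝ)..(2 * π), f x = 12 * ∫ x in (0:ℝ)..(π / 6), f x) ∧
    (∫ x in (-π)..π, f x = 12 * ∫ x in (0:ℝ)..(π / 6), f x) := by
  have hper : Function.Periodic f (π / 3) := hp
  have h1 : ∫ x in (-(π/6))..0, f x = ∫ x in (0:ℝ)..(π / 6), f x := by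
    have := intervalIntegral.integral_comp_neg (a := 0) (b := π / 6) f
    simp only [he] at this
    rw [this]; simp
  have h2 : ∫ x in (-(π/6))..(-(π/6) + π/3), f x = 2 * ∫ x in (0:ℝ)..(π / 6), f x := by
    rw [← intervalIntegral.integral_add_adjacent_intervals (hi (-(π/6)) 0) (hi 0 _), h1,
      show -(π/6) + π/3 = π/6 by ring]
    ring
  have h3 : ∀ t, ∫ x in t..(t + 2 * π), f x = 12 * ∫ x in (0:ℝ)..(π / 6), f x := by
    intro t
    have := hper.intervalIntegral_add_zsmul_eq 6 t hi
    rw [hper.intervalIntegral_add_eq t (-(π/6)), h2] at this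
    rw [show t + 2 * π = t + (6:ℤ) • (π/3) by simp; ring, this]
    simp; ring
  constructor
  · simpa using h3 0
  · have := h3 (-π)
    rwa [show -π + 2 * π = π by ring] at this

/-- distance to the lattice `(π/3)ℤ` -/
def dl (x : ℝ) : ℝ := |x - ⌊x * (3 / π) + 1 / 2⌋ * (π / 3)|

lemma dl_meas : Measurable dl := by
  unfold dl
  have : Measurable (fun x : ℝ => ((⌊x * (3 / π) + 1 / 2⌋ : ℤ) : ℝ)) := by
    have h : Measurable (fun x : ℝ => x * (3 / π) + 1 / 2) := by fun_prop
    exact (measurable_from_top (f := fun n : ℤ => (n : ℝ))).comp h.floor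
  fun_prop

lemma dl_nonneg (x : ℝ) : 0 ≤ dl x := abs_nonneg _

lemma dl_le (x : ℝ) : dl x ≤ π / 6 := by
  have hp := Real.pi_pos
  unfold dl
  set k := ⌊x * (3 / π) + 1 / 2⌋
  have h1 := Int.floor_le (x * (3 / π) + 1 / 2)
  have h2 := Int.lt_floor_add_one (x * (3 / π) + 1 / 2)
  have h3 : x = (x * (3 / π)) * (π / 3) := by field_simp
  have hp3 : 0 < π / 3 := by positivity
  rw [abs_le]
  constructor
  · nlinarith
  · nlinarith

lemma dl_per (x : ℝ) : dl (x + π / 3) = dl x := by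
  have hp := Real.pi_pos
  unfold dl
  have : (x + π / 3) * (3 / π) + 1 / 2 = (x * (3 / π) + 1 / 2) + 1 := by field_simp; ring
  rw [this, Int.floor_add_one]
  push_cast
  congr 1; ring

lemma dl_eq {x : ℝ} (h : -(π / 6) ≤ x) (h' : x ≤ π / 6) : dl x = |x| := by
  have hp := Real.pi_pos
  rcases h'.eq_or_lt with h' | h'
  · subst h'
    unfold dl
    rw [show π / 6 * (3 / π) + 1 / 2 = 1 by field_simp; norm_num, Int.floor_one, abs_sub_comm]
    push_cast
    congr 1; ring
  · unfold dl
    have h3 : x = (x * (3 / π)) * (π / 3) := by field_simp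
    have hp3 : 0 < π / 3 := by positivity
    have : ⌊x * (3 / π) + 1 / 2⌋ = 0 := by
      rw [Int.floor_eq_zero_iff]
      constructor
      · by_contra hc
        push Not at hc
        nlinarith
      · by_contra hc
        push Not at hc
        nlinarith
    rw [this]; simp

lemma dl_int : (∀ a b, IntervalIntegrable dl volume a b) ∧
    ∫ y in Set.Ioc 0 (2 * π), dl y = π ^ 2 / 6 := by
  have hp := Real.pi_pos
  have hi : ∀ a b, IntervalIntegrable dl volume a b := by
    intro a b
    refine (intervalIntegrable_const (c := π / 6)).mono_fun dl_meas.aestronglyMeasurable ?_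
    refine Filter.Eventually.of_forall fun t => ?_
    change ‖dl t‖ ≤ ‖π / 6‖
    rw [Real.norm_of_nonneg (dl_nonneg t), Real.norm_of_nonneg (by positivity)]
    exact dl_le t
  refine ⟨hi, ?_⟩
  have hper : Function.Periodic dl (π / 3) := dl_per
  have h0 : ∫ x in (0:ℝ)..(π/6), dl x = π ^ 2 / 72 := by
    have : ∫ x in (0:ℝ)..(π/6), dl x = ∫ x in (0:ℝ)..(π/6), x := by
      apply intervalIntegral.integral_congr
      intro x hx
      rw [Set.uIcc_of_le (by positivity)] at hx
      simp only
      rw [dl_eq (by linarith [hx.1]) hx.2, abs_of_nonneg hx.1]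
    rw [this, integral_id]; ring
  have h1 : ∫ x in (-(π/6))..0, dl x = π ^ 2 / 72 := by
    have : ∫ x in (-(π/6))..0, dl x = ∫ x in (-(π/6))..0, -x := by
      apply intervalIntegral.integral_congr
      intro x hx
      rw [Set.uIcc_of_le (by linarith)] at hx
      rw [dl_eq hx.1 (by linarith [hx.2]), abs_of_nonpos hx.2]
    rw [this, intervalIntegral.integral_neg, integral_id]; ring
  have h2 : ∫ x in (-(π/6))..(-(π/6) + π/3), dl x = π ^ 2 / 36 := by
    rw [← intervalIntegral.integral_add_adjacent_intervals (hi (-(π/6)) 0) (hi 0 _), h1,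
      show -(π/6) + π/3 = π/6 by ring, h0]
    ring
  have := hper.intervalIntegral_add_zsmul_eq 6 0 hi
  rw [hper.intervalIntegral_add_eq 0 (-(π/6)), h2] at this
  rw [← intervalIntegral.integral_of_le (by positivity),
    show 2 * π = 0 + (6:ℤ) • (π/3) by simp; ring, this]
  simp; ring

lemma abs_meas {w : ℝ → ℝ} (hloc : LocallyIntegrable (fun y => w y ^ 2) volume) :
    AEStronglyMeasurable (fun y => |w y|) volume := by
  have h := hloc.aestronglyMeasurable
  have := Real.continuous_sqrt.comp_aestronglyMeasurable h
  refine this.congr (Filter.Eventually.of_forall fun x => ?_)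
  simp [Real.sqrt_sq_eq_abs]

lemma v_bound_s16 {w v : ℝ → ℝ}
    (hodd : ∀ x : ℝ, w (-x) = -w x)
    (hper : ∀ x : ℝ, w (x + π / 3) = w x)
    (hloc : LocallyIntegrable (fun y => w y ^ 2) volume)
    (hv : ∀ x : ℝ, v x = ∫ y in (0:ℝ)..x, w y) (x : ℝ) :
    |v x| ≤ √(dl x) * √(∫ x in (0:ℝ)..(π / 6), w x ^ 2) := by
  have hp := Real.pi_pos
  have hm := abs_meas hloc
  have hev : ∀ x, v (-x) = v x := by
    intro x
    have := intervalIntegral.integral_comp_neg (a := 0) (b := x) w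
    simp only [hodd, intervalIntegral.integral_neg, neg_zero] at this
    rw [hv, hv, intervalIntegral.integral_symm, ← this, neg_neg]
  have hii : ∀ a b, IntegrableOn (fun y => w y ^ 2) (Set.Ioc a b) := fun a b =>
    (hloc.integrableOn_isCompact isCompact_Icc).mono_set Set.Ioc_subset_Icc_self
  -- small x
  have hsm0 : ∀ x, 0 ≤ x → x ≤ π / 6 → |v x| ≤ √x * √(∫ x in (0:ℝ)..(π / 6), w x ^ 2) := by
    intro x hx0 hx
    rw [hv]
    rw [← Real.norm_eq_abs]
    have h1 : ‖∫ y in (0:ℝ)..x, w y‖ ≤ ∫ y in (0:ℝ)..x, ‖w y‖ :=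
      intervalIntegral.norm_integral_le_integral_norm hx0
    refine h1.trans ?_
    have h2 := (cs_aux_s16 (μ := volume.restrict (Set.Ioc 0 x)) (f := fun _ => (1:ℝ)) (g := fun y => |w y|)
      aestronglyMeasurable_const hm.restrict (fun _ => zero_le_one) (fun _ => abs_nonneg _)
      (by simp) (by simp only [sq_abs]; exact hii 0 x)).2
    simp only [one_mul, sq_abs, one_pow] at h2
    rw [intervalIntegral.integral_of_le hx0, intervalIntegral.integral_of_le (by positivity)]
    simp only [Real.norm_eq_abs]
    refine h2.trans ?_
    have h3 : ∫ a in Set.Ioc 0 x, (1:ℝ) = x := by simp [hx0]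
    rw [h3]
    gcongr
    · exact Filter.Eventually.of_forall fun y => by positivity
    · exact hii _ _
  have hsm : ∀ x, -(π/6) ≤ x → x ≤ π / 6 → |v x| ≤ √|x| * √(∫ x in (0:ℝ)..(π / 6), w x ^ 2) := by
    intro x h1 h2
    rcases le_total 0 x with h | h
    · rw [abs_of_nonneg h]; exact hsm0 x h h2
    · rw [abs_of_nonpos h, ← hev]; exact hsm0 (-x) (by linarith) (by linarith)
  by_cases hint : IntervalIntegrable w volume 0 (π / 6)
  · have hneg : IntervalIntegrable w volume (-(π/6)) 0 := by
      have := hint.comp_sub_left 0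
      simp [hodd] at this
      have h2 := this.neg
      rw [show (-fun x => -w x) = w by ext; simp] at h2
      exact h2.symm
    have hall : ∀ a b, IntervalIntegrable w volume a b := by
      have hP : Function.Periodic w (π/3) := hper
      refine hP.intervalIntegrable (t := -(π/6)) (by positivity) ?_
      rw [show -(π/6) + π/3 = π/6 by ring]
      exact hneg.trans hint
    have hvp : Function.Periodic v (π / 3) := by
      intro x
      have hP : Function.Periodic w (π/3) := hper
      rw [hv, hv, ← intervalIntegral.integral_add_adjacent_intervals (hall 0 x) (hall x (x + π/3)),
        hP.intervalIntegral_add_eq x (-(π/6)), show -(π/6) + π/3 = π/6 by ring,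
        ← intervalIntegral.integral_add_adjacent_intervals (hall (-(π/6)) 0) (hall 0 (π/6))]
      have h := hev (π/6)
      rw [hv, hv, intervalIntegral.integral_symm] at h
      linarith
    have h := hvp.sub_zsmul_eq (x := x) ⌊x * (3 / π) + 1 / 2⌋
    have hd := dl_le x
    unfold dl at hd ⊢
    rw [abs_le] at hd
    rw [← h]
    simp only [zsmul_eq_mul]
    exact hsm _ hd.1 hd.2
  · by_cases hx : -(π/6) ≤ x ∧ x ≤ π / 6
    · rw [dl_eq hx.1 hx.2]; exact hsm x hx.1 hx.2
    · have : v x = 0 := by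
        have key : ∀ x, π/6 ≤ x → v x = 0 := by
          intro x hx
          rw [hv]
          apply intervalIntegral.integral_undef
          intro hc
          apply hint
          refine hc.mono_set ?_
          rw [Set.uIcc_of_le (by positivity), Set.uIcc_of_le (by linarith)]
          exact Set.Icc_subset_Icc_right hx
        rcases le_total 0 x with h | h
        · apply key
          by_contra hc
          exact hx ⟨by linarith, by linarith⟩
        · rw [← hev]; apply key
          by_contra hc
          exact hx ⟨by linarith, by linarith⟩
      rw [this]; simp; positivity
def kap : ℝ := 1 / (4 * π * Om)

lemma kap_pos : 0 < kap := by unfold kap Om; positivity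

def aC : ℝ := kap * (√28.1 * √12 + Lc * (√(2 * π) * √(π ^ 2 / 6)))
def bC : ℝ := √(π / 6) + kap * (√28.1 * √(π ^ 2 / 6) + Lc * (√(2 * π) * √12))

lemma N_bound {w v : ℝ → ℝ} {W : ℝ} (hW0 : 0 ≤ W) (hW1 : W ≤ 2e-5)
    (hm : AEStronglyMeasurable (fun y => |w y|) volume)
    (hwi : IntegrableOn (fun y => w y ^ 2) (Set.Ioc 0 (2 * π)))
    (hwe : ∫ y in Set.Ioc 0 (2 * π), w y ^ 2 = 12 * W ^ 2)
    (hvb : ∀ x, |v x| ≤ √(dl x) * W) {x : ℝ} (hx0 : 0 ≤ x) (hx1 : x ≤ π / 6) :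
    |Nop v w x| ≤ W ^ 2 * aC * √x + W * bC * |w x| := by
  have hp := Real.pi_pos
  have hk := kap_pos
  have hL := Lc_pos
  have h2p : (0:ℝ) ≤ 2 * π := by positivity
  set G : ℝ → ℝ := fun y => √(dl y) * W with hG
  have hG0 : ∀ y, 0 ≤ G y := fun y => by positivity
  have hGm : Measurable G := by
    have := dl_meas
    exact (Real.continuous_sqrt.measurable.comp this).mul_const W
  have hGsq : ∀ y, G y ^ 2 = dl y * W ^ 2 := by
    intro y; rw [hG]; simp only; rw [mul_pow, Real.sq_sqrt (dl_nonneg y)]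
  set μ := volume.restrict (Set.Ioc 0 (2 * π)) with hμ
  have hGi : Integrable (fun y => G y ^ 2) μ := by
    simp only [hGsq]
    have := (dl_int.1 0 (2 * π))
    rw [intervalIntegrable_iff_integrableOn_Ioc_of_le h2p] at this
    exact this.mul_const _
  have hGe : ∫ y, G y ^ 2 ∂μ = π ^ 2 / 6 * W ^ 2 := by
    simp only [hGsq]
    rw [MeasureTheory.integral_mul_const, hμ, dl_int.2]
  set p : ℝ → ℝ := fun y => √(Pf (x - y)) with hpdef
  have hp0 : ∀ y, 0 ≤ p y := fun y => Real.sqrt_nonneg _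
  have hpm : Measurable p := by
    have : Measurable (fun y => Pf (x - y)) := Pf_meas.comp (by fun_prop)
    exact Real.continuous_sqrt.measurable.comp this
  have hpsq : ∀ y, p y ^ 2 = Pf (x - y) := fun y => Real.sq_sqrt (Pf_nonneg _)
  have hpi : Integrable (fun y => p y ^ 2) μ := by
    simp only [hpsq]; exact (Pf_shift x).1
  have hpe : ∫ y, p y ^ 2 ∂μ ≤ 28.1 := by
    simp only [hpsq]; exact (Pf_shift x).2
  have hwi' : Integrable (fun y => |w y| ^ 2) μ := by simp only [sq_abs]; exact hwi
  have hwe' : ∫ y, |w y| ^ 2 ∂μ = 12 * W ^ 2 := by simp only [sq_abs]; exact hwe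
  -- the four integrals
  have sW : ∀ c : ℝ, 0 ≤ c → √(c * W ^ 2) = √c * W := by
    intro c hc; rw [Real.sqrt_mul hc, Real.sqrt_sq hW0]
  have I1 := cs_aux_s16 hpm.aestronglyMeasurable hm.restrict hp0 (fun y => abs_nonneg (w y)) hpi hwi'
  have I2 := cs_aux_s16 hpm.aestronglyMeasurable hGm.aestronglyMeasurable hp0 hG0 hpi hGi
  have I3 := cs_aux_s16 (μ := μ) (f := fun _ => (1:ℝ)) aestronglyMeasurable_const hGm.aestronglyMeasurable
    (fun _ => zero_le_one) hG0 (by simp [hμ]) hGi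
  have I4 := cs_aux_s16 (μ := μ) (f := fun _ => (1:ℝ)) aestronglyMeasurable_const hm.restrict
    (fun _ => zero_le_one) (fun y => abs_nonneg (w y)) (by simp [hμ]) hwi'
  rw [hwe', sW _ (by norm_num)] at I1 I4
  rw [hGe, sW _ (by positivity)] at I2 I3
  have h1 : ∫ y, (1:ℝ) ^ 2 ∂μ = 2 * π := by simp [hμ, h2p]
  rw [h1] at I3 I4
  simp only [one_mul] at I3 I4
  have hsp : √(∫ y, p y ^ 2 ∂μ) ≤ √28.1 := Real.sqrt_le_sqrt hpe
  have J1 : ∫ y, p y * |w y| ∂μ ≤ √28.1 * (√12 * W) := I1.2.trans (by gcongr)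
  have J2 : ∫ y, p y * G y ∂μ ≤ √28.1 * (√(π ^ 2 / 6) * W) := I2.2.trans (by gcongr)
  have J3 := I3.2
  have J4 := I4.2
  -- ranges
  have hrange : ∀ y, R0 y + v y ∈ Set.Icc (0.9:ℝ) 1.1 := by
    intro y
    have h1 := R0_bound y
    have h2 := hvb y
    have h3 : √(dl y) ≤ 1 := by
      rw [Real.sqrt_le_one]
      have := dl_le y
      have := Real.pi_lt_four
      linarith
    have h4 : |v y| ≤ 1 * 2e-5 := h2.trans (by gcongr)
    rw [abs_le] at h1 h4
    norm_num at h1 h4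
    constructor <;> norm_num <;> linarith [h1.1, h1.2, h4.1, h4.2]
  have hae : ∀ᵐ y ∂μ, Real.sin ((x - y) / 2) ≠ 0 := by
    apply ae_restrict_of_ae
    have hc : (Set.range (fun n : ℤ => x - 2 * (n * π))).Countable := Set.countable_range _
    filter_upwards [hc.ae_notMem volume] with y hy hs
    rw [Real.sin_eq_zero_iff] at hs
    obtain ⟨n, hn⟩ := hs
    exact hy ⟨n, by simp only; linarith⟩
  have hCS : ∀ᵐ y ∂μ, |Cfun v x y| ≤ kap * p y ∧ |Sfun v x y| ≤ kap * Lc := by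
    filter_upwards [hae] with y hy
    have := log_bound (hrange x) (hrange y) hy
    constructor
    · unfold Cfun Afun
      rw [mul_assoc, abs_mul]
      change |kap| * _ ≤ _
      rw [abs_of_pos hk]
      exact mul_le_mul_of_nonneg_left this.1 hk.le
    · unfold Sfun Afun
      rw [mul_assoc, abs_mul]
      change |kap| * _ ≤ _
      rw [abs_of_pos hk]
      exact mul_le_mul_of_nonneg_left this.2 hk.le
  have hvx : |v x| ≤ √x * W := by
    have := hvb x
    rwa [dl_eq (by linarith) hx1, abs_of_nonneg hx0] at this
  have B1 : |∫ y in (0:ℝ)..(2 * π), Cfun v x y * (v x * w y - v y * w x)| ≤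
      kap * (|v x| * (√28.1 * (√12 * W)) + |w x| * (√28.1 * (√(π ^ 2 / 6) * W))) := by
    rw [intervalIntegral.integral_of_le h2p, ← Real.norm_eq_abs]
    have hint : Integrable (fun y => kap * (|v x| * (p y * |w y|) + |w x| * (p y * G y))) μ :=
      ((I1.1.const_mul _).add (I2.1.const_mul _)).const_mul _
    refine (MeasureTheory.norm_integral_le_of_norm_le hint ?_).trans ?_
    · filter_upwards [hCS] with y hy
      rw [Real.norm_eq_abs, abs_mul]
      have h5 : |v x * w y - v y * w x| ≤ |v x| * |w y| + G y * |w x| := by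
        refine (abs_sub _ _).trans ?_
        rw [abs_mul, abs_mul]
        have := hvb y
        gcongr
      calc _ ≤ (kap * p y) * (|v x| * |w y| + G y * |w x|) :=
            mul_le_mul hy.1 h5 (abs_nonneg _) (mul_nonneg hk.le (hp0 y))
        _ = _ := by ring
    · rw [MeasureTheory.integral_const_mul, MeasureTheory.integral_add (I1.1.const_mul _) (I2.1.const_mul _),
        MeasureTheory.integral_const_mul, MeasureTheory.integral_const_mul]
      gcongr
  have B2 : |∫ y in (0:ℝ)..(2 * π), Sfun v x y * (v x * v y + w x * w y)| ≤
      kap * Lc * (|v x| * (√(2 * π) * (√(π ^ 2 / 6) * W)) + |w x| * (√(2 * π) * (√12 * W))) := by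
    rw [intervalIntegral.integral_of_le h2p, ← Real.norm_eq_abs]
    have hint : Integrable (fun y => kap * Lc * (|v x| * G y + |w x| * |w y|)) μ :=
      ((I3.1.const_mul _).add (I4.1.const_mul _)).const_mul _
    refine (MeasureTheory.norm_integral_le_of_norm_le hint ?_).trans ?_
    · filter_upwards [hCS] with y hy
      rw [Real.norm_eq_abs, abs_mul]
      have h5 : |v x * v y + w x * w y| ≤ |v x| * G y + |w x| * |w y| := by
        refine (abs_add_le _ _).trans ?_
        rw [abs_mul, abs_mul]
        have := hvb y
        gcongr
      exact mul_le_mul hy.2 h5 (abs_nonneg _) (mul_nonneg hk.le hL)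
    · rw [MeasureTheory.integral_const_mul, MeasureTheory.integral_add (I3.1.const_mul _) (I4.1.const_mul _),
        MeasureTheory.integral_const_mul, MeasureTheory.integral_const_mul]
      gcongr
  have B0 : |-(v x * w x)| ≤ √(π / 6) * W * |w x| := by
    rw [abs_neg, abs_mul]
    have : √x ≤ √(π / 6) := Real.sqrt_le_sqrt hx1
    have : |v x| ≤ √(π / 6) * W := hvx.trans (by gcongr)
    gcongr
  have hB1 := B1.trans (by gcongr : _ ≤ kap * ((√x * W) * (√28.1 * (√12 * W)) + |w x| * (√28.1 * (√(π ^ 2 / 6) * W))))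
  have hB2 := B2.trans (by gcongr : _ ≤ kap * Lc * ((√x * W) * (√(2 * π) * (√(π ^ 2 / 6) * W)) + |w x| * (√(2 * π) * (√12 * W))))
  unfold Nop
  refine (abs_add_three _ _ _).trans ((add_le_add (add_le_add B0 hB1) hB2).trans (le_of_eq ?_))
  unfold aC bC
  ring

lemma const_ineq : aC * √(π ^ 2 / 72) + bC ≤ CN := by
  have hk := kap_pos
  have hp := Real.pi_pos
  have hL0 := Lc_pos
  have hL := Lc_le
  have hb1 : kap * 4.12 ≤ b1 := by
    unfold b1
    change kap * _ ≤ kap * _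
    gcongr
    apply Real.le_sqrt_of_sq_le
    have h1 : 1 / 0.94 ≤ tOne := by
      unfold tOne mR
      have := Real.sin_le (x := Real.arcsin (1 / (2 * 0.94))) (Real.arcsin_nonneg.2 (by norm_num))
      rw [Real.sin_arcsin (by norm_num) (by norm_num)] at this
      norm_num at *; linarith
    have h2 : tTwo ≤ π / 3 := by
      have : Real.arcsin (√(1 - (MR - mR) ^ 2) / (2 * MR)) ≤ π / 6 := by
        rw [← Real.arcsin_sin (x := π / 6) (by linarith) (by linarith)]
        apply Real.monotone_arcsin
        rw [Real.sin_pi_div_six]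
        unfold MR mR
        have : √(1 - (1.1 - 0.94) ^ 2) ≤ (1:ℝ) := by rw [Real.sqrt_le_one]; norm_num
        rw [div_le_iff₀ (by norm_num)]
        norm_num at *; linarith
      unfold tTwo; linarith
    have h3 : 0 ≤ π / 2 - (Real.sin (2 * tTwo) + 2 * tTwo) / 4 := by
      have := Real.sin_le_one (2 * tTwo)
      have := Real.pi_gt_three
      linarith
    have h4 : 0 ≤ 8 * Real.log (2 * MR) ^ 2 * (π / 2 - (Real.sin (2 * tTwo) + 2 * tTwo) / 4) := by
      positivity
    norm_num at *; linarith
  have hb2 : kap * (√3 / 2 * Lc) ≤ b2 := by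
    unfold b2
    refine le_trans ?_ (le_max_right _ _)
    have : √3 / (8 * π * Om) = kap * (√3 / 2) := by
      unfold kap Om; field_simp; norm_num
    rw [this, mul_assoc]
    gcongr
    unfold Lc MR mR
    exact Real.log_le_log (by norm_num) (by norm_num)
  have hpl := Real.pi_gt_d4
  have hpu := Real.pi_lt_d4
  -- simplify the constants
  have e1 : (2:ℝ) ^ ((3:ℝ)/2) = 2 * √2 := by
    rw [show (3:ℝ)/2 = 1 + 1/2 by norm_num, Real.rpow_add (by norm_num), Real.rpow_one, ← Real.sqrt_eq_rpow]
  have e2 : (6:ℝ) ^ ((3:ℝ)/2) = 6 * √6 := by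
    rw [show (3:ℝ)/2 = 1 + 1/2 by norm_num, Real.rpow_add (by norm_num), Real.rpow_one, ← Real.sqrt_eq_rpow]
  have e3 : π ^ ((5:ℝ)/2) = π ^ 2 * √π := by
    rw [show (5:ℝ)/2 = 2 + 1/2 by norm_num, Real.rpow_add hp, ← Real.sqrt_eq_rpow]
    norm_num
  have u28 : √28.1 ≤ 5.302 := Real.sqrt_le_iff.2 (by norm_num)
  have u12 : √12 ≤ 3.4642 := Real.sqrt_le_iff.2 (by norm_num)
  have u2p : √(2 * π) ≤ 2.5067 := Real.sqrt_le_iff.2 ⟨by norm_num, by norm_num at *; linarith⟩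
  have hpp : π ^ 2 ≤ 9.86966 := by norm_num at *; nlinarith
  have hpp' : 9.869 ≤ π ^ 2 := by norm_num at *; nlinarith
  have u6 : √(π ^ 2 / 6) ≤ 1.2826 := Real.sqrt_le_iff.2 ⟨by norm_num, by norm_num at *; linarith⟩
  have u72 : √(π ^ 2 / 72) ≤ 0.37025 := Real.sqrt_le_iff.2 ⟨by norm_num, by norm_num at *; linarith⟩
  have l2 : 1.414 ≤ √2 := Real.le_sqrt_of_sq_le (by norm_num)
  have l3 : 1.732 ≤ √3 := Real.le_sqrt_of_sq_le (by norm_num)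
  have lp : 1.772 ≤ √π := Real.le_sqrt_of_sq_le (by norm_num at *; linarith)
  have l6p : 4.3415 ≤ √(6 * π) := Real.le_sqrt_of_sq_le (by norm_num at *; linarith)
  have u6' : √6 ≤ 2.4495 := Real.sqrt_le_iff.2 (by norm_num)
  have s6 : 0 < √6 := by positivity
  have c1 : 3.62 ≤ 2 * √2 * π / √6 := by
    rw [le_div_iff₀ s6]
    have : 1.414 * 3.1415 ≤ √2 * π := by gcongr
    norm_num at *; linarith
  have c2 : 2.37 ≤ 2 * (π ^ 2 * √π) / (6 * √6) := by
    rw [le_div_iff₀ (by positivity)]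
    have : 9.869 * 1.772 ≤ π ^ 2 * √π := by gcongr
    norm_num at *; linarith
  have hCN : √(π / 6) + 3.62 * (kap * 4.12) + (2.37 + 2 * 4.3415) * (kap * (1.732 / 2 * Lc)) ≤ CN := by
    unfold CN
    rw [e1, e2, e3]
    have : kap * (1.732 / 2 * Lc) ≤ b2 := le_trans (by gcongr) hb2
    gcongr
  refine le_trans ?_ hCN
  have hA : aC * √(π ^ 2 / 72) ≤ kap * (5.302 * 3.4642 + Lc * (2.5067 * 1.2826)) * 0.37025 := by
    unfold aC; gcongr
  have hB : bC ≤ √(π / 6) + kap * (5.302 * 1.2826 + Lc * (2.5067 * 3.4642)) := by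
    unfold bC; gcongr
  have hfin : kap * ((5.302 * 3.4642 + Lc * (2.5067 * 1.2826)) * 0.37025
      + (5.302 * 1.2826 + Lc * (2.5067 * 3.4642))) ≤
      kap * (3.62 * 4.12 + (2.37 + 2 * 4.3415) * (1.732 / 2 * Lc)) := by
    apply mul_le_mul_of_nonneg_left _ hk.le
    norm_num at *; linarith
  linarith

/-- Proposition 4.6: `‖N[v]‖_{L²([0,π/6])} ≤ C_N ‖v'‖²_{L²([0,π/6])}` for `v ∈ Ỹ`. -/
theorem stmt_16 (w : ℝ → ℝ)
    (hodd : ∀ x : ℝ, w (-x) = -w x)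
    (hper : ∀ x : ℝ, w (x + π / 3) = w x)
    (hloc : MeasureTheory.LocallyIntegrable (fun y => w y ^ 2) volume)
    (hnorm : (1 / Real.sqrt 12) * (∫ y in (-π)..π, w y ^ 2) ^ ((1:ℝ)/2) ≤ 2e-5)
    (v : ℝ → ℝ) (hv : ∀ x : ℝ, v x = ∫ y in (0:ℝ)..x, w y) :
    (∫ x in (0:ℝ)..(π / 6), Nop v w x ^ 2) ^ ((1:ℝ)/2) ≤
      CN * ((∫ x in (0:ℝ)..(π / 6), w x ^ 2) ^ ((1:ℝ)/2)) ^ 2 := by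
  have hp := Real.pi_pos
  have hp6 : (0:ℝ) ≤ π / 6 := by positivity
  have h2p : (0:ℝ) ≤ 2 * π := by positivity
  have hm := abs_meas hloc
  have hii : ∀ a b, IntegrableOn (fun y => w y ^ 2) (Set.Ioc a b) := fun a b =>
    (hloc.integrableOn_isCompact isCompact_Icc).mono_set Set.Ioc_subset_Icc_self
  have hiv : ∀ a b, IntervalIntegrable (fun y => w y ^ 2) volume a b := fun a b => ⟨hii a b, hii b a⟩
  have hs := even_per_int (f := fun y => w y ^ 2) (fun x => by simp [hodd]) (fun x => by simp [hper]) hiv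
  have hI0 : 0 ≤ ∫ x in (0:ℝ)..(π / 6), w x ^ 2 :=
    intervalIntegral.integral_nonneg hp6 (fun x _ => sq_nonneg _)
  set I := ∫ x in (0:ℝ)..(π / 6), w x ^ 2 with hI
  set W := √I with hWdef
  have hW0 : 0 ≤ W := Real.sqrt_nonneg _
  have hWsq : W ^ 2 = I := Real.sq_sqrt hI0
  have hW1 : W ≤ 2e-5 := by
    rw [hs.2, ← Real.sqrt_eq_rpow, Real.sqrt_mul (by norm_num)] at hnorm
    have : √12 ≠ 0 := by positivity
    have e : 1 / √12 * (√12 * √I) = W := by field_simp; rfl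
    rwa [e] at hnorm
  have hvb : ∀ x, |v x| ≤ √(dl x) * W := v_bound_s16 hodd hper hloc hv
  have hN : ∀ x, 0 ≤ x → x ≤ π / 6 → |Nop v w x| ≤ W ^ 2 * aC * √x + W * bC * |w x| := by
    intro x h0 h1
    refine N_bound hW0 hW1 hm (hii _ _) ?_ hvb h0 h1
    rw [← intervalIntegral.integral_of_le h2p, hs.1, hWsq]
  have ha0 : 0 ≤ aC := by
    have := kap_pos
    have := Lc_pos
    unfold aC; positivity
  have hb0 : 0 ≤ bC := by
    have := kap_pos
    have := Lc_pos
    unfold bC; positivity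
  rw [← Real.sqrt_eq_rpow, ← Real.sqrt_eq_rpow, ← hWdef]
  have hCN := const_ineq
  set D := √(π ^ 2 / 72) with hD
  have hDsq : D ^ 2 = π ^ 2 / 72 := Real.sq_sqrt (by positivity)
  have hD0 : 0 ≤ D := Real.sqrt_nonneg _
  set μ := volume.restrict (Set.Ioc 0 (π / 6)) with hμ
  have hxi : Integrable (fun x : ℝ => x) μ :=
    (intervalIntegrable_iff_integrableOn_Ioc_of_le hp6).1 intervalIntegrable_id
  have hsq : ∀ᵐ x ∂μ, √x ^ 2 = x := by
    rw [hμ, ae_restrict_iff' measurableSet_Ioc]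
    exact Filter.Eventually.of_forall fun x hx => Real.sq_sqrt hx.1.le
  have hsi : Integrable (fun x : ℝ => √x ^ 2) μ := hxi.congr (by
    filter_upwards [hsq] with x hx using hx.symm)
  have hse : ∫ x, √x ^ 2 ∂μ = D ^ 2 := by
    rw [integral_congr_ae hsq, hμ, ← intervalIntegral.integral_of_le hp6, integral_id, hDsq]; ring
  have hwi' : Integrable (fun y => |w y| ^ 2) μ := by simp only [sq_abs]; exact hii _ _
  have hwe' : ∫ y, |w y| ^ 2 ∂μ = W ^ 2 := by
    simp only [sq_abs]; rw [hWsq, hI, intervalIntegral.integral_of_le hp6]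
  have hcs := cs_aux_s16 (μ := μ) (f := fun x => √x) (g := fun y => |w y|)
    Real.continuous_sqrt.aestronglyMeasurable hm.restrict (fun _ => Real.sqrt_nonneg _)
    (fun _ => abs_nonneg _) hsi hwi'
  rw [hse, hwe', Real.sqrt_sq hD0, Real.sqrt_sq hW0] at hcs
  have hmain : ∫ x in (0:ℝ)..(π / 6), Nop v w x ^ 2 ≤ ((aC * D + bC) * W ^ 2) ^ 2 := by
    rw [intervalIntegral.integral_of_le hp6]
    have hint : Integrable (fun x => (W ^ 2 * aC) ^ 2 * √x ^ 2
        + (2 * (W ^ 2 * aC) * (W * bC) * (√x * |w x|) + (W * bC) ^ 2 * |w x| ^ 2)) μ :=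
      (hsi.const_mul _).add ((hcs.1.const_mul _).add (hwi'.const_mul _))
    refine (integral_mono_of_nonneg (Filter.Eventually.of_forall fun x => sq_nonneg _) hint ?_).trans ?_
    · rw [Filter.EventuallyLE, ae_restrict_iff' measurableSet_Ioc]
      refine Filter.Eventually.of_forall fun x hx => ?_
      have := hN x hx.1.le hx.2
      calc Nop v w x ^ 2 = |Nop v w x| ^ 2 := (sq_abs _).symm
        _ ≤ (W ^ 2 * aC * √x + W * bC * |w x|) ^ 2 := by gcongr
        _ = _ := by ring
    · have hi2 : Integrable (fun x => 2 * (W ^ 2 * aC) * (W * bC) * (√x * |w x|)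
          + (W * bC) ^ 2 * |w x| ^ 2) μ := (hcs.1.const_mul _).add (hwi'.const_mul _)
      rw [MeasureTheory.integral_add (hsi.const_mul _) hi2,
        MeasureTheory.integral_add (hcs.1.const_mul _) (hwi'.const_mul _), MeasureTheory.integral_const_mul, MeasureTheory.integral_const_mul,
        MeasureTheory.integral_const_mul, hse, hwe']
      have h := mul_le_mul_of_nonneg_left hcs.2
        (show 0 ≤ 2 * (W ^ 2 * aC) * (W * bC) by positivity)
      nlinarith [h]
  have h0 : 0 ≤ (aC * D + bC) * W ^ 2 := by positivity
  calc _ ≤ √(((aC * D + bC) * W ^ 2) ^ 2) := Real.sqrt_le_sqrt hmain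
    _ = (aC * D + bC) * W ^ 2 := Real.sqrt_sq h0
    _ ≤ _ := by gcongr
end
end

section
/- Let m ≥ 2 be an integer and p_m(t) = dist(t, {2πk/m : k ∈ ℤ}). Then ∫_{−π}^{π} |cos(z)|·√(p_m(z)) / |sin(z/2)| dz ≤ √(π/m)·(4π/(m·sin(π/(2m))) + √2·(π·log(m/2) + 2)), and ∫_{−π}^{π} |sin(z)|·√(p_m(z)) / |sin(z/2)| dz ≤ 8·√(π/m). -/
open Real MeasureTheory intervalIntegral

noncomputable section

/-- `p_m(t)`: the distance from `t` to the lattice `{2πk/m : k ∈ ℤ}`. -/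
def pm (m : ℕ) (t : ℝ) : ℝ :=
  Metric.infDist t (Set.range fun k : ℤ => 2 * π * (k:ℝ) / m)

lemma pm_le (m : ℕ) (hm : 2 ≤ m) (z : ℝ) : pm m z ≤ π / m := by
  have hm0 : (0:ℝ) < m := by positivity
  have h := Metric.infDist_le_dist_of_mem (x := z)
    (Set.mem_range_self (f := fun k : ℤ => 2 * π * (k:ℝ) / m) (round (z * m / (2 * π))))
  refine h.trans ?_
  have hr := abs_sub_round (z * m / (2 * π))
  have hpi := Real.pi_pos
  simp only [Real.dist_eq]
  have e : z - 2 * π * (round (z * m / (2 * π)) : ℝ) / m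
      = (2 * π / m) * (z * m / (2 * π) - (round (z * m / (2 * π)) : ℝ)) := by
    field_simp
  rw [e, abs_mul, abs_of_pos (by positivity : 0 < 2 * π / m)]
  calc 2 * π / m * |z * m / (2 * π) - (round (z * m / (2 * π)) : ℝ)|
      ≤ 2 * π / m * (1 / 2) := by gcongr
    _ = π / m := by ring

lemma pm_le_abs (m : ℕ) (z : ℝ) : pm m z ≤ |z| := by
  have h := Metric.infDist_le_dist_of_mem (x := z)
    (Set.mem_range_self (f := fun k : ℤ => 2 * π * (k:ℝ) / m) 0)
  simpa [Real.dist_eq, pm] using h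

lemma pm_cont (m : ℕ) : Continuous (pm m) := Metric.continuous_infDist_pt _

lemma dom {f g : ℝ → ℝ} {a b : ℝ} (hab : a ≤ b) (hf : Measurable f)
    (hg : IntervalIntegrable g volume a b) (h0 : ∀ x, 0 ≤ f x)
    (h : ∀ x ∈ Set.Ioo a b, f x ≤ g x) :
    IntervalIntegrable f volume a b ∧ ∫ x in a..b, f x ≤ ∫ x in a..b, g x := by
  have hi : IntervalIntegrable f volume a b := by
    rw [intervalIntegrable_iff_integrableOn_Ioo_of_le hab] at hg ⊢
    refine Integrable.mono' hg hf.aestronglyMeasurable ?_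
    filter_upwards [ae_restrict_mem measurableSet_Ioo] with x hx
    rw [Real.norm_eq_abs, abs_of_nonneg (h0 x)]
    exact h x hx
  exact ⟨hi, intervalIntegral.integral_mono_on_of_le_Ioo hab hi hg h⟩

/-- concavity bound -/
lemma sin_chord {a z : ℝ} (ha : 0 < a) (ha' : a ≤ π) (hz : 0 ≤ z) (hza : z ≤ a) :
    z / a * Real.sin (a / 2) ≤ Real.sin (z / 2) := by
  have hza1 : 0 ≤ 1 - z / a := by rw [sub_nonneg, div_le_one ha]; exact hza
  have hz1 : 0 ≤ z / a := by positivity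
  have m0 : (0:ℝ) ∈ Set.Icc 0 π := ⟨le_refl _, Real.pi_pos.le⟩
  have m1 : a / 2 ∈ Set.Icc 0 π := ⟨by linarith, by linarith⟩
  have hc := strictConcaveOn_sin_Icc.concaveOn.2 m0 m1 hza1 hz1 (by ring)
  simp only [smul_eq_mul, mul_zero, Real.sin_zero, zero_add] at hc
  have e : z / a * (a / 2) = z / 2 := by field_simp
  rwa [e] at hc

lemma half (m : ℕ) (hm : 2 ≤ m) (q : ℝ → ℝ) (hq : Continuous q)
    (h1 : ∀ z, q z ≤ π / m) (h2 : ∀ z, q z ≤ |z|) :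
    IntervalIntegrable (fun z => |Real.cos z| * Real.sqrt (q z) / |Real.sin (z / 2)|) volume 0 π ∧
    (∫ z in (0:ℝ)..π, |Real.cos z| * Real.sqrt (q z) / |Real.sin (z / 2)|) ≤
      Real.sqrt (π / m) *
        (4 * π / (m * Real.sin (π / (2 * m))) + Real.sqrt 2 * (π * Real.log (m / 2) + 2)) / 2 := by
  have hpi := Real.pi_pos
  have hm2 : (2:ℝ) ≤ m := by exact_mod_cast hm
  have hm0 : (0:ℝ) < m := by linarith
  have ha : 0 < π / m := by positivity
  have ha2 : π / m ≤ π / 2 := by gcongr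
  set f : ℝ → ℝ := fun z => |Real.cos z| * Real.sqrt (q z) / |Real.sin (z / 2)| with hfdef
  have hf : Measurable f := by
    have := hq.measurable
    fun_prop
  have h0 : ∀ x, 0 ≤ f x := fun x => by positivity
  have hs : 0 < Real.sin (π / m / 2) := Real.sin_pos_of_pos_of_lt_pi (by linarith) (by linarith)
  -- piece 1
  obtain ⟨i1, b1⟩ := dom (f := f)
    (g := fun z => (π / (m * Real.sin (π / m / 2))) * z ^ (-(1/2) : ℝ)) ha.le hf
    ((intervalIntegral.intervalIntegrable_rpow' (by norm_num)).const_mul _) h0 (by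
      rintro z ⟨hz, hza⟩
      have hc := sin_chord ha (by linarith) hz.le hza.le
      have hp : 0 < z / (π / m) * Real.sin (π / m / 2) := by positivity
      have hq2 : Real.sqrt (q z) ≤ Real.sqrt z :=
        Real.sqrt_le_sqrt ((h2 z).trans (by rw [abs_of_pos hz]))
      simp only [hfdef]
      rw [abs_of_pos (hp.trans_le hc)]
      calc |Real.cos z| * Real.sqrt (q z) / Real.sin (z / 2)
          ≤ 1 * Real.sqrt z / (z / (π / m) * Real.sin (π / m / 2)) := by
            gcongr
            exact Real.abs_cos_le_one z
        _ = _ := by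
            rw [Real.rpow_neg hz.le, ← Real.sqrt_eq_rpow]
            have hsz : 0 < Real.sqrt z := Real.sqrt_pos.2 hz
            have := Real.mul_self_sqrt hz.le
            generalize Real.sin (π / m / 2) = S at *
            field_simp
            rw [sq, this])
  have e1 : ∫ z in (0:ℝ)..(π / m), (π / (m * Real.sin (π / m / 2))) * z ^ (-(1/2) : ℝ)
      = Real.sqrt (π / m) * (4 * π / (m * Real.sin (π / m / 2))) / 2 := by
    rw [intervalIntegral.integral_const_mul, integral_rpow (Or.inl (by norm_num))]
    rw [Real.zero_rpow (by norm_num)]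
    have : (-(1/2) + 1 : ℝ) = 1 / 2 := by norm_num
    rw [this, ← Real.sqrt_eq_rpow]
    ring
  have hs4 : Real.sin (π / 2 / 2) = Real.sqrt 2 / 2 := by
    rw [← Real.sin_pi_div_four]; congr 1; ring
  have hr2 : 0 < Real.sqrt 2 := by positivity
  have hr22 : Real.sqrt 2 * Real.sqrt 2 = 2 := Real.mul_self_sqrt (by norm_num)
  have hsq : ∀ z, Real.sqrt (q z) ≤ Real.sqrt (π / m) := fun z => Real.sqrt_le_sqrt (h1 z)
  -- piece 2
  obtain ⟨i2, b2⟩ := dom (f := f)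
    (g := fun z => (Real.sqrt (π / m) * (π * Real.sqrt 2 / 2)) * z⁻¹) ha2 hf
    ((intervalIntegral.intervalIntegrable_inv (f := fun z => z) (by
      intro x hx
      rw [Set.uIcc_of_le ha2] at hx
      exact (ha.trans_le hx.1).ne') continuousOn_id).const_mul _) h0 (by
      rintro z ⟨hz, hza⟩
      have hz0 : 0 < z := ha.trans hz
      have hc := sin_chord (a := π / 2) (by linarith) (by linarith) hz0.le hza.le
      rw [hs4] at hc
      have hp : 0 < z / (π / 2) * (Real.sqrt 2 / 2) := by positivity
      simp only [hfdef]
      rw [abs_of_pos (hp.trans_le hc)]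
      calc |Real.cos z| * Real.sqrt (q z) / Real.sin (z / 2)
          ≤ 1 * Real.sqrt (π / m) / (z / (π / 2) * (Real.sqrt 2 / 2)) := by
            gcongr
            · exact Real.abs_cos_le_one z
            · exact h1 z
        _ = _ := by
            field_simp
            nlinarith)
  have e2 : ∫ z in (π / m)..(π / 2), (Real.sqrt (π / m) * (π * Real.sqrt 2 / 2)) * z⁻¹
      = Real.sqrt (π / m) * (Real.sqrt 2 * (π * Real.log (m / 2))) / 2 := by
    rw [intervalIntegral.integral_const_mul, integral_inv_of_pos ha (by positivity)]
    have : π / 2 / (π / m) = m / 2 := by field_simp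
    rw [this]
    ring
  -- piece 3
  obtain ⟨i3, b3⟩ := dom (f := f) (a := π / 2) (b := π)
    (g := fun z => (Real.sqrt (π / m) * Real.sqrt 2) * (-Real.cos z)) (by linarith) hf
    (Continuous.intervalIntegrable (by fun_prop) _ _) h0 (by
      rintro z ⟨hz, hza⟩
      have hc : Real.sin (π / 2 / 2) ≤ Real.sin (z / 2) :=
        Real.sin_le_sin_of_le_of_le_pi_div_two (by linarith) (by linarith) (by linarith)
      rw [hs4] at hc
      have hp : 0 < Real.sqrt 2 / 2 := by positivity
      have hcos : Real.cos z ≤ 0 :=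
        Real.cos_nonpos_of_pi_div_two_le_of_le hz.le (by linarith)
      simp only [hfdef]
      rw [abs_of_pos (hp.trans_le hc), abs_of_nonpos hcos]
      have hcos' : 0 ≤ -Real.cos z := by linarith
      calc (-Real.cos z) * Real.sqrt (q z) / Real.sin (z / 2)
          ≤ (-Real.cos z) * Real.sqrt (π / m) / (Real.sqrt 2 / 2) := by
            gcongr
            exact h1 z
        _ = _ := by
            rw [div_eq_iff hp.ne']
            linear_combination (Real.cos z * Real.sqrt (π / m) / 2) * hr22)
  have e3 : ∫ z in (π / 2)..π, (Real.sqrt (π / m) * Real.sqrt 2) * (-Real.cos z)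
      = Real.sqrt (π / m) * (Real.sqrt 2 * 2) / 2 := by
    rw [intervalIntegral.integral_const_mul, intervalIntegral.integral_neg, integral_cos]
    rw [Real.sin_pi, Real.sin_pi_div_two]
    ring
  refine ⟨(i1.trans i2).trans i3, ?_⟩
  rw [← intervalIntegral.integral_add_adjacent_intervals (i1.trans i2) i3,
    ← intervalIntegral.integral_add_adjacent_intervals i1 i2]
  have e : π / (2 * m) = π / m / 2 := by field_simp
  rw [e1] at b1
  rw [e2] at b2
  rw [e3] at b3
  rw [e]
  linarith

/-- Lemma A.2 (Integral bounds `I₁`). -/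
theorem stmt_19 (m : ℕ) (hm : 2 ≤ m) :
    (∫ z in (-π)..π, |Real.cos z| * Real.sqrt (pm m z) / |Real.sin (z / 2)|) ≤
      Real.sqrt (π / m) *
        (4 * π / (m * Real.sin (π / (2 * m))) + Real.sqrt 2 * (π * Real.log (m / 2) + 2)) ∧
    (∫ z in (-π)..π, |Real.sin z| * Real.sqrt (pm m z) / |Real.sin (z / 2)|) ≤
      8 * Real.sqrt (π / m) := by
  have hpi := Real.pi_pos
  constructor
  · obtain ⟨i1, b1⟩ := half m hm (pm m) (pm_cont m) (pm_le m hm) (pm_le_abs m)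
    obtain ⟨i2, b2⟩ := half m hm (fun z => pm m (-z)) ((pm_cont m).comp continuous_neg)
      (fun z => pm_le m hm _) (fun z => by simpa using pm_le_abs m (-z))
    have e := intervalIntegral.integral_comp_neg (a := 0) (b := π)
      (fun z => |Real.cos z| * Real.sqrt (pm m z) / |Real.sin (z / 2)|)
    have i3 : IntervalIntegrable
        (fun z => |Real.cos z| * Real.sqrt (pm m z) / |Real.sin (z / 2)|) volume (-π) 0 := by
      rw [← neg_zero, IntervalIntegrable.iff_comp_neg] at i2
      simpa [neg_div] using i2.symm
    simp only [Real.cos_neg, neg_div, Real.sin_neg, abs_neg, neg_zero] at e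
    rw [← intervalIntegral.integral_add_adjacent_intervals i3 i1, ← e]
    linarith
  · have hf : Measurable (fun z => |Real.sin z| * Real.sqrt (pm m z) / |Real.sin (z / 2)|) := by
      have := (pm_cont m).measurable
      fun_prop
    obtain ⟨-, b⟩ := dom (a := -π) (b := π)
      (g := fun z => (2 * Real.sqrt (π / m)) * Real.cos (z / 2)) (by linarith) hf
      (Continuous.intervalIntegrable (by fun_prop) _ _) (fun x => by positivity) (by
        rintro z ⟨hz, hz'⟩
        have hc : 0 ≤ Real.cos (z / 2) :=
          Real.cos_nonneg_of_mem_Icc ⟨by linarith, by linarith⟩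
        have hs : Real.sin z = 2 * Real.sin (z / 2) * Real.cos (z / 2) := by
          rw [← Real.sin_two_mul]; congr 1; ring
        refine div_le_of_le_mul₀ (abs_nonneg _) (by positivity) ?_
        rw [hs, abs_mul, abs_mul, abs_of_nonneg hc, abs_two]
        have := Real.sqrt_le_sqrt (pm_le m hm z)
        calc 2 * |Real.sin (z / 2)| * Real.cos (z / 2) * Real.sqrt (pm m z)
            ≤ 2 * |Real.sin (z / 2)| * Real.cos (z / 2) * Real.sqrt (π / m) := by gcongr
          _ = _ := by ring)
    refine b.trans (le_of_eq ?_)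
    rw [intervalIntegral.integral_const_mul,
      intervalIntegral.integral_comp_div (fun x => Real.cos x) (two_ne_zero), integral_cos]
    rw [neg_div, Real.sin_neg, Real.sin_pi_div_two]
    simp only [smul_eq_mul]
    ring
end
end
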